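/- Let H and K be two infinite, finitely generated groups with decidable word problem. Then M_SFT(H × K) equals the set of all Π⁰₁ Medvedev degrees. -/

import Mathlib

namespace MedvedevFormal

/-! ### Medvedev reducibility on Baire space -/

/-- The finite prefix of length `k` of a point of Baire space, as a list. -/
def pref (x : ℕ → ℕ) (k : ℕ) : List ℕ := (List.range k).map x

/-- Medvedev reducibility `m(P) ≤ m(Q)` between subsets of Baire space: some computable
monotone prefix-functional (i.e. a partial computable type-two functional), defined on all
of `Q`, maps every element of `Q` to an element of `P`. -/
def BaireLE (P Q : Set (ℕ → ℕ)) : Prop :=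
  ∃ φ : List ℕ → List ℕ, Computable φ ∧
    (∀ l₁ l₂ : List ℕ, l₁ <+: l₂ → φ l₁ <+: φ l₂) ∧
    ∀ x ∈ Q, ∃ y ∈ P, ∀ n : ℕ, ∃ k : ℕ, (φ (pref x k))[n]? = some (y n)

/-- Medvedev equivalence: `m(P) = m(Q)`. -/
def BaireEquiv (P Q : Set (ℕ → ℕ)) : Prop := BaireLE P Q ∧ BaireLE Q P

/-- A canonical representative of the join `m(P) ∨ m(Q)`. -/
def joinSet (P Q : Set (ℕ → ℕ)) : Set (ℕ → ℕ) :=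
  {x | (fun n => x (2 * n)) ∈ P ∧ (fun n => x (2 * n + 1)) ∈ Q}

/-- A canonical representative of the meet `m(P) ∧ m(Q)`. -/
def meetSet (P Q : Set (ℕ → ℕ)) : Set (ℕ → ℕ) :=
  {x | (x 0 = 0 ∧ (fun n => x (n + 1)) ∈ P) ∨ (x 0 = 1 ∧ (fun n => x (n + 1)) ∈ Q)}

/-- `P` has the zero Medvedev degree `0_M`: it contains a computable point. -/
def IsZeroDeg (P : Set (ℕ → ℕ)) : Prop := ∃ y ∈ P, Computable y

/-- The cylinder of a finite word in Baire space. -/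
def cylinder (l : List ℕ) : Set (ℕ → ℕ) :=
  {x | ∀ (i : ℕ) (h : i < l.length), x i = l[i]}

/-- Cantor space `{0,1}^ℕ` inside Baire space. -/
def cantorSpace : Set (ℕ → ℕ) := {x | ∀ n, x n ≤ 1}

/-- `P` is an effectively closed (`Π⁰₁`) subset of Cantor space: its complement within
Cantor space is the union of the cylinders of a computably enumerable sequence of words. -/
def IsPi01Cantor (P : Set (ℕ → ℕ)) : Prop :=
  ∃ f : ℕ → List ℕ, Computable f ∧ P = cantorSpace \ ⋃ n, cylinder (f n)

/-- The Medvedev degree of `P` is a `Π⁰₁` Medvedev degree. -/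
def IsPi01Deg (P : Set (ℕ → ℕ)) : Prop :=
  ∃ Q, IsPi01Cantor Q ∧ Q.Nonempty ∧ BaireEquiv P Q

/-- `P` realizes the maximal `Π⁰₁` Medvedev degree (the degree of the class of complete
consistent extensions of Peano arithmetic): it is a nonempty `Π⁰₁` subset of Cantor space
to which every nonempty `Π⁰₁` subset of Cantor space is Medvedev reducible. -/
def IsMaxPi01 (P : Set (ℕ → ℕ)) : Prop :=
  IsPi01Cantor P ∧ P.Nonempty ∧ ∀ Q, IsPi01Cantor Q → Q.Nonempty → BaireLE Q P

/-! ### Encoding of configuration spaces -/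

/-- The canonical encoding of a configuration `x : α → A` as a point of Baire space. -/
def confFun {α A : Type*} [Encodable α] [Encodable A] (x : α → A) : ℕ → ℕ :=
  fun n => Encodable.encode ((Encodable.decode (α := α) n).map x)

/-- The image of a set of configurations in Baire space, used to measure its
Medvedev degree. -/
def mSet {α A : Type*} [Encodable α] [Encodable A] (X : Set (α → A)) : Set (ℕ → ℕ) :=
  confFun '' X

/-- A configuration is computable if its Baire-space encoding is computable. -/
def ComputablePoint {α A : Type*} [Encodable α] [Encodable A] (x : α → A) : Prop :=
  Computable (confFun x)

/-- `m(X) ≤ m(Y)` for sets of configurations. -/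
def MedLE {α A β B : Type*} [Encodable α] [Encodable A] [Encodable β] [Encodable B]
    (X : Set (α → A)) (Y : Set (β → B)) : Prop :=
  BaireLE (mSet X) (mSet Y)

/-- `m(X) = m(Y)` for sets of configurations. -/
def MedEquiv {α A β B : Type*} [Encodable α] [Encodable A] [Encodable β] [Encodable B]
    (X : Set (α → A)) (Y : Set (β → B)) : Prop :=
  MedLE X Y ∧ MedLE Y X

/-! ### Subshifts -/

/-- The left shift action: `(g • x) h = x (g⁻¹ h)`. -/
def shift {G A : Type*} [Group G] (g : G) (x : G → A) : G → A := fun h => x (g⁻¹ * h)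

/-- The prodiscrete topology on `A^G`. -/
def prodiscrete (G A : Type*) : TopologicalSpace (G → A) :=
  @Pi.topologicalSpace G (fun _ => A) fun _ => ⊥

/-- A subshift: a shift-invariant subset of `A^G`, closed in the prodiscrete topology. -/
def IsSubshift {G A : Type*} [Group G] (X : Set (G → A)) : Prop :=
  (∀ x ∈ X, ∀ g : G, shift g x ∈ X) ∧ @IsClosed (G → A) (prodiscrete G A) X

/-- A pattern: a map `p : D → A` with `D ⊆ G` finite. -/
structure Pattern (G A : Type*) where
  dom : Finset G
  val : {g // g ∈ dom} → A

/-- The translate `g • x` agrees with the pattern `p` on its domain. -/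
def MatchesAt {G A : Type*} [Group G] (p : Pattern G A) (g : G) (x : G → A) : Prop :=
  ∀ h : {g' // g' ∈ p.dom}, shift g x h = p.val h

/-- A subshift of finite type: defined by a finite list of forbidden patterns. -/
def IsSFT {G A : Type*} [Group G] (X : Set (G → A)) : Prop :=
  ∃ F : List (Pattern G A), X = {x | ∀ p ∈ F, ∀ g : G, ¬MatchesAt p g x}

/-- A morphism between subshifts: a continuous shift-equivariant map from `X` to `Y`. -/
def IsMorphism {G A B : Type*} [Group G] (X : Set (G → A)) (Y : Set (G → B))
    (φ : (G → A) → (G → B)) : Prop :=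
  Set.MapsTo φ X Y ∧
    @ContinuousOn (G → A) (G → B) (prodiscrete G A) (prodiscrete G B) φ X ∧
    ∀ x ∈ X, ∀ g : G, φ (shift g x) = shift g (φ x)

/-- A sofic subshift: the image of an SFT (on some finite alphabet) under a topological
factor map. -/
def IsSofic {G A : Type*} [Group G] (X : Set (G → A)) : Prop :=
  ∃ (B : Type) (_ : Finite B) (Y : Set (G → B)) (φ : (G → B) → (G → A)),
    IsSFT Y ∧ IsMorphism Y X φ ∧ φ '' Y = X

/-! ### Finitely generated groups, covers and pullbacks -/

/-- `σ` enumerates a finite symmetric generating set of `G`. -/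
def IsSymmGen {G : Type*} [Group G] {k : ℕ} (σ : Fin k → G) : Prop :=
  Subgroup.closure (Set.range σ) = ⊤ ∧ ∀ i, (σ i)⁻¹ ∈ Set.range σ

/-- The canonical encoding of a free group via reduced words. -/
instance freeGroupEncodable {α : Type*} [DecidableEq α] [Encodable α] :
    Encodable (FreeGroup α) :=
  Encodable.ofLeftInjection FreeGroup.toWord (fun l => some (FreeGroup.mk l))
    fun _ => congrArg some FreeGroup.mk_toWord

/-- The canonical homomorphism from the free group determined by `σ`. -/
def cover {G : Type*} [Group G] {k : ℕ} (σ : Fin k → G) : FreeGroup (Fin k) →* G :=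
  FreeGroup.lift σ

/-- The pullback of a subshift along a group homomorphism. -/
def pullback {K G A : Type*} [Group K] [Group G] (ρ : K →* G) (X : Set (G → A)) :
    Set (K → A) :=
  (fun x => x ∘ ρ) '' X

/-- The group element represented by a word over the generators. -/
def wordVal {G : Type*} [Group G] {k : ℕ} (σ : Fin k → G) (w : List (Fin k × Bool)) : G :=
  cover σ (FreeGroup.mk w)

/-- `G` is recursively presented w.r.t. `σ`: its word problem is recursively enumerable. -/
def RecursivelyPresented {G : Type*} [Group G] {k : ℕ} (σ : Fin k → G) : Prop :=
  ∃ f : ℕ → Option (List (Fin k × Bool)), Computable f ∧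
    ∀ w : List (Fin k × Bool), (wordVal σ w = 1 ↔ ∃ n, f n = some w)

/-- The membership problem of the subgroup `H` in `G` is decidable w.r.t. `σ`. -/
def DecidableMembership {G : Type*} [Group G] {k : ℕ} (σ : Fin k → G)
    (H : Subgroup G) : Prop :=
  ∃ φ : List (Fin k × Bool) → Bool, Computable φ ∧
    ∀ w : List (Fin k × Bool), (φ w = true ↔ wordVal σ w ∈ H)

/-- `G` has decidable word problem w.r.t. `σ`. -/
def DecidableWordProblem {G : Type*} [Group G] {k : ℕ} (σ : Fin k → G) : Prop :=
  ∃ φ : List (Fin k × Bool) → Bool, Computable φ ∧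
    ∀ w : List (Fin k × Bool), (φ w = true ↔ wordVal σ w = 1)

/-- The set of configurations on the free group matching a coded pattern: a pattern is
coded as a list of pairs (code of a group element, code of a letter). -/
def codedCylinder {k : ℕ} {A : Type*} [Encodable A] (p : List (ℕ × ℕ)) :
    Set (FreeGroup (Fin k) → A) :=
  {x | ∀ q ∈ p, ∀ g : FreeGroup (Fin k),
    Encodable.encode g = q.1 → Encodable.encode (x g) = q.2}

/-- `X` is an effective subshift: the complement of its pullback to the free group is the
union of the cylinders of a computably enumerable sequence of finitely supported patterns. -/
def IsEffective {G : Type*} [Group G] {k : ℕ} (σ : Fin k → G) {A : Type*} [Encodable A]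
    (X : Set (G → A)) : Prop :=
  ∃ f : ℕ → List (ℕ × ℕ), Computable f ∧
    (pullback (cover σ) X)ᶜ = ⋃ n, codedCylinder (f n)

/-! ### Degree spectra -/

/-- The Medvedev degree of `P` belongs to `M_SFT(G)`: some nonempty `G`-SFT has the
Medvedev degree of `P`. -/
def IsSFTDeg {G : Type*} [Group G] {k : ℕ} (σ : Fin k → G) (P : Set (ℕ → ℕ)) : Prop :=
  ∃ (n : ℕ) (X : Set (G → Fin n)), IsSFT X ∧ X.Nonempty ∧
    BaireEquiv (mSet (pullback (cover σ) X)) P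

/-- The Medvedev degree of `P` belongs to `M_sof(G)`. -/
def IsSoficDeg {G : Type*} [Group G] {k : ℕ} (σ : Fin k → G) (P : Set (ℕ → ℕ)) : Prop :=
  ∃ (n : ℕ) (X : Set (G → Fin n)), IsSofic X ∧ X.Nonempty ∧
    BaireEquiv (mSet (pullback (cover σ) X)) P

/-- The Medvedev degree of `P` belongs to `M_eff(G)`. -/
def IsEffDeg {G : Type*} [Group G] {k : ℕ} (σ : Fin k → G) (P : Set (ℕ → ℕ)) : Prop :=
  ∃ (n : ℕ) (X : Set (G → Fin n)), IsSubshift X ∧ IsEffective σ X ∧ X.Nonempty ∧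
    BaireEquiv (mSet (pullback (cover σ) X)) P

/-! ### Word metrics and quasi-isometries -/

/-- The word length of `g` w.r.t. the (symmetric) generating map `σ`. -/
noncomputable def wordNorm {G : Type*} [Group G] {k : ℕ} (σ : Fin k → G) (g : G) : ℕ :=
  sInf {n | ∃ w : List (Fin k), w.length = n ∧ (w.map σ).prod = g}

/-- The word metric on `G` w.r.t. `σ`, as a real number. -/
noncomputable def wordDist {G : Type*} [Group G] {k : ℕ} (σ : Fin k → G) (g g' : G) : ℝ :=
  (wordNorm σ (g⁻¹ * g') : ℝ)

/-- `f : G → H` is a quasi-isometry w.r.t. the word metrics given by `σ` and `τ`. -/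
def IsQIGroups {G H : Type*} [Group G] [Group H] {k r : ℕ} (σ : Fin k → G)
    (τ : Fin r → H) (f : G → H) : Prop :=
  ∃ C : ℝ, 1 ≤ C ∧
    (∀ g g' : G, (1 / C) * wordDist σ g g' - C ≤ wordDist τ (f g) (f g') ∧
      wordDist τ (f g) (f g') ≤ C * wordDist σ g g' + C) ∧
    ∀ h : H, ∃ g : G, wordDist τ h (f g) ≤ C

/-- `f : G → Y` is a quasi-isometry from the group `G` (with word metric from `σ`) to the
metric space `Y`. -/
def IsQIToSpace {G : Type*} [Group G] {k : ℕ} (σ : Fin k → G) {Y : Type*}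
    [MetricSpace Y] (f : G → Y) : Prop :=
  ∃ C : ℝ, 1 ≤ C ∧
    (∀ g g' : G, (1 / C) * wordDist σ g g' - C ≤ dist (f g) (f g') ∧
      dist (f g) (f g') ≤ C * wordDist σ g g' + C) ∧
    ∀ y : Y, ∃ g : G, dist y (f g) ≤ C

/-- `f : G → H` is computable w.r.t. the generating maps `σ` and `τ`: some computable map
on words sends each word representing `g` to a word representing `f g`. -/
def ComputableMap {G H : Type*} [Group G] [Group H] {k r : ℕ} (σ : Fin k → G)
    (τ : Fin r → H) (f : G → H) : Prop :=
  ∃ φ : List (Fin k × Bool) → List (Fin r × Bool), Computable φ ∧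
    ∀ w : List (Fin k × Bool), wordVal τ (φ w) = f (wordVal σ w)

attribute [fun_prop] Computable

/-! ### Closure properties of computable functions -/

section ComputableCalculus

variable {α β γ δ σ : Type*} [Primcodable α] [Primcodable β] [Primcodable γ] [Primcodable δ]
  [Primcodable σ]

@[fun_prop] theorem C_id : Computable (fun a : α => a) := Computable.id

@[fun_prop] theorem C_const (b : β) : Computable (fun _ : α => b) := Computable.const b

@[fun_prop] theorem C_comp {f : β → γ} {g : α → β} (hf : Computable f) (hg : Computable g) :
    Computable (fun a => f (g a)) := hf.comp hg

@[fun_prop] theorem C_fst {f : α → β × γ} (hf : Computable f) :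
    Computable (fun a => (f a).1) := Computable.fst.comp hf

@[fun_prop] theorem C_snd {f : α → β × γ} (hf : Computable f) :
    Computable (fun a => (f a).2) := Computable.snd.comp hf

@[fun_prop] theorem C_pair {f : α → β} {g : α → γ} (hf : Computable f) (hg : Computable g) :
    Computable (fun a => (f a, g a)) := hf.pair hg

@[fun_prop] theorem C_add {f g : α → ℕ} (hf : Computable f) (hg : Computable g) :
    Computable (fun a => f a + g a) := Primrec.nat_add.to_comp.comp hf hg

@[fun_prop] theorem C_sub {f g : α → ℕ} (hf : Computable f) (hg : Computable g) :
    Computable (fun a => f a - g a) := Primrec.nat_sub.to_comp.comp hf hg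

@[fun_prop] theorem C_mul {f g : α → ℕ} (hf : Computable f) (hg : Computable g) :
    Computable (fun a => f a * g a) := Primrec.nat_mul.to_comp.comp hf hg

@[fun_prop] theorem C_div {f g : α → ℕ} (hf : Computable f) (hg : Computable g) :
    Computable (fun a => f a / g a) := Primrec.nat_div.to_comp.comp hf hg

@[fun_prop] theorem C_mod {f g : α → ℕ} (hf : Computable f) (hg : Computable g) :
    Computable (fun a => f a % g a) := Primrec.nat_mod.to_comp.comp hf hg

@[fun_prop] theorem C_natRec {f : α → ℕ} {g : α → σ} {h : α → ℕ → σ → σ} (hf : Computable f)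
    (hg : Computable g) (hh : Computable (fun p : α × ℕ × σ => h p.1 p.2.1 p.2.2)) :
    Computable (fun a => Nat.rec (motive := fun _ => σ) (g a) (h a) (f a)) :=
  Computable.nat_rec hf hg hh.to₂

@[fun_prop] theorem C_pow {f g : α → ℕ} (hf : Computable f) (hg : Computable g) :
    Computable (fun a => f a ^ g a) := by
  have h : Computable (fun a => Nat.rec (motive := fun _ => ℕ) 1 (fun _ x => x * f a) (g a)) := by
    fun_prop
  refine h.of_eq fun a => ?_
  induction g a with
  | zero => rfl
  | succ n ih => rw [pow_succ, ← ih]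

@[fun_prop] theorem C_encode {f : α → β} (hf : Computable f) :
    Computable (fun a => Encodable.encode (f a)) := Computable.encode.comp hf

@[fun_prop] theorem C_decode {f : α → ℕ} (hf : Computable f) :
    Computable (fun a => (Encodable.decode (f a) : Option β)) := Computable.decode.comp hf

@[fun_prop] theorem C_unpair {f : α → ℕ} (hf : Computable f) :
    Computable (fun a => Nat.unpair (f a)) := Computable.unpair.comp hf

@[fun_prop] theorem C_natPair {f g : α → ℕ} (hf : Computable f) (hg : Computable g) :
    Computable (fun a => Nat.pair (f a) (g a)) := Primrec₂.natPair.to_comp.comp hf hg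

@[fun_prop] theorem C_min {f g : α → ℕ} (hf : Computable f) (hg : Computable g) :
    Computable (fun a => min (f a) (g a)) := Primrec.nat_min.to_comp.comp hf hg

/-- The truth value of a proposition. -/
@[irreducible] noncomputable def dec (p : Prop) : Bool := @decide p (Classical.propDecidable p)

@[simp] theorem dec_eq_true {p : Prop} : dec p = true ↔ p := by
  unfold dec
  simp

@[simp] theorem dec_eq_false {p : Prop} : dec p = false ↔ ¬p := by
  rw [← not_congr dec_eq_true, Bool.not_eq_true]

theorem dec_eq_decide (p : Prop) [Decidable p] : dec p = decide p := by
  rw [Bool.eq_iff_iff]; simp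

@[fun_prop] theorem C_decide {p : α → Prop} [∀ a, Decidable (p a)]
    (h : Computable (fun a => dec (p a))) : Computable (fun a => decide (p a)) :=
  h.of_eq fun _ => dec_eq_decide _

@[fun_prop] theorem C_dec_lt {f g : α → ℕ} (hf : Computable f)
    (hg : Computable g) : Computable (fun a => dec (f a < g a)) :=
  ((Primrec.nat_lt.decide.to_comp).comp hf hg).of_eq fun _ => (dec_eq_decide _).symm

@[fun_prop] theorem C_dec_le {f g : α → ℕ} (hf : Computable f)
    (hg : Computable g) : Computable (fun a => dec (f a ≤ g a)) :=
  ((Primrec.nat_le.decide.to_comp).comp hf hg).of_eq fun _ => (dec_eq_decide _).symm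

@[fun_prop] theorem C_dec_eq {f g : α → β} (hf : Computable f)
    (hg : Computable g) : Computable (fun a => dec (f a = g a)) := by
  classical
  exact ((Primrec.eq.decide.to_comp).comp hf hg).of_eq fun _ => (dec_eq_decide _).symm

@[fun_prop] theorem C_band {f g : α → Bool} (hf : Computable f) (hg : Computable g) :
    Computable (fun a => f a && g a) := Primrec.and.to_comp.comp hf hg

@[fun_prop] theorem C_bor {f g : α → Bool} (hf : Computable f) (hg : Computable g) :
    Computable (fun a => f a || g a) := Primrec.or.to_comp.comp hf hg

@[fun_prop] theorem C_bnot {f : α → Bool} (hf : Computable f) :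
    Computable (fun a => !f a) := Primrec.not.to_comp.comp hf

@[fun_prop] theorem C_beq [DecidableEq β] {f g : α → β} (hf : Computable f) (hg : Computable g) :
    Computable (fun a => f a == g a) :=
  (C_dec_eq hf hg).of_eq fun a => by rw [Bool.eq_iff_iff]; simp

@[fun_prop] theorem C_dec_and {p q : α → Prop} (hf : Computable (fun a => dec (p a)))
    (hg : Computable (fun a => dec (q a))) : Computable (fun a => dec (p a ∧ q a)) :=
  (C_band hf hg).of_eq fun a => by rw [Bool.eq_iff_iff]; simp

@[fun_prop] theorem C_dec_or {p q : α → Prop} (hf : Computable (fun a => dec (p a)))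
    (hg : Computable (fun a => dec (q a))) : Computable (fun a => dec (p a ∨ q a)) :=
  (C_bor hf hg).of_eq fun a => by rw [Bool.eq_iff_iff]; simp

@[fun_prop] theorem C_dec_not {p : α → Prop} (hf : Computable (fun a => dec (p a))) :
    Computable (fun a => dec (¬ p a)) :=
  (C_bnot hf).of_eq fun a => by rw [Bool.eq_iff_iff]; simp

@[fun_prop] theorem C_dec_imp {p q : α → Prop} (hf : Computable (fun a => dec (p a)))
    (hg : Computable (fun a => dec (q a))) : Computable (fun a => dec (p a → q a)) :=
  (C_bor (C_bnot hf) hg).of_eq fun a => by rw [Bool.eq_iff_iff]; simp [imp_iff_not_or]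

@[fun_prop] theorem C_cond {c : α → Bool} {f g : α → β} (hc : Computable c) (hf : Computable f)
    (hg : Computable g) : Computable (fun a => bif c a then f a else g a) :=
  Computable.cond hc hf hg

@[fun_prop] theorem C_ite {p : α → Prop} [∀ a, Decidable (p a)] {f g : α → β}
    (hp : Computable (fun a => dec (p a))) (hf : Computable f) (hg : Computable g) :
    Computable (fun a => if p a then f a else g a) :=
  (C_cond hp hf hg).of_eq fun a => by by_cases h : p a <;> simp [h, Bool.cond_eq_ite]

@[fun_prop] theorem C_some {f : α → β} (hf : Computable f) :
    Computable (fun a => some (f a)) := Computable.option_some.comp hf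

@[fun_prop] theorem C_optionElim {o : α → Option β} {f : α → σ} {g : α → β → σ}
    (ho : Computable o) (hf : Computable f) (hg : Computable (fun p : α × β => g p.1 p.2)) :
    Computable (fun a => (o a).elim (f a) (g a)) :=
  (Computable.option_casesOn ho hf hg.to₂).of_eq fun a => by cases o a <;> rfl

@[fun_prop] theorem C_optionBind {o : α → Option β} {g : α → β → Option σ}
    (ho : Computable o) (hg : Computable (fun p : α × β => g p.1 p.2)) :
    Computable (fun a => (o a).bind (g a)) := Computable.option_bind ho hg.to₂

@[fun_prop] theorem C_optionMap {o : α → Option β} {g : α → β → σ}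
    (ho : Computable o) (hg : Computable (fun p : α × β => g p.1 p.2)) :
    Computable (fun a => (o a).map (g a)) := Computable.option_map ho hg.to₂

@[fun_prop] theorem C_optionGetD {o : α → Option β} {f : α → β}
    (ho : Computable o) (hf : Computable f) :
    Computable (fun a => (o a).getD (f a)) := Computable.option_getD ho hf

@[fun_prop] theorem C_cons {f : α → β} {g : α → List β} (hf : Computable f) (hg : Computable g) :
    Computable (fun a => f a :: g a) := Computable.list_cons.comp hf hg

@[fun_prop] theorem C_append {f g : α → List β} (hf : Computable f) (hg : Computable g) :
    Computable (fun a => f a ++ g a) := Computable.list_append.comp hf hg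

@[fun_prop] theorem C_length {f : α → List β} (hf : Computable f) :
    Computable (fun a => (f a).length) := Computable.list_length.comp hf

@[fun_prop] theorem C_reverse {f : α → List β} (hf : Computable f) :
    Computable (fun a => (f a).reverse) := Computable.list_reverse.comp hf

@[fun_prop] theorem C_getElem? {f : α → List β} {g : α → ℕ} (hf : Computable f)
    (hg : Computable g) : Computable (fun a => (f a)[g a]?) :=
  Computable.list_getElem?.comp hf hg

@[fun_prop] theorem C_take {f : α → List β} {g : α → ℕ} (hf : Computable f)
    (hg : Computable g) : Computable (fun a => (f a).take (g a)) :=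
  Primrec.list_take.to_comp.comp hg hf

@[fun_prop] theorem C_drop {f : α → List β} {g : α → ℕ} (hf : Computable f)
    (hg : Computable g) : Computable (fun a => (f a).drop (g a)) :=
  Primrec.list_drop.to_comp.comp hg hf

@[fun_prop] theorem C_range {f : α → ℕ} (hf : Computable f) :
    Computable (fun a => List.range (f a)) := Primrec.list_range.to_comp.comp hf

@[fun_prop] theorem C_flatten {f : α → List (List β)} (hf : Computable f) :
    Computable (fun a => (f a).flatten) := Primrec.list_flatten.to_comp.comp hf

@[fun_prop] theorem C_head? {f : α → List β} (hf : Computable f) :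
    Computable (fun a => (f a).head?) := Primrec.list_head?.to_comp.comp hf

@[fun_prop] theorem C_foldl {l : α → List β} {s : α → σ} {h : α → σ → β → σ}
    (hl : Computable l) (hs : Computable s)
    (hh : Computable (fun p : α × σ × β => h p.1 p.2.1 p.2.2)) :
    Computable (fun a => (l a).foldl (h a) (s a)) := by
  have hh' : Computable (fun p : (α × ℕ × σ) × β => h p.1.1 p.1.2.2 p.2) :=
    hh.comp (g := fun p : (α × ℕ × σ) × β => (p.1.1, p.1.2.2, p.2)) (by fun_prop)
  have h1 : Computable (fun a => Nat.rec (motive := fun _ => σ) (s a)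
      (fun n acc => ((l a)[n]?).elim acc (fun b => h a acc b)) (l a).length) := by
    fun_prop
  refine h1.of_eq fun a => ?_
  have key : ∀ n, n ≤ (l a).length → Nat.rec (motive := fun _ => σ) (s a)
      (fun n acc => ((l a)[n]?).elim acc (fun b => h a acc b)) n
      = ((l a).take n).foldl (h a) (s a) := by
    intro n hn
    induction n with
    | zero => simp
    | succ n ih =>
      rw [List.take_add_one, List.foldl_append]
      dsimp only
      rw [ih (by omega)]
      simp [List.getElem?_eq_getElem (show n < (l a).length by omega)]
  rw [key _ le_rfl, List.take_length]

@[fun_prop] theorem C_map {l : α → List β} {h : α → β → σ}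
    (hl : Computable l) (hh : Computable (fun p : α × β => h p.1 p.2)) :
    Computable (fun a => (l a).map (h a)) := by
  have hh' : Computable (fun p : α × List σ × β => h p.1 p.2.2) :=
    hh.comp (g := fun p : α × List σ × β => (p.1, p.2.2)) (by fun_prop)
  have h1 : Computable (fun a => ((l a).foldl (fun acc b => acc ++ [h a b]) [])) := by fun_prop
  refine h1.of_eq fun a => ?_
  have : ∀ (m : List β) (acc : List σ),
      m.foldl (fun acc b => acc ++ [h a b]) acc = acc ++ m.map (h a) := by
    intro m
    induction m with
    | nil => simp
    | cons b m ih => intro acc; simp [ih]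
  simpa using this (l a) []

@[fun_prop] theorem C_flatMap {l : α → List β} {h : α → β → List σ}
    (hl : Computable l) (hh : Computable (fun p : α × β => h p.1 p.2)) :
    Computable (fun a => (l a).flatMap (h a)) := C_flatten (C_map hl hh)

@[fun_prop] theorem C_filter {l : α → List β} {h : α → β → Bool}
    (hl : Computable l) (hh : Computable (fun p : α × β => h p.1 p.2)) :
    Computable (fun a => (l a).filter (h a)) := by
  have h1 : Computable (fun a => (l a).flatMap (fun b => bif h a b then [b] else [])) := by
    fun_prop
  refine h1.of_eq fun a => ?_
  induction l a with
  | nil => rfl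
  | cons b m ih => cases hb : h a b <;> simp [hb, ih]

@[fun_prop] theorem C_all {l : α → List β} {h : α → β → Bool}
    (hl : Computable l) (hh : Computable (fun p : α × β => h p.1 p.2)) :
    Computable (fun a => (l a).all (h a)) := by
  have h1 : Computable (fun a => dec (((l a).filter (fun b => !h a b)).length = 0)) := by
    fun_prop
  refine h1.of_eq fun a => ?_
  rw [Bool.eq_iff_iff]; simp

@[fun_prop] theorem C_any {l : α → List β} {h : α → β → Bool}
    (hl : Computable l) (hh : Computable (fun p : α × β => h p.1 p.2)) :
    Computable (fun a => (l a).any (h a)) := by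
  have h1 : Computable (fun a => !((l a).all (fun b => !h a b))) := by fun_prop
  refine h1.of_eq fun a => ?_
  rw [Bool.eq_iff_iff]; simp

@[fun_prop] theorem C_dec_forall_mem {l : α → List β} {p : α → β → Prop}
    (hl : Computable l) (hh : Computable (fun q : α × β => dec (p q.1 q.2))) :
    Computable (fun a => dec (∀ b ∈ l a, p a b)) :=
  (C_all (h := fun a b => dec (p a b)) hl hh).of_eq fun a => by rw [Bool.eq_iff_iff]; simp

@[fun_prop] theorem C_dec_exists_mem {l : α → List β} {p : α → β → Prop}
    (hl : Computable l) (hh : Computable (fun q : α × β => dec (p q.1 q.2))) :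
    Computable (fun a => dec (∃ b ∈ l a, p a b)) :=
  (C_any (h := fun a b => dec (p a b)) hl hh).of_eq fun a => by rw [Bool.eq_iff_iff]; simp

@[fun_prop] theorem C_dec_forall_lt {f : α → ℕ} {p : α → ℕ → Prop}
    (hl : Computable f) (hh : Computable (fun q : α × ℕ => dec (p q.1 q.2))) :
    Computable (fun a => dec (∀ b < f a, p a b)) :=
  (C_all (l := fun a => List.range (f a)) (h := fun a b => dec (p a b))
    (by fun_prop) hh).of_eq fun a => by rw [Bool.eq_iff_iff]; simp

@[fun_prop] theorem C_dec_exists_lt {f : α → ℕ} {p : α → ℕ → Prop}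
    (hl : Computable f) (hh : Computable (fun q : α × ℕ => dec (p q.1 q.2))) :
    Computable (fun a => dec (∃ b < f a, p a b)) :=
  (C_any (l := fun a => List.range (f a)) (h := fun a b => dec (p a b))
    (by fun_prop) hh).of_eq fun a => by rw [Bool.eq_iff_iff]; simp

@[fun_prop] theorem C_dec_mem {l : α → List β} {f : α → β}
    (hl : Computable l) (hf : Computable f) : Computable (fun a => dec (f a ∈ l a)) := by
  classical
  have h1 : Computable (fun a => dec (∃ b ∈ l a, b = f a)) := by fun_prop
  exact h1.of_eq fun a => by rw [Bool.eq_iff_iff]; simp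

@[fun_prop] theorem C_iterate {f : α → ℕ} {g : α → σ} {h : α → σ → σ} (hf : Computable f)
    (hg : Computable g) (hh : Computable (fun p : α × σ => h p.1 p.2)) :
    Computable (fun a => (h a)^[f a] (g a)) := by
  have hh' : Computable (fun p : α × ℕ × σ => h p.1 p.2.2) :=
    hh.comp (g := fun p : α × ℕ × σ => (p.1, p.2.2)) (by fun_prop)
  have h1 : Computable (fun a => Nat.rec (motive := fun _ => σ) (g a) (fun _ x => h a x) (f a)) := by
    fun_prop
  refine h1.of_eq fun a => ?_
  induction f a with
  | zero => rfl
  | succ n ih => rw [Function.iterate_succ_apply', ← ih]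

theorem computable_of_finite [Finite α] (f : α → σ) : Computable f :=
  (Primrec.dom_finite f).to_comp

open Classical in
theorem computable_find {p : α → ℕ → Prop}
    (hp : Computable (fun q : α × ℕ => dec (p q.1 q.2))) (h : ∀ a, ∃ n, p a n) :
    Computable (fun a => Nat.find (h a)) := by
  have : Partrec fun a => Nat.rfind ((fun n => dec (p a n) : ℕ → Bool) : ℕ →. Bool) :=
    Partrec.rfind hp.partrec.to₂
  refine this.of_eq_tot fun a => ?_
  rw [Nat.mem_rfind]
  simp only [PFun.coe_val, Part.mem_some_iff]
  refine ⟨(dec_eq_true.2 (Nat.find_spec (h a))).symm, fun hm => ?_⟩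
  rw [dec_eq_decide]
  exact (decide_eq_false (Nat.find_min (h a) hm)).symm

theorem exists_computable_selector [Inhabited β] {p : α → β → Prop}
    (hp : Computable (fun q : α × β => dec (p q.1 q.2))) (h : ∀ a, ∃ b, p a b) :
    ∃ f : α → β, Computable f ∧ ∀ a, p a (f a) := by
  let P : α → ℕ → Prop := fun a n =>
    (Encodable.decode (α := β) n).elim false (fun b => dec (p a b)) = true
  have hP : Computable (fun q : α × ℕ => dec (P q.1 q.2)) := by
    have hp' : Computable (fun q : (α × ℕ) × β => dec (p q.1.1 q.2)) :=
      hp.comp (g := fun q : (α × ℕ) × β => (q.1.1, q.2)) (by fun_prop)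
    show Computable (fun q : α × ℕ => dec
      ((Encodable.decode (α := β) q.2).elim false (fun b => dec (p q.1 b)) = true))
    fun_prop
  have hex : ∀ a, ∃ n, P a n := fun a => by
    obtain ⟨b, hb⟩ := h a
    exact ⟨Encodable.encode b, by simp [P, hb]⟩
  have hc := computable_find hP hex
  classical
  refine ⟨fun a => (Encodable.decode (α := β) (Nat.find (hex a))).getD default, ?_, fun a => ?_⟩
  · refine C_optionGetD (C_decode (hc.of_eq fun a => ?_)) (C_const _)
    congr
  · have := Nat.find_spec (hex a)
    revert this
    simp only [P]
    cases Encodable.decode (α := β) (Nat.find (hex a)) with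
    | none => simp
    | some b => simp

end ComputableCalculus

/-! ### Semidecidable predicates -/

/-- `p` is semidecidable: `p a` holds iff a computable search terminates. -/
def Semidec {α : Type*} [Primcodable α] (p : α → Prop) : Prop :=
  ∃ T : α → ℕ → Bool, Computable (fun q : α × ℕ => T q.1 q.2) ∧ ∀ a, p a ↔ ∃ n, T a n = true

theorem Semidec.intro {α β : Type*} [Primcodable α] [Primcodable β] {p : α → Prop}
    (R : α → β → Prop)
    (hR : Computable (fun q : α × β => dec (R q.1 q.2))) (h : ∀ a, p a ↔ ∃ b, R a b) :
    Semidec p := by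
  refine ⟨fun a n => (Encodable.decode (α := β) n).elim false (fun b => dec (R a b)), ?_, ?_⟩
  · have hR' : Computable (fun q : (α × ℕ) × β => dec (R q.1.1 q.2)) :=
      hR.comp (g := fun q : (α × ℕ) × β => (q.1.1, q.2)) (by fun_prop)
    fun_prop
  · intro a
    rw [h]
    constructor
    · rintro ⟨b, hb⟩
      exact ⟨Encodable.encode b, by simp [hb]⟩
    · rintro ⟨n, hn⟩
      dsimp only at hn
      revert hn
      cases Encodable.decode (α := β) n with
      | none => simp
      | some b => intro hb; exact ⟨b, by simpa using hb⟩

theorem Semidec.of_computable {α : Type*} [Primcodable α] {p : α → Prop}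
    (hp : Computable fun a => dec (p a)) : Semidec p :=
  ⟨fun a _ => dec (p a), hp.comp (f := fun a => dec (p a)) Computable.fst, fun a => by simp⟩

theorem Semidec.exists {α β : Type*} [Primcodable α] [Primcodable β] {p : α → β → Prop}
    (hp : Semidec (fun q : α × β => p q.1 q.2)) : Semidec (fun a => ∃ b, p a b) := by
  obtain ⟨T, hT, h⟩ := hp
  have hT' : Computable (fun q : α × β × ℕ => T (q.1, q.2.1) q.2.2) :=
    hT.comp (g := fun q : α × β × ℕ => ((q.1, q.2.1), q.2.2)) (by fun_prop)
  refine Semidec.intro (fun a (b : β × ℕ) => T (a, b.1) b.2 = true) (by fun_prop) fun a => ?_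
  constructor
  · rintro ⟨b, hb⟩
    obtain ⟨n, hn⟩ := (h (a, b)).1 hb
    exact ⟨(b, n), hn⟩
  · rintro ⟨⟨b, n⟩, hn⟩
    exact ⟨b, (h (a, b)).2 ⟨n, hn⟩⟩

theorem Semidec.or {α : Type*} [Primcodable α] {p q : α → Prop}
    (hp : Semidec p) (hq : Semidec q) : Semidec (fun a => p a ∨ q a) := by
  obtain ⟨T, hT, h⟩ := hp
  obtain ⟨S, hS, h'⟩ := hq
  refine ⟨fun a n => T a n || S a n, by fun_prop, fun a => ?_⟩
  simp only [h, h', ← exists_or, Bool.or_eq_true]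

/-! ### Medvedev reductions from local evidence -/

theorem length_pref (x : ℕ → ℕ) (k : ℕ) : (pref x k).length = k := by simp [pref]

theorem getElem?_pref {x : ℕ → ℕ} {k i : ℕ} (h : i < k) : (pref x k)[i]? = some (x i) := by
  simp [pref, h]

theorem getElem?_pref_eq {x : ℕ → ℕ} {k i v : ℕ} :
    (pref x k)[i]? = some v ↔ i < k ∧ x i = v := by
  by_cases h : i < k <;> simp [pref, h]

theorem pref_prefix (x : ℕ → ℕ) {k l : ℕ} (h : k ≤ l) : pref x k <+: pref x l := by
  rw [List.prefix_iff_getElem?]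
  intro i hi
  rw [length_pref] at hi
  rw [getElem?_pref (by omega)]
  simp [pref]

theorem take_pref (x : ℕ → ℕ) {k l : ℕ} (h : k ≤ l) : (pref x l).take k = pref x k := by
  rw [(List.prefix_iff_eq_take.1 (pref_prefix x h)), length_pref]

theorem List.IsPrefix.getElem?_eq_some {α : Type*} {l m : List α} (h : l <+: m) {i : ℕ} {v : α}
    (hi : l[i]? = some v) : m[i]? = some v := by
  obtain ⟨t, rfl⟩ := h
  have : i < l.length := (List.getElem?_eq_some_iff.1 hi).1
  rw [List.getElem?_append_left this, hi]

theorem BaireLE.trans {P Q R : Set (ℕ → ℕ)} (h₁ : BaireLE P Q) (h₂ : BaireLE Q R) :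
    BaireLE P R := by
  obtain ⟨φ, hφ, hφm, hφs⟩ := h₁
  obtain ⟨ψ, hψ, hψm, hψs⟩ := h₂
  refine ⟨fun l => φ (ψ l), hφ.comp hψ, fun l₁ l₂ h => hφm _ _ (hψm _ _ h), fun x hx => ?_⟩
  obtain ⟨y, hy, hyx⟩ := hψs x hx
  obtain ⟨z, hz, hzy⟩ := hφs y hy
  refine ⟨z, hz, fun n => ?_⟩
  have key : ∀ m, ∃ k, pref y m <+: ψ (pref x k) := by
    intro m
    have : ∃ k, ∀ i < m, (ψ (pref x k))[i]? = some (y i) := by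
      induction m with
      | zero => exact ⟨0, by simp⟩
      | succ m ih =>
        obtain ⟨k, hk⟩ := ih
        obtain ⟨k', hk'⟩ := hyx m
        refine ⟨max k k', fun i hi => ?_⟩
        rcases Nat.lt_succ_iff_lt_or_eq.1 hi with h | rfl
        · exact List.IsPrefix.getElem?_eq_some
            (hψm _ _ (pref_prefix x (le_max_left k k'))) (hk i h)
        · exact List.IsPrefix.getElem?_eq_some (hψm _ _ (pref_prefix x (le_max_right k k'))) hk'
    obtain ⟨k, hk⟩ := this
    refine ⟨k, List.prefix_iff_getElem?.2 fun i hi => ?_⟩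
    rw [length_pref] at hi
    rw [hk i hi]
    simp [pref]
  obtain ⟨m, hm⟩ := hzy n
  obtain ⟨k, hk⟩ := key m
  exact ⟨k, List.IsPrefix.getElem?_eq_some (hφm _ _ hk) hm⟩

/-- The longest initial segment, of length at most `N`, on which `a` is defined. -/
def initRun (a : ℕ → Option ℕ) (N : ℕ) : List ℕ :=
  Nat.rec [] (fun n acc => if acc.length = n then (a n).elim acc (fun v => acc ++ [v]) else acc) N

theorem initRun_succ (a : ℕ → Option ℕ) (N : ℕ) : initRun a (N + 1) =
    if (initRun a N).length = N then (a N).elim (initRun a N) (fun v => initRun a N ++ [v])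
    else initRun a N := rfl

theorem initRun_prefix_succ (a : ℕ → Option ℕ) (N : ℕ) : initRun a N <+: initRun a (N + 1) := by
  rw [initRun_succ]
  split_ifs
  · cases a N <;> simp
  · exact List.prefix_rfl

theorem length_initRun_le (a : ℕ → Option ℕ) (N : ℕ) : (initRun a N).length ≤ N := by
  induction N with
  | zero => simp [initRun]
  | succ N ih =>
    rw [initRun_succ]
    split_ifs
    · cases a N
      · simp; omega
      · simpa using ih
    · omega

theorem initRun_prefix (a : ℕ → Option ℕ) {N M : ℕ} (h : N ≤ M) : initRun a N <+: initRun a M := by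
  induction M, h using Nat.le_induction with
  | base => exact List.prefix_rfl
  | succ M _ ih => exact ih.trans (initRun_prefix_succ a M)

theorem initRun_mono {a b : ℕ → Option ℕ} (h : ∀ n v, a n = some v → b n = some v) (N : ℕ) :
    initRun a N <+: initRun b N := by
  induction N with
  | zero => exact List.prefix_rfl
  | succ N ih =>
    by_cases hl : (initRun a N).length = N
    · have heq : initRun a N = initRun b N :=
        ih.eq_of_length_le (by rw [hl]; exact length_initRun_le b N)
      cases ha : a N with
      | none =>
        have : initRun a (N + 1) = initRun a N := by rw [initRun_succ]; simp [ha]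
        rw [this]
        exact ih.trans (initRun_prefix_succ b N)
      | some v =>
        rw [initRun_succ, initRun_succ, ← heq, ha, h N v ha]
    · have : initRun a (N + 1) = initRun a N := by rw [initRun_succ]; simp [hl]
      rw [this]
      exact ih.trans (initRun_prefix_succ b N)

theorem initRun_eq {a : ℕ → Option ℕ} {y : ℕ → ℕ} {N : ℕ} (h : ∀ i < N, a i = some (y i)) :
    initRun a N = pref y N := by
  induction N with
  | zero => rfl
  | succ N ih =>
    rw [initRun_succ, ih fun i hi => h i (by omega), if_pos (length_pref y N), h N (by omega)]
    simp [pref, List.range_succ]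

theorem computable_initRun {f : List ℕ × ℕ → Option ℕ} (hf : Computable f) :
    Computable (fun l => initRun (fun n => f (l, n)) l.length) := by
  have h : Computable (fun p : List ℕ × ℕ × List ℕ => if p.2.2.length = p.2.1 then
      (f (p.1, p.2.1)).elim p.2.2 (fun v => p.2.2 ++ [v]) else p.2.2) := by fun_prop
  exact C_natRec (h := fun l n acc => if acc.length = n then
      (f (l, n)).elim acc (fun v => acc ++ [v]) else acc) Computable.list_length (C_const []) h

theorem BaireLE.of_semidec {P Q : Set (ℕ → ℕ)} {R : List ℕ → ℕ → ℕ → Prop}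
    (hR : Semidec (fun q : List ℕ × ℕ × ℕ => R q.1 q.2.1 q.2.2))
    (h : ∀ x ∈ Q, ∃ y ∈ P, ∀ n v, (∃ k, R (pref x k) n v) ↔ y n = v) : BaireLE P Q := by
  obtain ⟨T, hT, hTR⟩ := hR
  let test : List ℕ × ℕ → ℕ → Bool := fun q j =>
    T (q.1.take j.unpair.1, q.2, j.unpair.2.unpair.1) j.unpair.2.unpair.2
  let find : List ℕ × ℕ → Option ℕ := fun q =>
    ((List.range q.1.length).filter (test q)).head?.map (fun j => j.unpair.2.unpair.1)
  have htest : Computable (fun p : (List ℕ × ℕ) × ℕ => test p.1 p.2) :=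
    hT.comp (g := fun p : (List ℕ × ℕ) × ℕ => ((p.1.1.take p.2.unpair.1, p.1.2,
      p.2.unpair.2.unpair.1), p.2.unpair.2.unpair.2)) (by fun_prop)
  have hfind : Computable find := by fun_prop
  have htm : ∀ l₁ l₂ : List ℕ, l₁ <+: l₂ → ∀ n, ∀ j < l₁.length,
      test (l₁, n) j = test (l₂, n) j := by
    rintro l₁ l₂ ⟨t, rfl⟩ n j hj
    have : j.unpair.1 ≤ l₁.length := (Nat.unpair_left_le j).trans hj.le
    simp only [test]
    rw [List.take_append_of_le_length this]
  have hmono : ∀ l₁ l₂ : List ℕ, l₁ <+: l₂ → ∀ n v, find (l₁, n) = some v →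
      find (l₂, n) = some v := by
    intro l₁ l₂ hl n v hv
    have hle := hl.length_le
    simp only [find] at hv ⊢
    have hr : List.range l₂.length = List.range l₁.length ++
        (List.range (l₂.length - l₁.length)).map (l₁.length + ·) := by
      rw [← List.range_add]
      congr 1; omega
    have hf : (List.range l₁.length).filter (test (l₁, n)) =
        (List.range l₁.length).filter (test (l₂, n)) :=
      List.filter_congr fun j hj => htm l₁ l₂ hl n j (List.mem_range.1 hj)
    rw [hr, List.filter_append, ← hf]
    revert hv
    cases (List.range l₁.length).filter (test (l₁, n)) <;> simp
  refine ⟨fun l => initRun (fun n => find (l, n)) l.length, ?_, ?_, ?_⟩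
  · exact computable_initRun hfind
  · intro l₁ l₂ hl
    exact (initRun_mono (hmono l₁ l₂ hl) _).trans (initRun_prefix _ hl.length_le)
  · intro x hx
    obtain ⟨y, hy, hxy⟩ := h x hx
    have hsound : ∀ k n v, find (pref x k, n) = some v → v = y n := by
      intro k n v hv
      simp only [find, Option.map_eq_some_iff] at hv
      obtain ⟨j, hj, rfl⟩ := hv
      have hj' := List.mem_filter.1 (List.mem_of_mem_head? hj)
      have hjk : j < k := by simpa [length_pref] using hj'.1
      have h1 := (hTR _).2 ⟨_, hj'.2⟩
      simp only at h1
      rw [take_pref x ((Nat.unpair_left_le j).trans hjk.le)] at h1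
      exact ((hxy _ _).1 ⟨_, h1⟩).symm
    have hcomplete : ∀ n, ∃ k, find (pref x k, n) = some (y n) := by
      intro n
      obtain ⟨k, hk⟩ := (hxy n (y n)).2 rfl
      obtain ⟨s, hs⟩ := (hTR (pref x k, n, y n)).1 hk
      let j := Nat.pair k (Nat.pair (y n) s)
      have hjt : test (pref x (j + 1), n) j = true := by
        simp only [test, j, Nat.unpair_pair]
        rw [take_pref x ((Nat.left_le_pair _ _).trans (Nat.le_succ _))]
        exact hs
      refine ⟨j + 1, ?_⟩
      cases hf : find (pref x (j + 1), n) with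
      | some v => rw [hsound _ _ _ hf]
      | none =>
        simp only [find, Option.map_eq_none_iff, List.head?_eq_none_iff, length_pref,
          List.filter_eq_nil_iff] at hf
        exact absurd hjt (hf j (by simp))
    refine ⟨y, hy, fun n => ?_⟩
    have : ∃ k, ∀ i < n + 1, find (pref x k, i) = some (y i) := by
      induction n + 1 with
      | zero => exact ⟨0, by simp⟩
      | succ m ih =>
        obtain ⟨k, hk⟩ := ih
        obtain ⟨k', hk'⟩ := hcomplete m
        refine ⟨max k k', fun i hi => ?_⟩
        rcases Nat.lt_succ_iff_lt_or_eq.1 hi with h | rfl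
        · exact hmono _ _ (pref_prefix x (le_max_left k k')) _ _ (hk i h)
        · exact hmono _ _ (pref_prefix x (le_max_right k k')) _ _ hk'
    obtain ⟨k, hk⟩ := this
    let K := max k (n + 1)
    have h1 : initRun (fun m => find (pref x K, m)) (n + 1) = pref y (n + 1) :=
      initRun_eq fun i hi => hmono _ _ (pref_prefix x (le_max_left _ _)) _ _ (hk i hi)
    refine ⟨K, ?_⟩
    have h2 : pref y (n + 1) <+: initRun (fun m => find (pref x K, m)) (pref x K).length := by
      rw [← h1, length_pref]
      exact initRun_prefix _ (le_max_right _ _)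
    exact List.IsPrefix.getElem?_eq_some h2 (getElem?_pref (by omega))

theorem isPi01Cantor_of_semidec {B : List ℕ → Prop} (hB : Semidec B) :
    IsPi01Cantor (cantorSpace \ {x | ∃ k, B (pref x k)}) := by
  obtain ⟨T, hT, hTB⟩ := hB
  refine ⟨fun n => ((Encodable.decode (α := List ℕ × ℕ) n).elim [2]
    (fun q => if T q.1 q.2 = true then q.1 else [2])), ?_, ?_⟩
  · have hT' : Computable (fun q : ℕ × List ℕ × ℕ => T q.2.1 q.2.2) :=
      hT.comp (g := fun q : ℕ × List ℕ × ℕ => (q.2.1, q.2.2)) (by fun_prop)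
    fun_prop
  · ext x
    simp only [Set.mem_sdiff, Set.mem_ofPred_eq, Set.mem_iUnion]
    refine and_congr_right fun hx => not_congr ?_
    have hcyl : ∀ l : List ℕ, x ∈ cylinder l ↔ pref x l.length = l := by
      intro l
      constructor
      · intro h
        refine List.ext_getElem (length_pref _ _) fun i h1 h2 => ?_
        rw [← h i h2]
        simp [pref]
      · intro h i hi
        have := getElem?_pref (x := x) hi
        rw [h, List.getElem?_eq_getElem hi] at this
        exact (Option.some.inj this).symm
    have h2 : x ∉ cylinder [2] := by
      rw [hcyl]
      intro h
      have h1 := hx 0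
      simp [pref] at h
      omega
    constructor
    · rintro ⟨k, hk⟩
      obtain ⟨s, hs⟩ := (hTB _).1 hk
      refine ⟨Encodable.encode (pref x k, s), ?_⟩
      simp [hs, hcyl, length_pref]
    · rintro ⟨n, hn⟩
      revert hn
      cases Encodable.decode (α := List ℕ × ℕ) n with
      | none => exact fun h => absurd h h2
      | some q =>
        simp only [Option.elim_some]
        split_ifs with hq
        · intro h
          refine ⟨q.1.length, ?_⟩
          rw [(hcyl _).1 h]
          exact (hTB _).2 ⟨_, hq⟩
        · exact fun h => absurd h h2

/-! ### Oracle register machines -/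

/-- Instructions of a register machine with a binary oracle. -/
inductive Instr
  | set (a b : ℕ)
  | clr (a : ℕ)
  | inc (a : ℕ)
  | jeq (a b l : ℕ)
  | jz (b l : ℕ)
  | halt

namespace Instr

/-- One step of the machine with program `p` and oracle `z`; halting states are fixed. -/
def step (z : ℕ → Bool) (p : ℕ → Instr) (c : ℕ × (ℕ → ℕ)) : ℕ × (ℕ → ℕ) :=
  match p c.1 with
  | set a b => (c.1 + 1, Function.update c.2 a (c.2 b))
  | clr a => (c.1 + 1, Function.update c.2 a 0)
  | inc a => (c.1 + 1, Function.update c.2 a (c.2 a + 1))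
  | jeq a b l => (if c.2 a = c.2 b then l else c.1 + 1, c.2)
  | jz b l => (if z (c.2 b) = false then l else c.1 + 1, c.2)
  | halt => c

/-- Reachability of machine states. -/
def Reach (z : ℕ → Bool) (p : ℕ → Instr) (c d : ℕ × (ℕ → ℕ)) : Prop :=
  ∃ n, (step z p)^[n] c = d

variable {z : ℕ → Bool} {p : ℕ → Instr} {c d e : ℕ × (ℕ → ℕ)}

theorem Reach.refl : Reach z p c c := ⟨0, rfl⟩

theorem Reach.trans (h₁ : Reach z p c d) (h₂ : Reach z p d e) : Reach z p c e := by
  obtain ⟨n, rfl⟩ := h₁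
  obtain ⟨m, rfl⟩ := h₂
  exact ⟨m + n, Function.iterate_add_apply _ _ _ _⟩

theorem Reach.head (h : Reach z p (step z p c) d) : Reach z p c d :=
  Reach.trans ⟨1, rfl⟩ h

variable {pc : ℕ} {ρ : ℕ → ℕ} {a b l : ℕ}

theorem Reach.set (h : p pc = set a b)
    (h' : Reach z p (pc + 1, Function.update ρ a (ρ b)) d) : Reach z p (pc, ρ) d :=
  Reach.head (by simpa [step, h] using h')

theorem Reach.clr (h : p pc = clr a)
    (h' : Reach z p (pc + 1, Function.update ρ a 0) d) : Reach z p (pc, ρ) d :=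
  Reach.head (by simpa [step, h] using h')

theorem Reach.inc (h : p pc = inc a)
    (h' : Reach z p (pc + 1, Function.update ρ a (ρ a + 1)) d) : Reach z p (pc, ρ) d :=
  Reach.head (by simpa [step, h] using h')

theorem Reach.jeq_eq (h : p pc = jeq a b l) (hab : ρ a = ρ b)
    (h' : Reach z p (l, ρ) d) : Reach z p (pc, ρ) d :=
  Reach.head (by simpa [step, h, hab] using h')

theorem Reach.jeq_ne (h : p pc = jeq a b l) (hab : ρ a ≠ ρ b)
    (h' : Reach z p (pc + 1, ρ) d) : Reach z p (pc, ρ) d :=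
  Reach.head (by simpa [step, h, hab] using h')

theorem Reach.jz_zero (h : p pc = jz b l) (hb : z (ρ b) = false)
    (h' : Reach z p (l, ρ) d) : Reach z p (pc, ρ) d :=
  Reach.head (by simpa [step, h, hb] using h')

theorem Reach.jz_one (h : p pc = jz b l) (hb : z (ρ b) = true)
    (h' : Reach z p (pc + 1, ρ) d) : Reach z p (pc, ρ) d :=
  Reach.head (by simpa [step, h, hb] using h')

/-- The program `p` contains the code `code` at position `off`. -/
def At (p : ℕ → Instr) (off : ℕ) (code : List Instr) : Prop :=
  ∀ j i, code[j]? = some i → p (off + j) = i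

theorem At.append {p : ℕ → Instr} {off : ℕ} {c₁ c₂ : List Instr} (h : At p off (c₁ ++ c₂)) :
    At p off c₁ ∧ At p (off + c₁.length) c₂ := by
  refine ⟨fun j i hj => h j i ?_, fun j i hj => ?_⟩
  · rw [List.getElem?_append_left (List.getElem?_eq_some_iff.1 hj).1, hj]
  · rw [add_assoc]
    refine h _ i ?_
    rw [List.getElem?_append_right (by omega)]
    simpa using hj

theorem At.cons {p : ℕ → Instr} {off : ℕ} {i : Instr} {c : List Instr} (h : At p off (i :: c)) :
    p off = i ∧ At p (off + 1) c :=
  ⟨h 0 i rfl, fun j i' hj => by rw [add_assoc, add_comm 1 j]; exact h (j + 1) i' (by simpa using hj)⟩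

/-- Some code placed at `off` computes `f` of the registers `ins` into register `out`,
leaving the other registers below `s` unchanged. -/
def Computes (n : ℕ) (f : List.Vector ℕ n → ℕ) (ins : Fin n → ℕ) (out s off : ℕ)
    (code : List Instr) : Prop :=
  ∀ z p, At p off code → ∀ ρ : ℕ → ℕ, ∃ ρ' : ℕ → ℕ,
    Reach z p (off, ρ) (off + code.length, ρ') ∧
    ρ' out = f (List.Vector.ofFn fun i => ρ (ins i)) ∧ ∀ r < s, r ≠ out → ρ' r = ρ r

theorem exists_code_family {n m : ℕ} {g : Fin n → List.Vector ℕ m → ℕ}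
    (hg : ∀ i, ∀ (ins : Fin m → ℕ) (out s off : ℕ), (∀ j, ins j < s) → (∀ j, ins j ≠ out) →
      out < s → ∃ code, Computes m (g i) ins out s off code)
    (ins : Fin m → ℕ) (s off : ℕ) (hins : ∀ j, ins j < s) (l : ℕ) (hl : l ≤ n) :
    ∃ code, ∀ z p, At p off code → ∀ ρ : ℕ → ℕ, ∃ ρ' : ℕ → ℕ,
      Reach z p (off, ρ) (off + code.length, ρ') ∧
      (∀ i : Fin n, i.1 < l → ρ' (s + i) = g i (List.Vector.ofFn fun i => ρ (ins i))) ∧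
      ∀ r < s, ρ' r = ρ r := by
  induction l with
  | zero => exact ⟨[], fun z p _ ρ => ⟨ρ, Reach.refl, fun i hi => absurd hi (by omega), fun _ _ => rfl⟩⟩
  | succ l ih =>
    obtain ⟨c₁, h₁⟩ := ih (by omega)
    obtain ⟨c₂, h₂⟩ := hg ⟨l, hl⟩ ins (s + l) (s + n) (off + c₁.length)
      (fun j => (hins j).trans_le (by omega)) (fun j => by have := hins j; omega) (by omega)
    refine ⟨c₁ ++ c₂, fun z p hp ρ => ?_⟩
    obtain ⟨hp₁, hp₂⟩ := hp.append
    obtain ⟨ρ₁, hr₁, hv₁, hs₁⟩ := h₁ z p hp₁ ρ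
    obtain ⟨ρ₂, hr₂, hv₂, hs₂⟩ := h₂ z p hp₂ ρ₁
    refine ⟨ρ₂, ?_, fun i hi => ?_, fun r hr => ?_⟩
    · rw [List.length_append, ← add_assoc]
      exact hr₁.trans hr₂
    · rcases Nat.lt_succ_iff_lt_or_eq.1 hi with h | h
      · rw [hs₂ _ (by omega) (by omega), hv₁ i h]
      · obtain rfl : i = ⟨l, hl⟩ := Fin.ext h
        rw [hv₂]
        congr 2
        funext j
        exact hs₁ _ (hins j)
    · rw [hs₂ r (by omega) (by omega), hs₁ r hr]

theorem exists_code_prec {n : ℕ} {f : List.Vector ℕ n → ℕ} {g : List.Vector ℕ (n + 2) → ℕ}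
    (hf : ∀ (ins : Fin n → ℕ) (out s off : ℕ), (∀ j, ins j < s) → (∀ j, ins j ≠ out) →
      out < s → ∃ code, Computes n f ins out s off code)
    (hg : ∀ (ins : Fin (n + 2) → ℕ) (out s off : ℕ), (∀ j, ins j < s) → (∀ j, ins j ≠ out) →
      out < s → ∃ code, Computes (n + 2) g ins out s off code)
    (ins : Fin (n + 1) → ℕ) (out s off : ℕ) (hins : ∀ j, ins j < s) : ∃ code, Computes (n + 1) (fun v : List.Vector ℕ (n + 1) =>
      Nat.rec (f v.tail) (fun y IH => g (y ::ᵥ IH ::ᵥ v.tail)) v.head) ins out s off code := by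
  obtain ⟨c₁, h₁⟩ := hf (fun i => ins i.succ) (s + 1) (s + 3) off
    (fun j => (hins _).trans_le (by omega)) (fun j => by have := hins j.succ; omega) (by omega)
  obtain ⟨c₂, h₂⟩ := hg (Fin.cons s (Fin.cons (s + 1) fun i => ins i.succ)) (s + 2) (s + 3)
    (off + c₁.length + 2)
    (fun j => by
      refine Fin.cases (by simp) (fun j => ?_) j
      refine Fin.cases (by simp) (fun j => ?_) j
      have := hins j.succ
      simp; omega)
    (fun j => by
      refine Fin.cases (by simp) (fun j => ?_) j
      refine Fin.cases (by simp) (fun j => ?_) j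
      have := hins j.succ
      simp; omega) (by omega)
  refine ⟨c₁ ++ ([clr s, jeq s (ins 0) (off + c₁.length + 2 + c₂.length + 3)] ++
    (c₂ ++ [set (s + 1) (s + 2), inc s, jeq s s (off + c₁.length + 1), set out (s + 1)])),
    fun z p hp ρ => ?_⟩
  obtain ⟨hp₁, hp'⟩ := hp.append
  obtain ⟨hp₃, hp₄⟩ := hp'.append
  obtain ⟨hclr, hp₃⟩ := hp₃.cons
  obtain ⟨hjeq, -⟩ := hp₃.cons
  obtain ⟨hp₂, hp₅⟩ := hp₄.append
  obtain ⟨hset, hp₅⟩ := hp₅.cons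
  obtain ⟨hinc, hp₅⟩ := hp₅.cons
  obtain ⟨hback, hp₅⟩ := hp₅.cons
  obtain ⟨hfin, -⟩ := hp₅.cons
  simp only [List.length_cons, List.length_nil, zero_add, Nat.reduceAdd] at hset hinc hback hfin hp₂
  obtain ⟨ρ₁, hr₁, hv₁, hs₁⟩ := h₁ z p hp₁ ρ
  set F : ℕ → ℕ := fun N => Nat.rec (f (List.Vector.ofFn fun i => ρ (ins i.succ)))
      (fun y IH => g (y ::ᵥ IH ::ᵥ (List.Vector.ofFn fun i => ρ (ins i.succ)))) N with hF
  have loop : ∀ y ≤ ρ (ins 0), ∃ ρ' : ℕ → ℕ, Reach z p (off, ρ) (off + c₁.length + 1, ρ') ∧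
      ρ' s = y ∧ ρ' (s + 1) = F y ∧ ∀ r < s, ρ' r = ρ r := by
    intro y
    induction y with
    | zero =>
      intro _
      refine ⟨Function.update ρ₁ s 0, hr₁.trans (Reach.clr hclr Reach.refl), by simp, ?_, ?_⟩
      · rw [Function.update_of_ne (by omega)]
        exact hv₁
      · intro r hr
        rw [Function.update_of_ne (by omega), hs₁ r (by omega) (by omega)]
    | succ y ih =>
      intro hy
      obtain ⟨ρ₂, hr₂, hy₂, hF₂, hs₂⟩ := ih (by omega)
      obtain ⟨ρ₃, hr₃, hv₃, hs₃⟩ := h₂ z p hp₂ ρ₂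
      refine ⟨Function.update (Function.update ρ₃ (s + 1) (ρ₃ (s + 2))) s (ρ₃ s + 1),
        hr₂.trans ?_, ?_, ?_, ?_⟩
      · refine Reach.jeq_ne hjeq ?_ (hr₃.trans ?_)
        · rw [hy₂, hs₂ _ (hins 0)]
          omega
        · refine Reach.set hset (Reach.inc hinc (Reach.jeq_eq hback rfl ?_))
          rw [Function.update_of_ne (a := s) (by omega)]
          exact Reach.refl
      · rw [Function.update_self, hs₃ s (by omega) (by omega), hy₂]
      · rw [Function.update_of_ne (by omega), Function.update_self, hv₃]
        have : (List.Vector.ofFn fun i =>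
            ρ₂ ((Fin.cons s (Fin.cons (s + 1) fun i => ins i.succ) : Fin (n + 2) → ℕ) i)) =
            y ::ᵥ F y ::ᵥ (List.Vector.ofFn fun i => ρ (ins i.succ)) := by
          refine List.Vector.ext fun i => ?_
          rw [List.Vector.get_ofFn]
          refine Fin.cases (by simpa using hy₂) (fun i => ?_) i
          refine Fin.cases hF₂ (fun i => ?_) i
          simp [hs₂ _ (hins i.succ)]
        rw [this]
      · intro r hr
        rw [Function.update_of_ne (by omega), Function.update_of_ne (by omega),
          hs₃ r (by omega) (by omega), hs₂ r hr]
  obtain ⟨ρ₂, hr₂, hy₂, hF₂, hs₂⟩ := loop _ le_rfl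
  refine ⟨Function.update ρ₂ out (ρ₂ (s + 1)), ?_, ?_, ?_⟩
  · refine hr₂.trans (Reach.jeq_eq hjeq (by rw [hy₂, hs₂ _ (hins 0)]) (Reach.set hfin ?_))
    · convert Reach.refl using 2
      simp only [List.length_append, List.length_cons, List.length_nil]
      omega
  · rw [Function.update_self, hF₂, hF]
    simp only [List.Vector.ofFn, List.Vector.head_cons, List.Vector.tail_cons]
  · intro r hr hro
    rw [Function.update_of_ne hro, hs₂ r hr]

theorem exists_code {n : ℕ} {f : List.Vector ℕ n → ℕ} (hf : Nat.Primrec' f) :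
    ∀ (ins : Fin n → ℕ) (out s off : ℕ), (∀ j, ins j < s) → (∀ j, ins j ≠ out) →
      out < s → ∃ code, Computes n f ins out s off code := by
  induction hf with
  | zero =>
    intro ins out s off _ _ _
    refine ⟨[clr out], fun z p hp ρ => ⟨Function.update ρ out 0, ?_, by simp, ?_⟩⟩
    · exact Reach.clr hp.cons.1 Reach.refl
    · intro r _ hr
      rw [Function.update_of_ne hr]
  | succ =>
    intro ins out s off _ _ _
    refine ⟨[set out (ins 0), inc out],
      fun z p hp ρ => ⟨Function.update ρ out (ρ (ins 0) + 1), ?_, by simp [List.Vector.ofFn], ?_⟩⟩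
    · refine Reach.set hp.cons.1 (Reach.inc hp.cons.2.cons.1 ?_)
      simpa using Reach.refl
    · intro r _ hr
      rw [Function.update_of_ne hr]
  | get i =>
    intro ins out s off _ _ _
    refine ⟨[set out (ins i)],
      fun z p hp ρ => ⟨Function.update ρ out (ρ (ins i)), ?_, by simp, ?_⟩⟩
    · exact Reach.set hp.cons.1 Reach.refl
    · intro r _ hr
      rw [Function.update_of_ne hr]
  | @comp m n f g hf hg ihf ihg =>
    intro ins out s off hins hne hout
    obtain ⟨c₁, h₁⟩ := exists_code_family ihg ins s off hins n le_rfl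
    obtain ⟨c₂, h₂⟩ := ihf (fun i => s + i) out (s + n) (off + c₁.length) (fun j => by omega)
      (fun j => by omega) (by omega)
    refine ⟨c₁ ++ c₂, fun z p hp ρ => ?_⟩
    obtain ⟨hp₁, hp₂⟩ := hp.append
    obtain ⟨ρ₁, hr₁, hv₁, hs₁⟩ := h₁ z p hp₁ ρ
    obtain ⟨ρ₂, hr₂, hv₂, hs₂⟩ := h₂ z p hp₂ ρ₁
    refine ⟨ρ₂, ?_, ?_, fun r hr hro => ?_⟩
    · rw [List.length_append, ← add_assoc]
      exact hr₁.trans hr₂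
    · rw [hv₂]
      congr 2
      funext i
      exact hv₁ i i.2
    · rw [hs₂ r (by omega) hro, hs₁ r hr]
  | prec hf hg ihf ihg =>
    intro ins out s off hins _ _
    exact exists_code_prec ihf ihg ins out s off hins

end Instr

namespace Instr

/-- A finite program, padded with `halt`. -/
def prog (p : List Instr) (i : ℕ) : Instr := p[i]?.getD halt

theorem at_prog (c₁ c₂ c₃ : List Instr) : At (prog (c₁ ++ c₂ ++ c₃)) c₁.length c₂ := by
  intro j i h
  have hj : j < c₂.length := (List.getElem?_eq_some_iff.1 h).1
  rw [prog, List.append_assoc, List.getElem?_append_right (by omega),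
    List.getElem?_append_left (by omega)]
  simp [h]

/-- The machine state after `n` steps. -/
def run (z : ℕ → Bool) (p : ℕ → Instr) (n : ℕ) : ℕ × (ℕ → ℕ) := (step z p)^[n] (0, fun _ => 0)

theorem run_succ (z : ℕ → Bool) (p : ℕ → Instr) (n : ℕ) :
    run z p (n + 1) = step z p (run z p n) := Function.iterate_succ_apply' _ _ _

theorem run_eq_of_halt {z : ℕ → Bool} {p : ℕ → Instr} {n m : ℕ} (h : p (run z p n).1 = halt)
    (hm : n ≤ m) : run z p m = run z p n := by
  induction m, hm using Nat.le_induction with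
  | base => rfl
  | succ m _ ih => rw [run_succ, ih, step, h]

/-- The inner loop comparing the `m`-th word with the oracle. -/
theorem exists_checker {len : ℕ → ℕ} {bit : ℕ → ℕ → ℕ}
    (hlen : Nat.Primrec' fun v : List.Vector ℕ 1 => len v.head)
    (hbit : Nat.Primrec' fun v : List.Vector ℕ 2 => bit v.head v.tail.head) :
    ∃ p : List Instr, ∀ z : ℕ → Bool, (∀ n, prog p (run z (prog p) n).1 ≠ halt) ↔
      ∀ m, ∃ i < len m, (z i).toNat ≠ bit m i := by
  obtain ⟨c₁, h₁⟩ := exists_code hlen (fun _ => 0) 2 6 1 (by simp) (by simp) (by simp)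
  obtain ⟨c₂, h₂⟩ := exists_code hbit (fun i => i) 3 6 (1 + c₁.length + 2) (fun i => by omega)
    (fun i => by omega) (by simp)
  set a := 1 + c₁.length with ha
  set b := a + 2 + c₂.length with hb
  set p : List Instr := [inc 5] ++ c₁ ++ ([clr 1, jeq 1 2 (b + 8)] ++ (c₂ ++
    [jz 1 (b + 3), jeq 3 5 (b + 6), jeq 1 1 (b + 4), jeq 3 4 (b + 6), inc 0, jeq 1 1 1, inc 1,
      jeq 1 1 (a + 1), halt])) with hp
  refine ⟨p, fun z => ?_⟩
  have hall : At (prog p) 0 p := by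
    have := at_prog [] p []
    simpa using this
  obtain ⟨hA, hB⟩ := hall.append
  obtain ⟨hA, hC₁⟩ := hA.append
  obtain ⟨hB, hD⟩ := hB.append
  obtain ⟨hC₂, hD⟩ := hD.append
  have hinc5 := hA.cons.1
  obtain ⟨hclr, hB⟩ := hB.cons
  obtain ⟨hjeq, -⟩ := hB.cons
  obtain ⟨i0, hD⟩ := hD.cons
  obtain ⟨i1, hD⟩ := hD.cons
  obtain ⟨i2, hD⟩ := hD.cons
  obtain ⟨i3, hD⟩ := hD.cons
  obtain ⟨i4, hD⟩ := hD.cons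
  obtain ⟨i5, hD⟩ := hD.cons
  obtain ⟨i6, hD⟩ := hD.cons
  obtain ⟨i7, hD⟩ := hD.cons
  obtain ⟨i8, -⟩ := hD.cons
  simp only [List.length_append, List.length_cons, List.length_nil, zero_add, Nat.reduceAdd,
    ← ha, ← hb, add_assoc b] at hC₁ hclr hjeq hC₂ i0 i1 i2 i3 i4 i5 i6 i7 i8
  have inner : ∀ m k i ρ, i + k = len m → ρ 0 = m → ρ 1 = i → ρ 2 = len m → ρ 4 = 0 → ρ 5 = 1 →
      (∀ j < i, (z j).toNat = bit m j) →
      ((∀ j < len m, (z j).toNat = bit m j) ∧ ∃ ρ', Reach z (prog p) (a + 1, ρ) (b + 8, ρ')) ∨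
      ((∃ j < len m, (z j).toNat ≠ bit m j) ∧ ∃ ρ', Reach z (prog p) (a + 1, ρ) (1, ρ') ∧
        ρ' 0 = m + 1 ∧ ρ' 4 = 0 ∧ ρ' 5 = 1) := by
    intro m k
    induction k with
    | zero =>
      intro i ρ hi h0 hi1 hi2 h4 h5 hj
      obtain rfl : i = len m := by omega
      exact .inl ⟨hj, ρ, Reach.jeq_eq hjeq (by omega) Reach.refl⟩
    | succ k ih =>
      intro i ρ hi h0 hi1 hi2 h4 h5 hj
      obtain ⟨ρ₁, hr₁, hv₁, hs₁⟩ := h₂ z (prog p) hC₂ ρ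
      have hstart : ∀ d, Reach z (prog p) (b, ρ₁) d → Reach z (prog p) (a + 1, ρ) d :=
        fun d hd => Reach.jeq_ne hjeq (by omega) (hr₁.trans hd)
      have hv : ρ₁ 3 = bit m i := by
        rw [hv₁, ← h0, ← hi1]
        simp [List.Vector.ofFn]
      have e0 : ρ₁ 0 = m := by rw [hs₁ 0 (by omega) (by omega), h0]
      have e1 : ρ₁ 1 = i := by rw [hs₁ 1 (by omega) (by omega), hi1]
      have e2 : ρ₁ 2 = len m := by rw [hs₁ 2 (by omega) (by omega), hi2]
      have e4 : ρ₁ 4 = 0 := by rw [hs₁ 4 (by omega) (by omega), h4]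
      have e5 : ρ₁ 5 = 1 := by rw [hs₁ 5 (by omega) (by omega), h5]
      by_cases hbi : (z i).toNat = bit m i
      · have hgo : Reach z (prog p) (b, ρ₁) (a + 1, Function.update ρ₁ 1 (ρ₁ 1 + 1)) := by
          have hend : Reach z (prog p) (b + 6, ρ₁) (a + 1, Function.update ρ₁ 1 (ρ₁ 1 + 1)) :=
            Reach.inc i6 (Reach.jeq_eq i7 rfl Reach.refl)
          cases hz : z i with
          | false =>
            refine Reach.jz_zero i0 (by rw [e1, hz]) (Reach.jeq_eq i3 ?_ hend)
            rw [hv, e4, ← hbi, hz]; rfl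
          | true =>
            refine Reach.jz_one i0 (by rw [e1, hz]) (Reach.jeq_eq i1 ?_ hend)
            rw [hv, e5, ← hbi, hz]; rfl
        have := ih (i + 1) (Function.update ρ₁ 1 (ρ₁ 1 + 1)) (by omega) (by simp [e0])
          (by simp [e1]) (by simp [e2]) (by simp [e4]) (by simp [e5]) (fun j hj' => by
            rcases Nat.lt_succ_iff_lt_or_eq.1 hj' with h | rfl
            · exact hj j h
            · exact hbi)
        rcases this with ⟨h, ρ', hr⟩ | ⟨h, ρ', hr, h'⟩
        · exact .inl ⟨h, ρ', hstart _ (hgo.trans hr)⟩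
        · exact .inr ⟨h, ρ', hstart _ (hgo.trans hr), h'⟩
      · refine .inr ⟨⟨i, by omega, hbi⟩, Function.update ρ₁ 0 (ρ₁ 0 + 1), hstart _ ?_, by simp [e0],
          by simp [e4], by simp [e5]⟩
        have hend : Reach z (prog p) (b + 4, ρ₁) (1, Function.update ρ₁ 0 (ρ₁ 0 + 1)) :=
          Reach.inc i4 (Reach.jeq_eq i5 rfl Reach.refl)
        cases hz : z i with
        | false =>
          refine Reach.jz_zero i0 (by rw [e1, hz]) (Reach.jeq_ne i3 ?_ hend)
          rw [hv, e4]
          intro h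
          exact hbi (by rw [h, hz]; rfl)
        | true =>
          refine Reach.jz_one i0 (by rw [e1, hz])
            (Reach.jeq_ne i1 ?_ (Reach.jeq_eq i2 rfl hend))
          rw [hv, e5]
          intro h
          exact hbi (by rw [h, hz]; rfl)
  have outer : ∀ m ρ, ρ 0 = m → ρ 4 = 0 → ρ 5 = 1 →
      ((∀ j < len m, (z j).toNat = bit m j) ∧ ∃ ρ', Reach z (prog p) (1, ρ) (b + 8, ρ')) ∨
      ((∃ j < len m, (z j).toNat ≠ bit m j) ∧ ∃ ρ', Reach z (prog p) (1, ρ) (1, ρ') ∧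
        ρ' 0 = m + 1 ∧ ρ' 4 = 0 ∧ ρ' 5 = 1) := by
    intro m ρ h0 h4 h5
    obtain ⟨ρ₁, hr₁, hv₁, hs₁⟩ := h₁ z (prog p) hC₁ ρ
    have hv : ρ₁ 2 = len m := by
      rw [hv₁, ← h0]
      simp [List.Vector.ofFn]
    have hgo : Reach z (prog p) (1, ρ) (a + 1, Function.update ρ₁ 1 0) :=
      hr₁.trans (Reach.clr hclr Reach.refl)
    rcases inner m (len m) 0 (Function.update ρ₁ 1 0) (by omega)
      (by simp [hs₁, h0]) (by simp) (by simp [hv]) (by simp [hs₁, h4]) (by simp [hs₁, h5])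
      (by simp) with ⟨h, ρ', hr⟩ | ⟨h, ρ', hr, h'⟩
    · exact .inl ⟨h, ρ', hgo.trans hr⟩
    · exact .inr ⟨h, ρ', hgo.trans hr, h'⟩
  have start : ∀ m, (∀ m' < m, ∃ i < len m', (z i).toNat ≠ bit m' i) →
      ∃ ρ, Reach z (prog p) (0, fun _ => 0) (1, ρ) ∧ ρ 0 = m ∧ ρ 4 = 0 ∧ ρ 5 = 1 := by
    intro m
    induction m with
    | zero =>
      intro _
      exact ⟨_, Reach.inc hinc5 Reach.refl, by simp, by simp, by simp⟩
    | succ m ih =>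
      intro h
      obtain ⟨ρ, hr, h0, h4, h5⟩ := ih fun m' hm' => h m' (by omega)
      rcases outer m ρ h0 h4 h5 with ⟨hm, -⟩ | ⟨-, ρ', hr', h'⟩
      · obtain ⟨i, hi, hi'⟩ := h m (by omega)
        exact absurd (hm i hi) hi'
      · exact ⟨ρ', hr.trans hr', h'⟩
  constructor
  · intro hnh
    by_contra! hex
    classical
    set m := Nat.find hex with hm
    obtain ⟨ρ, hr, h0, h4, h5⟩ := start m fun m' hm' => by
      have := Nat.find_min hex hm'
      push Not at this
      exact this
    rcases outer m ρ h0 h4 h5 with ⟨-, ρ', hr'⟩ | ⟨⟨i, hi, hi'⟩, -⟩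
    · obtain ⟨n, hn⟩ := hr.trans hr'
      refine hnh n ?_
      rw [run, hn]
      exact i8
    · exact hi' (Nat.find_spec hex i hi)
  · intro h n hn
    choose ρ hr h0 h4 h5 using fun m => start m fun m' _ => h m'
    choose t ht using hr
    have hinj : Function.Injective t := by
      intro m m' hmm
      have : ((1, ρ m) : ℕ × (ℕ → ℕ)) = (1, ρ m') := by rw [← ht, ← ht, hmm]
      rw [← h0 m, ← h0 m', (Prod.mk.inj this).2]
    obtain ⟨m, hm⟩ : ∃ m, n ≤ t m ∧ 1 ≤ len m := by
      by_contra! hcon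
      have : Set.Finite (Set.univ : Set ℕ) := by
        refine Set.Finite.of_finite_image (f := t) ((Set.finite_lt_nat n).subset ?_) hinj.injOn
        rintro _ ⟨m, -, rfl⟩
        by_contra hlt
        have := hcon m (by simpa using hlt)
        obtain ⟨i, hi, -⟩ := h m
        omega
      exact Set.infinite_univ this
    have h1 : run z (prog p) (t m) = (1, ρ m) := ht m
    have h2 := run_eq_of_halt hn hm.1
    obtain ⟨m', hm', hne⟩ : ∃ m', n ≤ t m' ∧ m' ≠ m := by
      by_contra! hcon
      have : Set.Finite (Set.univ : Set ℕ) := by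
        refine Set.Finite.of_finite_image (f := t)
          (((Set.finite_lt_nat n).union (Set.finite_singleton (t m))).subset ?_) hinj.injOn
        rintro _ ⟨m', -, rfl⟩
        rcases lt_or_ge (t m') n with h | h
        · exact .inl h
        · exact .inr (by rw [hcon m' h]; rfl)
      exact Set.infinite_univ this
    have h3 := run_eq_of_halt hn hm'
    have h4 : ((1, ρ m') : ℕ × (ℕ → ℕ)) = (1, ρ m) := by
      rw [← ht, ← ht]
      exact h3.trans h2.symm
    exact hne (by rw [← h0 m, ← h0 m', (Prod.mk.inj h4).2])

end Instr

open Instr in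
/-- Every effectively closed subset of Cantor space consists of the oracles with which some
register machine does not halt. -/
theorem IsPi01Cantor.exists_machine {Q : Set (ℕ → ℕ)} (hQ : IsPi01Cantor Q) :
    ∃ p : List Instr, ∀ z : ℕ → Bool, (∀ n, prog p (run z (prog p) n).1 ≠ halt) ↔
      (fun n => (z n).toNat) ∈ Q := by
  obtain ⟨f, hf, rfl⟩ := hQ
  have hf' : Nat.Partrec fun n => Part.some (Encodable.encode (f n)) :=
    Partrec.nat_iff.1 (Computable.encode.comp hf)
  obtain ⟨c, hc⟩ := Nat.Partrec.Code.exists_code.1 hf'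
  set g : ℕ → List ℕ := fun m =>
    ((Nat.Partrec.Code.evaln m.unpair.2 c m.unpair.1).bind
      fun e => Encodable.decode (α := List ℕ) e).getD [2] with hg
  have hgp : Primrec g := by
    refine Primrec.option_getD.comp (Primrec.option_bind (Nat.Partrec.Code.primrec_evaln.comp
      (((Primrec.snd.comp Primrec.unpair).pair (Primrec.const c)).pair
        (Primrec.fst.comp Primrec.unpair))) (Primrec.decode.comp Primrec.snd)) (Primrec.const [2])
  have hg₁ : ∀ m, g m = [2] ∨ ∃ n, g m = f n := by
    intro m
    rw [hg]
    cases he : Nat.Partrec.Code.evaln m.unpair.2 c m.unpair.1 with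
    | none => simp [he]
    | some e =>
      have := Nat.Partrec.Code.evaln_sound (by rw [he]; rfl)
      rw [hc] at this
      obtain rfl := Part.mem_some_iff.1 this
      exact .inr ⟨m.unpair.1, by simp [he]⟩
  have hg₂ : ∀ n, ∃ m, g m = f n := by
    intro n
    have : Encodable.encode (f n) ∈ Nat.Partrec.Code.eval c n := by rw [hc]; exact Part.mem_some _
    obtain ⟨k, hk⟩ := Nat.Partrec.Code.evaln_complete.1 this
    refine ⟨Nat.pair n k, ?_⟩
    rw [hg]
    simp [Option.mem_def.1 hk]
  obtain ⟨p, hp⟩ := exists_checker (len := fun m => (g m).length)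
    (bit := fun m i => (g m)[i]?.getD 2)
    (Nat.Primrec'.prim_iff.2 (Primrec.list_length.comp (hgp.comp Primrec.vector_head)))
    (Nat.Primrec'.prim_iff.2 (Primrec.option_getD.comp (Primrec.list_getElem?.comp
      (hgp.comp Primrec.vector_head) (Primrec.vector_head.comp Primrec.vector_tail))
      (Primrec.const 2)))
  refine ⟨p, fun z => (hp z).trans ?_⟩
  have key : ∀ l : List ℕ, (fun n => (z n).toNat) ∉ cylinder l ↔
      ∃ i < l.length, (z i).toNat ≠ l[i]?.getD 2 := by
    intro l
    simp only [cylinder, Set.mem_ofPred_eq, not_forall]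
    constructor
    · rintro ⟨i, hi, h⟩
      exact ⟨i, hi, by simpa [List.getElem?_eq_getElem hi] using h⟩
    · rintro ⟨i, hi, h⟩
      exact ⟨i, hi, by simpa [List.getElem?_eq_getElem hi] using h⟩
  have hcs : (fun n => (z n).toNat) ∈ cantorSpace := fun n => Bool.toNat_le (z n)
  simp only [Set.mem_sdiff, hcs, true_and, Set.mem_iUnion, not_exists]
  constructor
  · intro h n
    obtain ⟨m, hm⟩ := hg₂ n
    exact (key _).2 (by rw [← hm]; exact h m)
  · intro h m
    rcases hg₁ m with h2 | ⟨n, hn⟩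
    · refine ⟨0, by simp [h2], ?_⟩
      simp only [h2]
      cases z 0 <;> simp
    · exact (key (g m)).1 (by rw [hn]; exact h n)

/-! ### Wang tiles -/

/-- Data attached to a line (row or column) of a board. -/
structure LineData where
  dir : Bool
  mark : Bool
  kap : ZMod 4
  z : Bool
  e : Bool
  pc : ℕ
  flag : Bool

/-- Data attached to a cell of a board: those of its column and of its row, and the
comparisons of its abscissa with the ordinate and the registers. -/
structure CellData where
  u : LineData
  v : LineData
  d1 : Ordering
  d2 : Ordering
  rho : ℕ → Ordering

/-- The colour of an edge of a tile, carrying the data of the surrounding cells of the board. -/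
structure Wire where
  l : CellData
  r : CellData
  c : ℕ
  t : Bool
  base : Bool

/-- A Wang tile; `ty` compares the level of the column with that of the row. -/
structure Tile where
  ty : Ordering
  W : Wire
  E : Wire
  S : Wire
  N : Wire

/-- Transposition. -/
def CellData.tr (d : CellData) : CellData := { d with u := d.v, v := d.u }

/-- Transposition. -/
def Wire.tr (w : Wire) : Wire := { w with l := w.l.tr, r := w.r.tr }

/-- Transposition. -/
def Tile.tr (t : Tile) : Tile :=
  { ty := t.ty.swap, W := t.S.tr, E := t.N.tr, S := t.W.tr, N := t.E.tr }

@[simp] theorem Tile.tr_tr (t : Tile) : t.tr.tr = t := by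
  cases t; simp [Tile.tr, Wire.tr, CellData.tr]

/-- The change of class of a wire at a crossing. -/
def classRule (ty : Ordering) (c c' : ℕ) (inn : Bool) : Prop :=
  match ty with
  | .eq => c = 3 ∧ c' = 0
  | .gt => c = 1 ∧ c' = 2
  | .lt => if inn then (c = 0 ∧ c' = 1) ∨ (c = 2 ∧ c' = 3) else c = c'

/-- Consecutive lines of a board. -/
structure LineData.Next (a b : LineData) : Prop where
  dir : b.dir = !a.dir
  mark : b.mark = true → b.dir = false
  kap : b.kap = if b.mark then a.kap + 1 else a.kap

/-- The relation between consecutive levels. -/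
structure LineData.Up (a b : LineData) : Prop where
  mark : b.mark = true ↔ a.mark = true ∧ a.kap = 0
  e : a.e = b.z

/-- The structural rules about the row of a tile. -/
structure Tile.RowOk (t : Tile) : Prop where
  base : t.E.base = t.W.base
  tag : t.E.t = !t.W.t
  cross : t.S.base = t.E.t
  same : t.ty ≠ .eq → t.E.l = t.W.l ∧ t.E.r = t.W.r
  cls : t.W.base = false → classRule t.ty t.W.c t.E.c t.S.r.v.dir
  ty : t.W.base = true → t.S.base = false → t.ty = .gt
  next : t.ty = .eq → t.W.l.u.Next t.W.r.u ∧ t.W.l.v = t.W.r.v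
  low : t.ty = .eq → t.W.base = true → t.W.r.u.mark = !t.W.r.u.dir
  up : t.ty = .gt → t.W.l.u.dir = false → t.W.l.u.Up t.S.r.u

/-- The structural rules of a tile. -/
structure Tile.Struct (t : Tile) : Prop where
  row : t.RowOk
  col : t.tr.RowOk
  ty : t.W.base = true → t.S.base = true → t.ty = .eq
  cell : t.ty = .eq → t.E.l = t.W.r ∧ t.S.r = t.W.r ∧ t.N.l = t.W.r

theorem CellData.tr_injective {d d' : CellData} (h : d.tr = d'.tr) : d = d' := by
  have := congrArg CellData.tr h
  exact this

theorem Tile.Struct.tr {t : Tile} (h : t.Struct) : t.tr.Struct := by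
  refine ⟨h.col, by simpa using h.row, fun h₁ h₂ => ?_, fun h₁ => ?_⟩
  · have := h.ty h₂ h₁
    simp [Tile.tr, this]
  · have h₁ : t.ty = .eq := by simpa [Tile.tr] using h₁
    obtain ⟨ha, hb, hc⟩ := h.cell h₁
    simp [Tile.tr, Wire.tr, ha, hb, hc]

/-- A valid tiling of the quadrant. -/
structure StructTiling (t : ℕ → ℕ → Tile) : Prop where
  ok : ∀ i j, (t i j).Struct
  hor : ∀ i j, (t i j).E = (t (i + 1) j).W
  ver : ∀ i j, (t i j).N = (t i (j + 1)).S

theorem StructTiling.tr {t : ℕ → ℕ → Tile} (h : StructTiling t) :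
    StructTiling (fun i j => (t j i).tr) :=
  ⟨fun i j => (h.ok j i).tr, fun i j => by simp [Tile.tr, h.ver j i],
    fun i j => by simp [Tile.tr, h.hor j i]⟩

/-- The row conditions on a lattice of crossings of lines of level at least `n`: those of level
exactly `n` are the columns `i ≡ a` and the rows `j ≡ b` modulo `2`. -/
structure HalfLat (t : ℕ → ℕ → Tile) (a b : ℕ) : Prop where
  ok : ∀ i j, (t i j).Struct
  ha : a < 2
  eq : ∀ i j, i % 2 = a → j % 2 = b → (t i j).ty = .eq
  gt : ∀ i j, i % 2 ≠ a → j % 2 = b → (t i j).ty = .gt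
  data : ∀ i j, (t i j).E.l = (t (i + 1) j).W.l ∧ (t i j).E.r = (t (i + 1) j).W.r
  cls : ∀ i j, j % 2 ≠ b → (t i j).E.c = (t (i + 1) j).W.c
  base : ∀ i j, j % 2 ≠ b → (t i j).W.base = false

/-- The lattice conditions, for rows and columns. -/
structure Lat (t : ℕ → ℕ → Tile) (a b : ℕ) : Prop where
  row : HalfLat t a b
  col : HalfLat (fun i j => (t j i).tr) b a

theorem Lat.tr {t : ℕ → ℕ → Tile} {a b : ℕ} (h : Lat t a b) :
    Lat (fun i j => (t j i).tr) b a := ⟨h.col, by simpa using h.row⟩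

theorem Lat.lt {t : ℕ → ℕ → Tile} {a b : ℕ} (h : Lat t a b) {i j : ℕ} (hi : i % 2 = a)
    (hj : j % 2 ≠ b) : (t i j).ty = .lt := by
  have := h.col.gt j i hj hi
  simpa [Tile.tr] using this

namespace StructTiling
variable {t : ℕ → ℕ → Tile}

theorem colBase (h : StructTiling t) (i j : ℕ) : (t i j).S.base = (t i 0).S.base := by
  induction j with
  | zero => rfl
  | succ j ih =>
    rw [← ih, ← h.ver]
    exact (h.ok i j).col.base

theorem colBase_succ (h : StructTiling t) (i : ℕ) :
    (t (i + 1) 0).S.base = !(t i 0).S.base := by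
  rw [(h.ok _ _).row.cross, (h.ok _ _).row.tag, ← h.hor, (h.ok i 0).row.cross]

theorem exists_colBase (h : StructTiling t) : ∃ a < 2, ∀ i j, (t i j).S.base = true ↔ i % 2 = a := by
  have key : ∀ i, (t i 0).S.base = xor (t 0 0).S.base (decide (i % 2 = 1)) := by
    intro i
    induction i with
    | zero => simp
    | succ i ih =>
      rw [h.colBase_succ, ih]
      rcases Nat.mod_two_eq_zero_or_one i with hi | hi
      · have : (i + 1) % 2 = 1 := by omega
        simp [hi, this]
      · have : (i + 1) % 2 = 0 := by omega
        simp [hi, this]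
  cases h0 : (t 0 0).S.base with
  | true =>
    refine ⟨0, by omega, fun i j => ?_⟩
    rw [h.colBase, key, h0]
    simp
  | false =>
    refine ⟨1, by omega, fun i j => ?_⟩
    rw [h.colBase, key, h0]
    simp

theorem halfLat (h : StructTiling t) {a b : ℕ} (ha : a < 2)
    (hc : ∀ i j, (t i j).S.base = true ↔ i % 2 = a)
    (hr : ∀ i j, (t i j).W.base = true ↔ j % 2 = b) : HalfLat t a b where
  ok := h.ok
  ha := ha
  eq i j hi hj := (h.ok i j).ty ((hr i j).2 hj) ((hc i j).2 hi)
  gt i j hi hj := (h.ok i j).row.ty ((hr i j).2 hj) (by rw [← Bool.not_eq_true, hc]; exact hi)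
  data i j := by simp [h.hor]
  cls i j _ := by simp [h.hor]
  base i j hj := by rw [← Bool.not_eq_true, hr]; exact hj

theorem exists_lat (h : StructTiling t) : ∃ a b, Lat t a b ∧
    ∀ i j, j % 2 = b → (t i j).W.base = true := by
  obtain ⟨a, ha, hc⟩ := h.exists_colBase
  obtain ⟨b, hb, hr⟩ := h.tr.exists_colBase
  have hr' : ∀ i j, (t i j).W.base = true ↔ j % 2 = b := fun i j => hr j i
  exact ⟨a, b, ⟨h.halfLat ha hc hr', h.tr.halfLat hb hr fun i j => hc j i⟩, fun i j => (hr' i j).2⟩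

end StructTiling

/-- The data of the cells of level exactly `n`. -/
def eqData (t : ℕ → ℕ → Tile) (a b i j : ℕ) : CellData := (t (2 * i + a) (2 * j + b)).W.r

namespace HalfLat
variable {t : ℕ → ℕ → Tile} {a b : ℕ}

theorem eqData_left (h : HalfLat t a b) (hb : b < 2) (i j : ℕ) :
    (t (2 * i + a + 1) (2 * j + b)).W.l = eqData t a b i j := by
  have := h.ha
  rw [← (h.data _ _).1]
  exact ((h.ok _ _).cell (h.eq _ _ (by omega) (by omega))).1

theorem row_link (h : HalfLat t a b) (hb : b < 2) (i j : ℕ) :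
    (t (2 * i + a + 1) (2 * j + b)).W.r = eqData t a b (i + 1) j ∧
    (t (2 * (i + 1) + a) (2 * j + b)).W.l = eqData t a b i j := by
  have := h.ha
  have hs := (h.ok (2 * i + a + 1) (2 * j + b)).row.same
    (by rw [h.gt _ _ (by omega) (by omega)]; simp)
  have hd := h.data (2 * i + a + 1) (2 * j + b)
  have e : 2 * i + a + 1 + 1 = 2 * (i + 1) + a := by ring
  rw [e] at hd
  exact ⟨by rw [← hs.2, hd.2]; rfl, by rw [← hd.1, hs.1, h.eqData_left hb]⟩

theorem next (h : HalfLat t a b) (hb : b < 2) (i j : ℕ) :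
    (eqData t a b i j).u.Next (eqData t a b (i + 1) j).u ∧
      (eqData t a b i j).v = (eqData t a b (i + 1) j).v := by
  have := h.ha
  have := (h.ok (2 * (i + 1) + a) (2 * j + b)).row.next (h.eq _ _ (by omega) (by omega))
  rwa [(h.row_link hb i j).2] at this

end HalfLat

namespace Lat
variable {t : ℕ → ℕ → Tile} {a b : ℕ}

theorem ha (h : Lat t a b) : a < 2 := h.row.ha
theorem hb (h : Lat t a b) : b < 2 := h.col.ha

theorem eqData_tr (h : Lat t a b) (i j : ℕ) :
    eqData (fun i j => (t j i).tr) b a j i = (eqData t a b i j).tr := by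
  have := h.ha
  have := h.hb
  have := ((h.row.ok (2 * i + a) (2 * j + b)).cell (h.row.eq _ _ (by omega) (by omega))).2.1
  simp [eqData, Tile.tr, Wire.tr, this]

theorem v_eq (h : Lat t a b) (i j : ℕ) : (eqData t a b i j).v = (eqData t a b 0 j).v := by
  induction i with
  | zero => rfl
  | succ i ih => rw [← ih, (h.row.next h.hb i j).2]

theorem u_eq (h : Lat t a b) (i j : ℕ) : (eqData t a b i j).u = (eqData t a b i 0).u := by
  have := h.tr.v_eq j i
  rwa [h.eqData_tr, h.eqData_tr] at this

theorem v_next (h : Lat t a b) (i j : ℕ) :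
    (eqData t a b i j).v.Next (eqData t a b i (j + 1)).v := by
  have := (h.tr.row.next h.ha j i).1
  rwa [h.eqData_tr, h.eqData_tr] at this

end Lat

/-- The lattice of the lines of level at least `n + 1`. -/
def derived (t : ℕ → ℕ → Tile) (a b i j : ℕ) : Tile := t (2 * i + 1 + a) (2 * j + 1 + b)

theorem exists_parity {f : ℕ → Bool} (h : ∀ n, f (n + 1) = !f n) :
    ∃ a < 2, ∀ n, f n = false ↔ n % 2 = a := by
  cases h0 : f 0 with
  | false =>
    refine ⟨0, by omega, fun n => ?_⟩
    induction n with
    | zero => simp [h0]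
    | succ n ih =>
      rw [h, Bool.not_eq_false', ← Bool.not_eq_false, ih]
      omega
  | true =>
    refine ⟨1, by omega, fun n => ?_⟩
    induction n with
    | zero => simp [h0]
    | succ n ih =>
      rw [h, Bool.not_eq_false', ← Bool.not_eq_false, ih]
      omega

namespace Lat
variable {t : ℕ → ℕ → Tile} {a b : ℕ}

/-- The crossing of a row of level above `n` with the column of level `n` preceding a column of
level above `n`. -/
theorem cross (h : Lat t a b) (i j : ℕ) :
    classRule .lt (t (2 * i + a) (2 * j + 1 + b)).W.c (derived t a b i j).W.c
      (eqData t a b i (j + 1)).v.dir := by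
  have hA := h.ha
  have hB := h.hb
  have hc := (h.row.ok (2 * i + a) (2 * j + 1 + b)).row.cls (h.row.base _ _ (by omega))
  rw [h.lt (by omega) (by omega)] at hc
  have e : (t (2 * i + a) (2 * j + 1 + b)).S.r = eqData t a b i (j + 1) := by
    have := (h.tr.row.row_link h.ha j i).1
    rw [h.eqData_tr] at this
    rw [show 2 * j + 1 + b = 2 * j + b + 1 by ring]
    exact CellData.tr_injective this
  rw [e, h.row.cls _ _ (by omega)] at hc
  rwa [derived, show 2 * i + 1 + a = 2 * i + a + 1 by ring]

theorem derived_cls (h : Lat t a b) (i j : ℕ) :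
    (derived t a b i j).E.c = (t (2 * (i + 1) + a) (2 * j + 1 + b)).W.c := by
  have hB := h.hb
  rw [derived, h.row.cls _ _ (by omega)]
  congr 3
  ring

theorem derived_data (h : Lat t a b) (i j : ℕ) :
    (derived t a b i j).E.l = (derived t a b (i + 1) j).W.l ∧
      (derived t a b i j).E.r = (derived t a b (i + 1) j).W.r := by
  have hA := h.ha
  have hB := h.hb
  have h1 := h.row.data (2 * i + 1 + a) (2 * j + 1 + b)
  have h2 := h.row.data (2 * i + 1 + a + 1) (2 * j + 1 + b)
  have h3 := (h.row.ok (2 * i + 1 + a + 1) (2 * j + 1 + b)).row.same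
    (by rw [h.lt (by omega) (by omega)]; simp)
  rw [derived, derived, show 2 * (i + 1) + 1 + a = 2 * i + 1 + a + 1 + 1 by ring]
  exact ⟨by rw [h1.1, ← h3.1, h2.1], by rw [h1.2, ← h3.2, h2.2]⟩

/-- Rows of level exactly `n + 1` alternate between cells of equal levels and others. -/
theorem derived_row (h : Lat t a b) {j : ℕ} (hj : (eqData t a b 0 (j + 1)).v.dir = true) (i : ℕ) :
    ((derived t a b i j).ty = .eq ∧ (derived t a b (i + 1) j).ty ≠ .eq) ∨
      ((derived t a b i j).ty = .gt) := by
  have hB := h.hb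
  have hcls : ∀ i, ((derived t a b i j).W.c = 3 ∧ (derived t a b i j).E.c = 0 ∧
      (derived t a b i j).ty = .eq) ∨ ((derived t a b i j).W.c = 1 ∧ (derived t a b i j).E.c = 2 ∧
      (derived t a b i j).ty = .gt) := by
    intro i
    have h1 := h.cross i j
    have h2 := h.cross (i + 1) j
    rw [h.v_eq, hj] at h1 h2
    rw [← h.derived_cls] at h2
    have h3 := (h.row.ok (2 * i + 1 + a) (2 * j + 1 + b)).row.cls (h.row.base _ _ (by omega))
    change classRule (derived t a b i j).ty (derived t a b i j).W.c (derived t a b i j).E.c _ at h3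
    revert h3
    simp only [classRule, if_true] at h1 h2
    cases hty : (derived t a b i j).ty with
    | eq => simp only [classRule]; intro h3; simp [h3]
    | gt => simp only [classRule]; intro h3; simp [h3]
    | lt =>
      simp only [classRule]
      split_ifs
      · intro h3; omega
      · intro h3; omega
  rcases hcls i with ⟨-, h0, hty⟩ | ⟨-, -, hty⟩
  · refine .inl ⟨hty, fun h' => ?_⟩
    have h2 := h.cross (i + 1) j
    rw [h.v_eq, hj] at h2
    simp only [classRule, if_true, ← h.derived_cls] at h2
    rcases hcls (i + 1) with ⟨h3, -, -⟩ | ⟨-, -, h3⟩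
    · omega
    · rw [h'] at h3
      exact absurd h3 (by simp)
  · exact .inr hty

theorem derived_tr (t : ℕ → ℕ → Tile) (a b i j : ℕ) :
    derived (fun i j => (t j i).tr) b a j i = (derived t a b i j).tr := rfl

theorem derived_halfLat (h : Lat t a b) {a' b' : ℕ} (ha' : a' < 2)
    (hc : ∀ i, (eqData t a b i 0).u.dir = false ↔ i % 2 = a')
    (hr : ∀ j, (eqData t a b 0 j).v.dir = false ↔ j % 2 = b') :
    HalfLat (derived t a b) a' b' := by
  have hA := h.ha
  have hB := h.hb
  have hr' : ∀ j, (eqData t a b 0 (j + 1)).v.dir = true ↔ j % 2 = b' := fun j => by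
    rw [(h.v_next 0 j).dir, Bool.not_eq_true', hr]
  have hc' : ∀ i, (eqData t a b (i + 1) 0).u.dir = true ↔ i % 2 = a' := fun i => by
    rw [(h.row.next hB i 0).1.dir, Bool.not_eq_true', hc]
  have heq : ∀ i j, i % 2 = a' → j % 2 = b' → (derived t a b i j).ty = .eq := by
    intro i j hi hj
    rcases h.derived_row ((hr' j).2 hj) i with h1 | h1
    · exact h1.1
    · rcases h.tr.derived_row (j := i) (by rw [h.eqData_tr]; exact (hc' i).2 hi) j with h2 | h2
      · have h2 := h2.1
        rw [derived_tr] at h2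
        simpa [Tile.tr] using h2
      · rw [derived_tr] at h2
        simp [Tile.tr, h1] at h2
  refine ⟨fun i j => h.row.ok _ _, ha', heq, fun i j hi hj => ?_, h.derived_data, fun i j hj => ?_,
    fun i j _ => h.row.base _ _ (by omega)⟩
  · rcases h.derived_row ((hr' j).2 hj) i with h1 | h1
    · exact absurd (heq (i + 1) j (by omega) hj) h1.2
    · exact h1
  · have h2 := h.cross (i + 1) j
    rw [h.v_eq] at h2
    have : (eqData t a b 0 (j + 1)).v.dir = false := by
      rw [← Bool.not_eq_true, hr']; exact hj
    simp only [this, classRule, Bool.false_eq_true, if_false] at h2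
    rw [← h2, ← h.derived_cls]

/-- The stage lemma. -/
theorem exists_derived (h : Lat t a b) : ∃ a' b', Lat (derived t a b) a' b' ∧
    (∀ i, (eqData t a b i 0).u.dir = false ↔ i % 2 = a') ∧
    (∀ j, (eqData t a b 0 j).v.dir = false ↔ j % 2 = b') := by
  obtain ⟨a', ha', hc⟩ := exists_parity (f := fun i => (eqData t a b i 0).u.dir)
    fun i => (h.row.next h.hb i 0).1.dir
  obtain ⟨b', hb', hr⟩ := exists_parity (f := fun j => (eqData t a b 0 j).v.dir)
    fun j => (h.v_next 0 j).dir
  refine ⟨a', b', ⟨h.derived_halfLat ha' hc hr, h.tr.derived_halfLat hb' ?_ ?_⟩, hc, hr⟩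
  · intro j
    rw [h.eqData_tr]
    exact hr j
  · intro i
    rw [h.eqData_tr]
    exact hc i

/-- The relation between the data of consecutive levels. -/
theorem up (h : Lat t a b) {a' b' : ℕ} (h' : Lat (derived t a b) a' b')
    (hc : ∀ i, (eqData t a b i 0).u.dir = false ↔ i % 2 = a') (i : ℕ) :
    (eqData t a b (2 * i + a') 0).u.Up (eqData (derived t a b) a' b' i 0).u := by
  have hA := h.ha
  have hB := h.hb
  have hA' := h'.ha
  have hB' := h'.hb
  have h1 := (h.row.ok (2 * (2 * i + a') + a + 1) (2 * b' + b)).row.up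
    (h.row.gt _ _ (by omega) (by omega))
  rw [h.row.eqData_left hB, h.u_eq] at h1
  have h2 := h1 ((hc _).2 (by omega))
  have h3 : (t (2 * (2 * i + a') + a + 1) (2 * b' + b)).S.r = eqData (derived t a b) a' b' i 0 := by
    have h4 := (h.tr.row.data (2 * b' + b) (2 * (2 * i + a') + a + 1)).2
    have h5 := (h.tr.row.ok (2 * b' + b) (2 * (2 * i + a') + a + 1)).row.same (by
      have := h.row.gt (2 * (2 * i + a') + a + 1) (2 * b' + b) (by omega) (by omega)
      simp [Tile.tr, this])
    have h6 := ((h'.row.ok (2 * i + a') (2 * 0 + b')).cell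
      (h'.row.eq _ _ (by omega) (by omega))).2.1
    have h7 : (t (2 * (2 * i + a') + a + 1) (2 * b' + b + 1)).S.r =
        eqData (derived t a b) a' b' i 0 := by
      rw [eqData, ← h6, derived]
      congr 3
      · ring
      · ring
    rw [← h7]
    exact CellData.tr_injective (h5.2.symm.trans h4)
  rwa [h3] at h2

end Lat

/-! ### Boards -/

/-- The possible evolutions of `compare x y` when `x` is increased by one. -/
def hstep : Ordering → Ordering → Prop
  | .lt, o => o = .lt ∨ o = .eq
  | .eq, o => o = .gt
  | .gt, o => o = .gt

/-- The possible evolutions of `compare x y` when `y` is increased by one. -/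
def vstep : Ordering → Ordering → Prop
  | .lt, o => o = .lt
  | .eq, o => o = .lt
  | .gt, o => o = .gt ∨ o = .eq

theorem hstep_compare (x y : ℕ) : hstep (compare x y) (compare (x + 1) y) := by
  rcases lt_trichotomy x y with h | rfl | h
  · rw [Nat.compare_eq_lt.2 h]
    rcases Nat.lt_or_eq_of_le (Nat.succ_le_of_lt h) with h | h
    · exact .inl (Nat.compare_eq_lt.2 h)
    · exact .inr (Nat.compare_eq_eq.2 h)
  · rw [Nat.compare_eq_eq.2 rfl]
    exact Nat.compare_eq_gt.2 (by omega)
  · rw [Nat.compare_eq_gt.2 h]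
    exact Nat.compare_eq_gt.2 (by omega)

theorem vstep_compare (x y : ℕ) : vstep (compare x y) (compare x (y + 1)) := by
  rcases lt_trichotomy x y with h | rfl | h
  · rw [Nat.compare_eq_lt.2 h]
    exact Nat.compare_eq_lt.2 (by omega)
  · rw [Nat.compare_eq_eq.2 rfl]
    exact Nat.compare_eq_lt.2 (by omega)
  · rw [Nat.compare_eq_gt.2 h]
    rcases Nat.lt_or_eq_of_le (Nat.succ_le_of_lt h) with h | h
    · exact .inl (Nat.compare_eq_gt.2 h)
    · exact .inr (Nat.compare_eq_eq.2 h.symm)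

theorem eq_compare_of_step {x y : ℕ} {o : Ordering} (h₁ : hstep (compare x (y + 1)) o)
    (h₂ : vstep (compare (x + 1) y) o) : o = compare (x + 1) (y + 1) := by
  rcases lt_trichotomy x y with h | rfl | h
  · rw [Nat.compare_eq_lt.2 (by omega : x + 1 < y + 1)]
    rcases Nat.lt_or_eq_of_le (Nat.succ_le_of_lt h) with h | h
    · rwa [Nat.compare_eq_lt.2 (by omega : x + 1 < y)] at h₂
    · rwa [Nat.compare_eq_eq.2 h] at h₂
  · rw [Nat.compare_eq_lt.2 (by omega : x < x + 1)] at h₁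
    rw [Nat.compare_eq_gt.2 (by omega : x < x + 1)] at h₂
    rw [Nat.compare_eq_eq.2 rfl]
    rcases h₁ with rfl | rfl
    · simp [vstep] at h₂
    · rfl
  · rw [Nat.compare_eq_gt.2 (by omega : y + 1 < x + 1)]
    rcases Nat.lt_or_eq_of_le (Nat.succ_le_of_lt h) with h | h
    · rwa [Nat.compare_eq_gt.2 (by omega : y + 1 < x)] at h₁
    · rwa [Nat.compare_eq_eq.2 h.symm] at h₁

theorem eq_compare_of_hstep {x y : ℕ} {o : Ordering} (h₁ : hstep (compare x y) o) (h : y ≤ x) :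
    o = compare (x + 1) y := by
  rw [Nat.compare_eq_gt.2 (by omega : y < x + 1)]
  rcases Nat.lt_or_eq_of_le h with h | h
  · rwa [Nat.compare_eq_gt.2 h] at h₁
  · rwa [Nat.compare_eq_eq.2 h.symm] at h₁

theorem eq_compare_of_vstep {x y : ℕ} {o : Ordering} (h₁ : vstep (compare x y) o) (h : x ≤ y) :
    o = compare x (y + 1) := by
  rw [Nat.compare_eq_lt.2 (by omega : x < y + 1)]
  rcases Nat.lt_or_eq_of_le h with h | h
  · rwa [Nat.compare_eq_lt.2 h] at h₁
  · rwa [Nat.compare_eq_eq.2 h] at h₁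

/-- The evolution of the comparisons with the registers from a row to the next one. -/
def Instr.regRule (c d : CellData) : Instr → Prop
  | set a b => ∀ r, d.rho r = if r = a then c.rho b else c.rho r
  | clr a => ∀ r, d.rho r = if r = a then (if d.u.mark then .eq else .gt) else c.rho r
  | inc a => vstep (c.rho a) (d.rho a) ∧ ∀ r, r ≠ a → d.rho r = c.rho r
  | _ => d.rho = c.rho

/-- The next instruction. -/
def Instr.nextPc (v : LineData) : Instr → ℕ
  | jeq _ _ l => if v.flag then l else v.pc + 1
  | jz _ l => if v.flag then l else v.pc + 1
  | _ => v.pc + 1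

/-- The flag of a row tells whether a jump is performed. -/
def Instr.flagRule (d : CellData) : Instr → Prop
  | jeq a b _ => d.rho a = .eq → (d.v.flag = true ↔ d.rho b = .eq)
  | jz b _ => d.rho b = .eq → (d.v.flag = true ↔ d.u.z = false)
  | halt => False
  | _ => True

/-- Horizontally consecutive cells. -/
structure CellData.HRule (c d : CellData) : Prop where
  d1 : d.u.mark = false → hstep c.d1 d.d1
  rho : d.u.mark = false → ∀ r, hstep (c.rho r) (d.rho r)
  d2 : d.u.mark = false → if c.u.dir = false then d.d2 = c.d2 else hstep c.d2 d.d2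

/-- Vertically consecutive cells. -/
structure CellData.VRule (p : ℕ → Instr) (c d : CellData) : Prop where
  d1 : d.v.mark = false → vstep c.d1 d.d1
  d2 : d.v.mark = false → vstep c.d2 d.d2
  rho : d.v.mark = false → (p c.v.pc).regRule c d
  pc : d.v.mark = false → d.v.pc = (p c.v.pc).nextPc c.v

/-- The rules about a single cell. -/
structure CellData.Ok (p : ℕ → Instr) (d : CellData) : Prop where
  origin : d.u.mark = true → d.v.mark = true → d.d1 = .eq ∧ d.d2 = .eq ∧ ∀ r, d.rho r = .eq
  pc : d.v.mark = true → d.v.pc = 0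
  z : d.d1 = .eq → d.u.z = d.v.z
  e : d.d2 = .eq → d.u.kap = 0 → d.u.e = d.v.z
  flag : (p d.v.pc).flagRule d

/-- The cells of a board of size `N`. -/
structure Board (p : ℕ → Instr) (N : ℕ) (D : ℕ → ℕ → CellData) : Prop where
  umark : ∀ x < N, ∀ y < N, (D x y).u.mark = true ↔ x = 0
  vmark : ∀ x < N, ∀ y < N, (D x y).v.mark = true ↔ y = 0
  dir : ∀ x < N, ∀ y < N, (D x y).u.dir = false ↔ x % 2 = 0
  u : ∀ x y, (D x y).u = (D x 0).u
  v : ∀ x y, (D x y).v = (D 0 y).v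
  h : ∀ x y, (D x y).HRule (D (x + 1) y)
  hv : ∀ x y, (D x y).VRule p (D x (y + 1))
  ok : ∀ x y, (D x y).Ok p

namespace Board
variable {p : ℕ → Instr} {N : ℕ} {D : ℕ → ℕ → CellData}

theorem umark_succ (h : Board p N D) {x y : ℕ} (hx : x + 1 < N) (hy : y < N) :
    (D (x + 1) y).u.mark = false := by
  rw [← Bool.not_eq_true, h.umark _ hx _ hy]
  omega

theorem vmark_succ (h : Board p N D) {x y : ℕ} (hx : x < N) (hy : y + 1 < N) :
    (D x (y + 1)).v.mark = false := by
  rw [← Bool.not_eq_true, h.vmark _ hx _ hy]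
  omega

theorem d1_eq (h : Board p N D) {x y : ℕ} (hx : x < N) (hy : y < N) :
    (D x y).d1 = compare x y := by
  induction y generalizing x with
  | zero =>
    induction x with
    | zero => exact ((h.ok 0 0).origin ((h.umark _ hx _ hy).2 rfl) ((h.vmark _ hx _ hy).2 rfl)).1
    | succ x ih =>
      have := (h.h x 0).d1 (h.umark_succ hx hy)
      rw [ih (by omega)] at this
      exact eq_compare_of_hstep this (by omega)
  | succ y ihy =>
    have h2 : ∀ x < N, vstep (compare x y) (D x (y + 1)).d1 := fun x hx => by
      rw [← ihy hx (by omega)]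
      exact (h.hv x y).d1 (h.vmark_succ hx hy)
    induction x with
    | zero => exact eq_compare_of_vstep (h2 0 hx) (by omega)
    | succ x ih =>
      have h1 := (h.h x (y + 1)).d1 (h.umark_succ hx hy)
      rw [ih (by omega)] at h1
      exact eq_compare_of_step h1 (h2 _ hx)

theorem d2_eq (h : Board p N D) {x y : ℕ} (hx : x < N) (hy : y < N) :
    (D x y).d2 = compare (x / 2) y := by
  have hh : ∀ x y, x + 1 < N → y < N → (D x y).d2 = compare (x / 2) y → ((x + 1) / 2 = x / 2 ∧
      (D (x + 1) y).d2 = compare ((x + 1) / 2) y) ∨ ((x + 1) / 2 = x / 2 + 1 ∧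
      hstep (compare (x / 2) y) (D (x + 1) y).d2) := by
    intro x y hx hy ih
    have h1 := (h.h x y).d2 (h.umark_succ hx hy)
    by_cases hd : x % 2 = 0
    · rw [if_pos ((h.dir _ (by omega) _ hy).2 hd), ih] at h1
      have : (x + 1) / 2 = x / 2 := by omega
      exact .inl ⟨this, by rw [h1, this]⟩
    · rw [if_neg (fun h' => hd ((h.dir _ (by omega) _ hy).1 h')), ih] at h1
      exact .inr ⟨by omega, h1⟩
  induction y generalizing x with
  | zero =>
    induction x with
    | zero => exact ((h.ok 0 0).origin ((h.umark _ hx _ hy).2 rfl) ((h.vmark _ hx _ hy).2 rfl)).2.1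
    | succ x ih =>
      rcases hh x 0 hx hy (ih (by omega)) with h1 | ⟨h1, h3⟩
      · exact h1.2
      · rw [h1]
        exact eq_compare_of_hstep h3 (by omega)
  | succ y ihy =>
    have h2 : ∀ x < N, vstep (compare (x / 2) y) (D x (y + 1)).d2 := fun x hx => by
      rw [← ihy hx (by omega)]
      exact (h.hv x y).d2 (h.vmark_succ hx hy)
    induction x with
    | zero => exact eq_compare_of_vstep (h2 0 hx) (by omega)
    | succ x ih =>
      rcases hh x (y + 1) hx hy (ih (by omega)) with h1 | ⟨h1, h3⟩
      · exact h1.2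
      · have h2 := h2 _ hx
        rw [h1] at h2 ⊢
        exact eq_compare_of_step h3 h2

theorem z_eq (h : Board p N D) {x : ℕ} (hx : x < N) : (D x 0).u.z = (D 0 x).v.z := by
  rw [← h.u x x, ← h.v x x]
  exact (h.ok x x).z (by rw [h.d1_eq hx hx]; simp)

theorem e_eq (h : Board p N D) {x : ℕ} (hx : 2 * x < N) (hk : (D (2 * x) 0).u.kap = 0) :
    (D (2 * x) 0).u.e = (D 0 x).v.z := by
  rw [← h.u (2 * x) x, ← h.v (2 * x) x]
  exact (h.ok (2 * x) x).e (by rw [h.d2_eq hx (by omega)]; simp) (by rw [h.u, hk])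

theorem run_eq (h : Board p N D) {q : ℕ → Bool} {n : ℕ} (hn : n < N)
    (hq : ∀ x ≤ n, (D x 0).u.z = q x) {t : ℕ} (ht : t ≤ n) :
    (D 0 t).v.pc = (Instr.run q p t).1 ∧ (∀ r, (Instr.run q p t).2 r ≤ t) ∧
      ∀ x < N, ∀ r, (D x t).rho r = compare x ((Instr.run q p t).2 r) := by
  induction t with
  | zero =>
    have h0 := (h.ok 0 0).origin ((h.umark _ (by omega) _ (by omega)).2 rfl)
      ((h.vmark _ (by omega) _ (by omega)).2 rfl)
    refine ⟨(h.ok 0 0).pc ((h.vmark _ (by omega) _ (by omega)).2 rfl), fun r => le_rfl,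
      fun x => ?_⟩
    induction x with
    | zero => intro _ r; exact h0.2.2 r
    | succ x ih =>
      intro hx r
      have := (h.h x 0).rho (h.umark_succ hx (by omega)) r
      rw [ih (by omega) r] at this
      exact eq_compare_of_hstep this (Nat.zero_le _)
  | succ t ih =>
    obtain ⟨hpc, hle, hrho⟩ := ih (by omega)
    have hpc' : ∀ x, (D x t).v.pc = (Instr.run q p t).1 := fun x => by rw [h.v, hpc]
    have hreg : ∀ x < N, (p (Instr.run q p t).1).regRule (D x t) (D x (t + 1)) := fun x hx => by
      have := (h.hv x t).rho (h.vmark_succ hx (by omega))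
      rwa [hpc'] at this
    have hnext : (D 0 (t + 1)).v.pc = (p (Instr.run q p t).1).nextPc (D 0 t).v := by
      have := (h.hv 0 t).pc (h.vmark_succ (by omega) (by omega))
      rwa [hpc'] at this
    have hflag : ∀ x < N, (p (Instr.run q p t).1).flagRule (D x t) := fun x hx => by
      have := (h.ok x t).flag
      rwa [hpc'] at this
    rw [Instr.run_succ, Instr.step]
    cases hi : p (Instr.run q p t).1 with
    | set a b =>
      simp only [hi, Instr.regRule, Instr.nextPc, Instr.flagRule] at hreg hnext hflag
      refine ⟨by simp [hnext, hpc], fun r => ?_, fun x hx r => ?_⟩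
      · by_cases hr : r = a
        · subst hr; simpa using (hle b).trans (by omega)
        · simpa [hr] using (hle r).trans (by omega)
      · rw [hreg x hx]
        by_cases hr : r = a
        · subst hr; simp [hrho x hx]
        · simp [hr, hrho x hx]
    | clr a =>
      simp only [hi, Instr.regRule, Instr.nextPc, Instr.flagRule] at hreg hnext hflag
      refine ⟨by simp [hnext, hpc], fun r => ?_, fun x hx r => ?_⟩
      · by_cases hr : r = a
        · subst hr; simp
        · simpa [hr] using (hle r).trans (by omega)
      · rw [hreg x hx]
        by_cases hr : r = a
        · subst hr
          simp only [if_true, Function.update_self, h.umark x hx _ (show t + 1 < N by omega)]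
          split_ifs with hx0
          · simp [hx0]
          · exact (Nat.compare_eq_gt.2 (by omega)).symm
        · simp [hr, hrho x hx]
    | inc a =>
      simp only [hi, Instr.regRule, Instr.nextPc, Instr.flagRule] at hreg hnext hflag
      refine ⟨by simp [hnext, hpc], fun r => ?_, fun x hx r => ?_⟩
      · by_cases hr : r = a
        · subst hr; simpa using hle r
        · simpa [hr] using (hle r).trans (by omega)
      · by_cases hr : r = a
        · subst hr
          simp only [Function.update_self]
          induction x with
          | zero =>
            have h2 := (hreg 0 hx).1
            rw [hrho _ hx] at h2
            exact eq_compare_of_vstep h2 (by omega)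
          | succ x ihx =>
            have h1 := (h.h x (t + 1)).rho (h.umark_succ hx (by omega)) r
            have h2 := (hreg _ hx).1
            rw [ihx (by omega)] at h1
            rw [hrho _ hx] at h2
            exact eq_compare_of_step h1 h2
        · rw [(hreg x hx).2 r hr]
          simp [hr, hrho x hx]
    | jeq a b l =>
      simp only [hi, Instr.regRule, Instr.nextPc, Instr.flagRule] at hreg hnext hflag
      refine ⟨?_, fun r => (hle r).trans (by omega), fun x hx r => by rw [hreg x hx, hrho x hx]⟩
      have hl := hle a
      have h1 := hflag ((Instr.run q p t).2 a) (by omega)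
      rw [hrho _ (by omega), hrho _ (by omega)] at h1
      have h1 := h1 (by simp)
      rw [Nat.compare_eq_eq, h.v] at h1
      simp only [hnext, h1, hpc]
    | jz b l =>
      simp only [hi, Instr.regRule, Instr.nextPc, Instr.flagRule] at hreg hnext hflag
      refine ⟨?_, fun r => (hle r).trans (by omega), fun x hx r => by rw [hreg x hx, hrho x hx]⟩
      have hl := hle b
      have h1 := hflag ((Instr.run q p t).2 b) (by omega)
      rw [hrho _ (by omega)] at h1
      have h1 := h1 (by simp)
      rw [h.u, hq _ (by omega), h.v] at h1
      simp only [hnext, h1, hpc]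
    | halt =>
      simp only [hi, Instr.flagRule] at hflag
      exact (hflag 0 (by omega)).elim

theorem not_halt (h : Board p N D) {q : ℕ → Bool} {n : ℕ} (hn : n < N)
    (hq : ∀ x ≤ n, (D x 0).u.z = q x) : p (Instr.run q p n).1 ≠ .halt := by
  intro h'
  have h1 := (h.ok 0 n).flag
  rw [(h.run_eq hn hq le_rfl).1, h'] at h1
  exact h1

end Board

/-- The rules of a tile. -/
structure Tile.Ok (p : ℕ → Instr) (t : Tile) : Prop where
  struct : t.Struct
  h : t.ty = .eq → t.W.l.HRule t.W.r
  v : t.ty = .eq → t.S.l.VRule p t.W.r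
  cell : t.ty = .eq → t.W.r.Ok p

/-! ### Levels of a valid tiling -/

theorem kap_add {f : ℕ → LineData} (hf : ∀ i, (f i).Next (f (i + 1))) {N α : ℕ}
    (hα : α < N) (hm : ∀ i, (f i).mark = true ↔ i % N = α) (P : ℕ) {x : ℕ} (hx : x < N) :
    (f (α + P * N + x)).kap = (f α).kap + P := by
  have hmod : ∀ P x, x < N → ((α + P * N + x) % N = α ↔ x = 0) := fun P x hx => by
    rw [show α + P * N + x = α + x + P * N by ring, Nat.add_mul_mod_self_right]
    constructor
    · intro h
      rcases Nat.lt_or_ge (α + x) N with h1 | h1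
      · rw [Nat.mod_eq_of_lt h1] at h; omega
      · rw [Nat.mod_eq_sub_mod h1, Nat.mod_eq_of_lt (by omega)] at h; omega
    · rintro rfl; exact Nat.mod_eq_of_lt hα
  induction P generalizing x with
  | zero =>
    induction x with
    | zero => simp
    | succ x ih =>
      have h1 := (hf (α + 0 * N + x)).kap
      rw [← add_assoc, h1, if_neg, ih (by omega)]
      rw [add_assoc, hm, hmod _ _ hx]
      omega
  | succ P ihP =>
    induction x with
    | zero =>
      have h1 := (hf (α + P * N + (N - 1))).kap
      have e : α + P * N + (N - 1) + 1 = α + (P + 1) * N + 0 := by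
        rw [add_mul]; omega
      rw [e] at h1
      rw [h1, if_pos, ihP (by omega)]
      · push_cast; ring
      · rw [hm, hmod _ _ hx]
    | succ x ih =>
      have h1 := (hf (α + (P + 1) * N + x)).kap
      rw [← add_assoc, h1, if_neg, ih (by omega)]
      rw [add_assoc, hm, hmod _ _ hx]
      omega

theorem dir_parity {f : ℕ → LineData} (hf : ∀ i, (f i).Next (f (i + 1))) {N α : ℕ}
    (hα : α < 2 * N) (hm : ∀ i, (f i).mark = true ↔ i % (2 * N) = α) (i : ℕ) :
    (f i).dir = false ↔ i % 2 = α % 2 := by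
  obtain ⟨a, ha, h⟩ := exists_parity (f := fun i => (f i).dir) fun i => (hf i).dir
  have h1 := (hf (α + 2 * N - 1)).mark
  rw [show α + 2 * N - 1 + 1 = α + 2 * N by omega, hm, h, Nat.add_mod_right,
    Nat.mod_eq_of_lt hα] at h1
  have h1 := h1 rfl
  rw [h]
  omega

/-- The marks of the next level. -/
theorem exists_mark_derived {f g : ℕ → LineData} (hf : ∀ i, (f i).Next (f (i + 1))) {M α a : ℕ}
    (hα : α < 2 * M) (hm : ∀ i, (f i).mark = true ↔ i % (2 * M) = α)
    (hd : ∀ i, (f i).dir = false ↔ i % 2 = a) (hu : ∀ i, (f (2 * i + a)).Up (g i)) :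
    ∃ α' k₀, α' < 4 * M ∧ (∀ i, (g i).mark = true ↔ i % (4 * M) = α') ∧
      2 * α' + a = α + k₀ * (2 * M) ∧ (f α).kap + (k₀ : ZMod 4) = 0 := by
  have ha : α % 2 = a := (hd α).1 ((dir_parity hf hα hm α).2 rfl)
  set k := ((-(f α).kap : ZMod 4)).val with hk
  have hk4 : k < 4 := ZMod.val_lt _
  have hkz : (f α).kap + (k : ZMod 4) = 0 := by
    rw [hk, ZMod.natCast_zmod_val, add_neg_cancel]
  obtain ⟨α', hα'⟩ : ∃ α', 2 * α' + a = α + k * (2 * M) := by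
    have : k * (2 * M) = 2 * (k * M) := by ring
    exact ⟨α / 2 + k * M, by omega⟩
  have hlt : k * (2 * M) ≤ 3 * (2 * M) := Nat.mul_le_mul_right _ (by omega)
  refine ⟨α', k, by omega, fun i => ?_, hα', hkz⟩
  have hkap : ∀ P : ℕ, (f (α + P * (2 * M))).kap = 0 ↔ P % 4 = k := fun P => by
    have h1 := kap_add hf hα hm P (x := 0) (by omega)
    rw [add_zero] at h1
    rw [h1, ← hkz, add_right_inj, ZMod.natCast_eq_natCast_iff', Nat.mod_eq_of_lt hk4]
  rw [(hu i).mark, hm]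
  constructor
  · rintro ⟨h1, h2⟩
    have e := Nat.div_add_mod' (2 * i + a) (2 * M)
    rw [h1, add_comm] at e
    rw [← e, hkap] at h2
    have e2 := Nat.div_add_mod' ((2 * i + a) / (2 * M)) 4
    rw [h2] at e2
    rw [← e2] at e
    have : i = α' + (2 * i + a) / (2 * M) / 4 * (4 * M) := by
      have : ((2 * i + a) / (2 * M) / 4 * 4 + k) * (2 * M) =
        k * (2 * M) + 2 * ((2 * i + a) / (2 * M) / 4 * (4 * M)) := by ring
      omega
    rw [this, Nat.add_mul_mod_self_right, Nat.mod_eq_of_lt (by omega)]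
  · intro h1
    have e := Nat.div_add_mod' i (4 * M)
    rw [h1] at e
    have e3 : 2 * i + a = α + (k + 4 * (i / (4 * M))) * (2 * M) := by
      have : (k + 4 * (i / (4 * M))) * (2 * M) = k * (2 * M) + 2 * (i / (4 * M) * (4 * M)) := by
        ring
      omega
    rw [e3, hkap, Nat.add_mul_mod_self_right, Nat.mod_eq_of_lt hα]
    exact ⟨rfl, by omega⟩

/-- The lattice of the lines of level at least `n` of a valid tiling. -/
structure Level (p : ℕ → Instr) (n : ℕ) (t : ℕ → ℕ → Tile) (a b α β : ℕ) : Prop where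
  lat : Lat t a b
  ok : ∀ i j, (t i j).Ok p
  hα : α < 2 * 2 ^ n
  hβ : β < 2 * 2 ^ n
  umark : ∀ i, (eqData t a b i 0).u.mark = true ↔ i % (2 * 2 ^ n) = α
  vmark : ∀ j, (eqData t a b 0 j).v.mark = true ↔ j % (2 * 2 ^ n) = β

namespace Level
variable {p : ℕ → Instr} {n : ℕ} {t : ℕ → ℕ → Tile} {a b α β : ℕ}

theorem eqData_ok (h : Level p n t a b α β) (i j : ℕ) :
    (eqData t a b i j).HRule (eqData t a b (i + 1) j) ∧
    (eqData t a b i j).VRule p (eqData t a b i (j + 1)) ∧ (eqData t a b i j).Ok p := by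
  have hA := h.lat.ha
  have hB := h.lat.hb
  refine ⟨?_, ?_, (h.ok _ _).cell (h.lat.row.eq _ _ (by omega) (by omega))⟩
  · have h1 := (h.ok (2 * (i + 1) + a) (2 * j + b)).h (h.lat.row.eq _ _ (by omega) (by omega))
    rwa [(h.lat.row.row_link hB i j).2] at h1
  · have h1 := (h.ok (2 * i + a) (2 * (j + 1) + b)).v (h.lat.row.eq _ _ (by omega) (by omega))
    have h2 := (h.lat.tr.row.row_link hA j i).2
    rw [h.lat.eqData_tr] at h2
    have h2 : (t (2 * i + a) (2 * (j + 1) + b)).S.l = eqData t a b i j :=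
      CellData.tr_injective h2
    rwa [h2] at h1

theorem u_next (h : Level p n t a b α β) (i : ℕ) :
    (eqData t a b i 0).u.Next (eqData t a b (i + 1) 0).u := (h.lat.row.next h.lat.hb i 0).1

theorem board (h : Level p n t a b α β) (P Q : ℕ) : Board p (2 * 2 ^ n)
    (fun x y => eqData t a b (α + P * (2 * 2 ^ n) + x) (β + Q * (2 * 2 ^ n) + y)) := by
  have hmod : ∀ {α P x}, α < 2 * 2 ^ n → x < 2 * 2 ^ n →
      ((α + P * (2 * 2 ^ n) + x) % (2 * 2 ^ n) = α ↔ x = 0) := fun {α P x} hα hx => by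
    rw [show α + P * (2 * 2 ^ n) + x = α + x + P * (2 * 2 ^ n) by ring,
      Nat.add_mul_mod_self_right]
    constructor
    · intro h
      rcases Nat.lt_or_ge (α + x) (2 * 2 ^ n) with h1 | h1
      · rw [Nat.mod_eq_of_lt h1] at h; omega
      · rw [Nat.mod_eq_sub_mod h1, Nat.mod_eq_of_lt (by omega)] at h; omega
    · rintro rfl; exact Nat.mod_eq_of_lt hα
  refine ⟨fun x hx y _ => ?_, fun x _ y hy => ?_, fun x _ y _ => ?_, fun x y => ?_, fun x y => ?_,
    fun x y => ?_, fun x y => ?_, fun x y => ?_⟩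
  · rw [h.lat.u_eq, h.umark, hmod h.hα hx]
  · rw [h.lat.v_eq, h.vmark, hmod h.hβ hy]
  · rw [h.lat.u_eq, dir_parity h.u_next h.hα h.umark]
    have : P * (2 * 2 ^ n) = 2 * (P * 2 ^ n) := by ring
    omega
  · exact (h.lat.u_eq _ _).trans (h.lat.u_eq _ _).symm
  · exact (h.lat.v_eq _ _).trans (h.lat.v_eq _ _).symm
  · exact (h.eqData_ok _ _).1
  · exact (h.eqData_ok _ _).2.1
  · exact (h.eqData_ok _ _).2.2

/-- The oracle read on the boards. -/
theorem z_eq (h : Level p n t a b α β) (P : ℕ) {x : ℕ} (hx : x < 2 * 2 ^ n) :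
    (eqData t a b (α + P * (2 * 2 ^ n) + x) 0).u.z = (eqData t a b (α + x) 0).u.z := by
  have h1 := (h.board P 0).z_eq hx
  have h2 := (h.board 0 0).z_eq hx
  rw [h.lat.u_eq, h.lat.v_eq] at h1 h2
  rw [h1, ← h2, zero_mul, add_zero]

theorem exists_succ (h : Level p n t a b α β) : ∃ a' b' α' β',
    Level p (n + 1) (derived t a b) a' b' α' β' ∧ ∀ y < 2 ^ n,
      (eqData (derived t a b) a' b' (α' + y) 0).u.z = (eqData t a b (α + y) 0).u.z := by
  obtain ⟨a', b', h', hc, hr⟩ := h.lat.exists_derived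
  have hup := h.lat.up h' hc
  obtain ⟨α', k₀, hα', hm, hαe, hk⟩ := exists_mark_derived h.u_next h.hα h.umark hc hup
  obtain ⟨β', -, hβ', hm', -, -⟩ := exists_mark_derived
    (f := fun j => (eqData t a b 0 j).v) (g := fun j => (eqData (derived t a b) a' b' 0 j).v)
    (fun j => h.lat.v_next 0 j) h.hβ h.vmark hr (fun j => by
      have := h.lat.tr.up (a' := b') (b' := a') h'.tr (fun i => by rw [h.lat.eqData_tr]; exact hr i) j
      rw [h.lat.eqData_tr] at this
      have e := h'.eqData_tr 0 j
      have e' : eqData (derived (fun i j => (t j i).tr) b a) b' a' j 0 =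
        (eqData (derived t a b) a' b' 0 j).tr := e
      rwa [e'] at this)
  have e4 : 2 * 2 ^ (n + 1) = 4 * 2 ^ n := by ring
  refine ⟨a', b', α', β', ⟨h', fun i j => h.ok _ _, e4 ▸ hα', e4 ▸ hβ', e4 ▸ hm, e4 ▸ hm'⟩,
    fun y hy => ?_⟩
  rw [← (hup (α' + y)).e]
  have e5 : 2 * (α' + y) + a' = α + k₀ * (2 * 2 ^ n) + 2 * y := by omega
  rw [e5]
  have h1 := (h.board k₀ 0).e_eq (x := y) (by omega) (by
    rw [h.lat.u_eq, kap_add h.u_next h.hα h.umark _ (by omega), hk])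
  have h2 := (h.board 0 0).z_eq (x := y) (by omega)
  rw [h.lat.u_eq, h.lat.v_eq] at h1 h2
  rw [h1, ← h2, zero_mul, add_zero]

end Level

/-- A valid tiling of the quadrant. -/
structure ValidTiling (p : ℕ → Instr) (t : ℕ → ℕ → Tile) : Prop where
  ok : ∀ i j, (t i j).Ok p
  hor : ∀ i j, (t i j).E = (t (i + 1) j).W
  ver : ∀ i j, (t i j).N = (t i (j + 1)).S

theorem ValidTiling.exists_level {p : ℕ → Instr} {t : ℕ → ℕ → Tile} (h : ValidTiling p t) :
    ∃ a b α β, Level p 0 t a b α β := by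
  have hs : StructTiling t := ⟨fun i j => (h.ok i j).struct, h.hor, h.ver⟩
  obtain ⟨a, b, hl, hb⟩ := hs.exists_lat
  have hA := hl.ha
  have hB := hl.hb
  obtain ⟨a', b', h', hc, hr⟩ := hl.exists_derived
  refine ⟨a, b, a', b', hl, h.ok, h'.ha, h'.hb, fun i => ?_, fun j => ?_⟩
  · have := (hs.ok (2 * i + a) (2 * 0 + b)).row.low (hl.row.eq _ _ (by omega) (by omega))
      (hb _ _ (by omega))
    rw [show 2 * 2 ^ 0 = 2 by rfl, ← hc, eqData, this]
    simp
  · have hrow := hb (2 * 0 + a) (2 * j + b) (by omega)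
    have heq := hl.row.eq (2 * 0 + a) (2 * j + b) (by omega) (by omega)
    have hcb : (t (2 * 0 + a) (2 * j + b)).S.base = true := by
      by_contra hcb
      rw [Bool.not_eq_true] at hcb
      have := (hs.ok _ _).row.ty hrow hcb
      rw [heq] at this
      exact absurd this (by simp)
    have := (hs.ok (2 * 0 + a) (2 * j + b)).col.low (by simpa [Tile.tr] using heq) hcb
    have hd := ((hs.ok (2 * 0 + a) (2 * j + b)).cell heq).2.1
    simp only [Tile.tr, Wire.tr, CellData.tr, hd] at this
    rw [show 2 * 2 ^ 0 = 2 by rfl, ← hr, eqData, this]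
    simp

/-- The successive levels of a valid tiling. -/
structure Levels (p : ℕ → Instr) (t : ℕ → ℕ → Tile) (T : ℕ → ℕ → ℕ → Tile) (a b α β : ℕ → ℕ) :
    Prop where
  zero : T 0 = t
  succ : ∀ n, T (n + 1) = derived (T n) (a n) (b n)
  level : ∀ n, Level p n (T n) (a n) (b n) (α n) (β n)
  z : ∀ n, ∀ y < 2 ^ n, (eqData (T (n + 1)) (a (n + 1)) (b (n + 1)) (α (n + 1) + y) 0).u.z =
    (eqData (T n) (a n) (b n) (α n + y) 0).u.z

theorem ValidTiling.exists_levels {p : ℕ → Instr} {t : ℕ → ℕ → Tile} (h : ValidTiling p t) :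
    ∃ T a b α β, Levels p t T a b α β := by
  obtain ⟨a₀, b₀, α₀, β₀, h₀⟩ := h.exists_level
  have step : ∀ (n : ℕ) (s : (ℕ → ℕ → Tile) × ℕ × ℕ × ℕ × ℕ), ∃ s' : (ℕ → ℕ → Tile) × ℕ × ℕ × ℕ × ℕ,
      Level p n s.1 s.2.1 s.2.2.1 s.2.2.2.1 s.2.2.2.2 →
      s'.1 = derived s.1 s.2.1 s.2.2.1 ∧
      Level p (n + 1) s'.1 s'.2.1 s'.2.2.1 s'.2.2.2.1 s'.2.2.2.2 ∧ ∀ y < 2 ^ n,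
        (eqData s'.1 s'.2.1 s'.2.2.1 (s'.2.2.2.1 + y) 0).u.z =
          (eqData s.1 s.2.1 s.2.2.1 (s.2.2.2.1 + y) 0).u.z := by
    intro n s
    by_cases hs : Level p n s.1 s.2.1 s.2.2.1 s.2.2.2.1 s.2.2.2.2
    · obtain ⟨a', b', α', β', h1, h2⟩ := hs.exists_succ
      exact ⟨(_, a', b', α', β'), fun _ => ⟨rfl, h1, h2⟩⟩
    · exact ⟨s, fun h => absurd h hs⟩
  choose f hf using step
  let s : ℕ → (ℕ → ℕ → Tile) × ℕ × ℕ × ℕ × ℕ := fun n =>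
    Nat.rec (t, a₀, b₀, α₀, β₀) (fun n s => f n s) n
  have hs : ∀ n, Level p n (s n).1 (s n).2.1 (s n).2.2.1 (s n).2.2.2.1 (s n).2.2.2.2 := by
    intro n
    induction n with
    | zero => exact h₀
    | succ n ih => exact (hf n _ ih).2.1
  exact ⟨fun n => (s n).1, fun n => (s n).2.1, fun n => (s n).2.2.1, fun n => (s n).2.2.2.1,
    fun n => (s n).2.2.2.2, rfl, fun n => (hf n _ (hs n)).1, hs, fun n => (hf n _ (hs n)).2.2⟩

namespace Levels
variable {p : ℕ → Instr} {t : ℕ → ℕ → Tile} {T : ℕ → ℕ → ℕ → Tile} {a b α β : ℕ → ℕ}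

theorem z_eq (h : Levels p t T a b α β) {n y : ℕ} (hy : y ≤ n) :
    (eqData (T n) (a n) (b n) (α n + y) 0).u.z = (eqData (T y) (a y) (b y) (α y + y) 0).u.z := by
  induction n, hy using Nat.le_induction with
  | base => rfl
  | succ n hn ih => rw [h.z n y (hn.trans_lt Nat.lt_two_pow_self), ih]

/-- The machine does not halt with the oracle read on the boards. -/
theorem not_halt (h : Levels p t T a b α β) (n : ℕ) :
    p (Instr.run (fun y => (eqData (T y) (a y) (b y) (α y + y) 0).u.z) p n).1 ≠ .halt := by
  have hn : n < 2 ^ n := Nat.lt_two_pow_self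
  refine ((h.level n).board 0 0).not_halt (n := n) (by omega) fun x hx => ?_
  rw [← h.z_eq hx, (h.level n).lat.u_eq, zero_mul, add_zero]

end Levels

/-! ### Reading the oracle off a tiling -/

theorem computable_dec_bounded (n : ℕ) (F : ℕ → Prop) :
    Computable fun v => dec (v < n ∧ F v) := by
  induction n with
  | zero => exact (C_const false).of_eq fun v => by simp
  | succ n ih =>
    have h : Computable fun v => dec ((v < n ∧ F v) ∨ (v = n ∧ F n)) := by fun_prop
    refine h.of_eq fun v => ?_
    rw [Bool.eq_iff_iff, dec_eq_true, dec_eq_true]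
    constructor
    · rintro (h | ⟨rfl, h⟩)
      · exact ⟨by omega, h.2⟩
      · exact ⟨by omega, h⟩
    · rintro ⟨h, h'⟩
      rcases Nat.lt_succ_iff_lt_or_eq.1 h with h | rfl
      · exact .inl ⟨h, h'⟩
      · exact .inr ⟨rfl, h'⟩

/-- The set of valid tilings of the quadrant by the tiles `tl v`, for `v < n`. -/
def tilingSet (p : ℕ → Instr) (n : ℕ) (tl : ℕ → Tile) : Set (ℕ → ℕ) :=
  {x | (∀ m, x m < n) ∧ ValidTiling p fun i j => tl (x (Nat.pair i j))}

/-- The absolute index of the `i`-th line in a derived lattice. -/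
def linePos (L : List ℕ) (i : ℕ) : ℕ := L.foldl (fun x a => 2 * x + 1 + a) i

@[fun_prop] theorem C_linePos {α : Type*} [Primcodable α] {f : α → List ℕ} {g : α → ℕ}
    (hf : Computable f) (hg : Computable g) : Computable fun a => linePos (f a) (g a) := by
  unfold linePos
  fun_prop

/-- The parities of the lattice are those read on a partial tiling. -/
def Parity (A : Ordering → ℕ → ℕ → Prop) (L M : List ℕ) (a b : ℕ) : Prop :=
  a < 2 ∧ b < 2 ∧ A .eq (linePos L a) (linePos M b) ∧ A .gt (linePos L (1 - a)) (linePos M b) ∧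
    A .lt (linePos L a) (linePos M (1 - b))

/-- The parities of successive lattices, latest first. -/
def ParityChain (A : Ordering → ℕ → ℕ → Prop) (L M : List ℕ) : Prop :=
  ∀ k < L.length, Parity A (L.drop (k + 1)) (M.drop (k + 1)) (L[k]?.getD 0) (M[k]?.getD 0)

theorem parityChain_cons {A : Ordering → ℕ → ℕ → Prop} {L M : List ℕ} {a b : ℕ} :
    ParityChain A (a :: L) (b :: M) ↔ Parity A L M a b ∧ ParityChain A L M := by
  constructor
  · intro h
    exact ⟨by simpa using h 0 (by simp), fun k hk => by simpa using h (k + 1) (by simpa using hk)⟩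
  · rintro ⟨h1, h2⟩ k hk
    cases k with
    | zero => simpa using h1
    | succ k => simpa using h2 k (by simpa using hk)

/-- The first terms of a sequence, latest first. -/
def revPref (a : ℕ → ℕ) : ℕ → List ℕ
  | 0 => []
  | n + 1 => a n :: revPref a n

theorem length_revPref (a : ℕ → ℕ) (n : ℕ) : (revPref a n).length = n := by
  induction n with
  | zero => rfl
  | succ n ih => simp [revPref, ih]

theorem linePos_revPref_succ (a : ℕ → ℕ) (n i : ℕ) :
    linePos (revPref a (n + 1)) i = linePos (revPref a n) (2 * i + 1 + a n) := rfl

namespace Levels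
variable {p : ℕ → Instr} {t : ℕ → ℕ → Tile} {T : ℕ → ℕ → ℕ → Tile} {a b α β : ℕ → ℕ}

theorem eq_linePos (h : Levels p t T a b α β) (n i j : ℕ) :
    T n i j = t (linePos (revPref a n) i) (linePos (revPref b n) j) := by
  induction n generalizing i j with
  | zero => rw [h.zero]; rfl
  | succ n ih => rw [h.succ, derived, ih, linePos_revPref_succ, linePos_revPref_succ]

theorem parity (h : Levels p t T a b α β) (n : ℕ) :
    Parity (fun o i j => (t i j).ty = o) (revPref a n) (revPref b n) (a n) (b n) := by
  have hA := (h.level n).lat.ha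
  have hB := (h.level n).lat.hb
  refine ⟨hA, hB, ?_, ?_, ?_⟩ <;> beta_reduce
  · rw [← h.eq_linePos]
    exact (h.level n).lat.row.eq _ _ (by omega) (by omega)
  · rw [← h.eq_linePos]
    exact (h.level n).lat.row.gt _ _ (by omega) (by omega)
  · rw [← h.eq_linePos]
    exact (h.level n).lat.lt (by omega) (by omega)

theorem parityChain (h : Levels p t T a b α β) (n : ℕ) :
    ParityChain (fun o i j => (t i j).ty = o) (revPref a n) (revPref b n) := by
  induction n with
  | zero => intro k hk; simp [revPref] at hk
  | succ n ih => exact parityChain_cons.2 ⟨h.parity n, ih⟩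

theorem eq_of_parity (h : Levels p t T a b α β) {n a' b' : ℕ}
    (h' : Parity (fun o i j => (t i j).ty = o) (revPref a n) (revPref b n) a' b') :
    a' = a n ∧ b' = b n := by
  have hA := (h.level n).lat.ha
  have hB := (h.level n).lat.hb
  obtain ⟨ha', hb', h1, h2, -⟩ := h'
  rw [← h.eq_linePos] at h1 h2
  by_cases ha : a' = a n
  · refine ⟨ha, ?_⟩
    by_contra hb
    rw [(h.level n).lat.lt (by omega) (by omega)] at h1
    exact absurd h1 (by simp)
  · by_cases hb : b' = b n
    · rw [(h.level n).lat.row.gt _ _ (by omega) (by omega)] at h1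
      exact absurd h1 (by simp)
    · rw [(h.level n).lat.lt (by omega) (by omega)] at h2
      exact absurd h2 (by simp)

theorem eq_of_parityChain (h : Levels p t T a b α β) {L M : List ℕ} (hl : L.length = M.length)
    (h' : ParityChain (fun o i j => (t i j).ty = o) L M) :
    L = revPref a L.length ∧ M = revPref b L.length := by
  induction L generalizing M with
  | nil => cases M with
    | nil => exact ⟨rfl, rfl⟩
    | cons => simp at hl
  | cons x L ih => cases M with
    | nil => simp at hl
    | cons y M =>
      obtain ⟨h1, h2⟩ := parityChain_cons.1 h'
      obtain ⟨h3, h4⟩ := ih (by simpa using hl) h2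
      rw [h3, h4] at h1
      obtain ⟨rfl, rfl⟩ := h.eq_of_parity h1
      simp only [List.length_cons, revPref]
      rw [← h3, ← h4]
      exact ⟨rfl, rfl⟩

end Levels

/-- The property `F` of the letter at `(i, j)`, read on a finite prefix. -/
def tileProp (n : ℕ) (F : ℕ → Prop) (l : List ℕ) (i j : ℕ) : Prop :=
  (l[Nat.pair i j]?.getD n) < n ∧ F (l[Nat.pair i j]?.getD n)

@[fun_prop] theorem C_tileProp {α : Type*} [Primcodable α] {n : ℕ} {F : ℕ → Prop}
    {l : α → List ℕ} {f g : α → ℕ} (hl : Computable l) (hf : Computable f) (hg : Computable g) :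
    Computable fun a => dec (tileProp n F (l a) (f a) (g a)) :=
  (computable_dec_bounded n F).comp
    (g := fun a => ((l a)[Nat.pair (f a) (g a)]?).getD n) (by fun_prop)

theorem tileProp_pref {n : ℕ} {F : ℕ → Prop} {x : ℕ → ℕ} (hx : ∀ m, x m < n) {k i j : ℕ} :
    tileProp n F (pref x k) i j ↔ Nat.pair i j < k ∧ F (x (Nat.pair i j)) := by
  by_cases h : Nat.pair i j < k
  · simp [tileProp, getElem?_pref h, hx, h]
  · have : (pref x k)[Nat.pair i j]? = none := by
      rw [List.getElem?_eq_none_iff, length_pref]; omega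
    simp [tileProp, this, h]

theorem Parity.mono {A B : Ordering → ℕ → ℕ → Prop} {L M : List ℕ} {a b : ℕ}
    (h : Parity A L M a b) (hAB : ∀ o i j, A o i j → B o i j) : Parity B L M a b :=
  ⟨h.1, h.2.1, hAB _ _ _ h.2.2.1, hAB _ _ _ h.2.2.2.1, hAB _ _ _ h.2.2.2.2⟩

theorem ParityChain.exists_bound {A : ℕ → Ordering → ℕ → ℕ → Prop} {B : Ordering → ℕ → ℕ → Prop}
    {L M : List ℕ} (h : ParityChain B L M)
    (hAB : ∀ o i j, B o i j → ∃ k, ∀ k' ≥ k, A k' o i j) :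
    ∃ k, ∀ k' ≥ k, ParityChain (A k') L M := by
  have h1 : ∀ m, ∃ k, ∀ k' ≥ k, m < L.length →
      Parity (A k') (L.drop (m + 1)) (M.drop (m + 1)) (L[m]?.getD 0) (M[m]?.getD 0) := by
    intro m
    by_cases hm : m < L.length
    · obtain ⟨h1, h2, h3, h4, h5⟩ := h m hm
      obtain ⟨k3, h3⟩ := hAB _ _ _ h3
      obtain ⟨k4, h4⟩ := hAB _ _ _ h4
      obtain ⟨k5, h5⟩ := hAB _ _ _ h5
      exact ⟨k3 + k4 + k5, fun k' hk' _ =>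
        ⟨h1, h2, h3 k' (by omega), h4 k' (by omega), h5 k' (by omega)⟩⟩
    · exact ⟨0, fun _ _ h => absurd h hm⟩
  choose f hf using h1
  refine ⟨∑ m ∈ Finset.range L.length, f m, fun k' hk' m hm => hf m k' (le_trans ?_ hk') hm⟩
  exact Finset.single_le_sum (f := f) (fun _ _ => Nat.zero_le _) (Finset.mem_range.2 hm)

@[fun_prop] theorem C_parity {α : Type*} [Primcodable α] {n : ℕ} {F : Ordering → ℕ → Prop}
    {l L M : α → List ℕ} {f g : α → ℕ} (hl : Computable l) (hL : Computable L)
    (hM : Computable M) (hf : Computable f) (hg : Computable g) :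
    Computable fun a => dec (Parity (fun o => tileProp n (F o) (l a)) (L a) (M a) (f a) (g a)) := by
  unfold Parity
  fun_prop

@[fun_prop] theorem C_parityChain {α : Type*} [Primcodable α] {n : ℕ} {F : Ordering → ℕ → Prop}
    {l L M : α → List ℕ} (hl : Computable l) (hL : Computable L) (hM : Computable M) :
    Computable fun a => dec (ParityChain (fun o => tileProp n (F o) (l a)) (L a) (M a)) := by
  unfold ParityChain
  fun_prop

/-- An oracle for which the machine does not halt is computable from any valid tiling. -/
theorem baireLE_tilingSet {Q : Set (ℕ → ℕ)} {p : ℕ → Instr}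
    (hp : ∀ z : ℕ → Bool, (∀ n, p (Instr.run z p n).1 ≠ .halt) ↔ (fun n => (z n).toNat) ∈ Q)
    (n : ℕ) (tl : ℕ → Tile) : BaireLE Q (tilingSet p n tl) := by
  let A : List ℕ → Ordering → ℕ → ℕ → Prop := fun l o => tileProp n (fun v => (tl v).ty = o) l
  let R : List ℕ → ℕ → ℕ → (ℕ × ℕ) × (List ℕ × List ℕ) × ℕ → Prop := fun l m v e =>
    e.2.1.1.length = m ∧ e.2.1.2.length = m ∧
    ParityChain (A l) (e.1.1 :: e.2.1.1) (e.1.2 :: e.2.1.2) ∧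
    tileProp n (fun v => (tl v).W.r.u.mark = true) l
      (linePos e.2.1.1 (2 * e.2.2 + e.1.1)) (linePos e.2.1.2 e.1.2) ∧
    ((v = 0 ∧ tileProp n (fun v => (tl v).W.r.u.z = false) l
      (linePos e.2.1.1 (2 * (e.2.2 + m) + e.1.1)) (linePos e.2.1.2 e.1.2)) ∨
    (v = 1 ∧ tileProp n (fun v => (tl v).W.r.u.z = true) l
      (linePos e.2.1.1 (2 * (e.2.2 + m) + e.1.1)) (linePos e.2.1.2 e.1.2)))
  refine BaireLE.of_semidec (R := fun l m v => ∃ e, R l m v e) ?_ ?_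
  · refine Semidec.intro (fun q e => R q.1 q.2.1 q.2.2 e) ?_ fun _ => Iff.rfl
    simp only [R, A]
    fun_prop
  · rintro x ⟨hx, ht⟩
    obtain ⟨T, a, b, α, β, h⟩ := ht.exists_levels
    refine ⟨_, (hp _).1 h.not_halt, fun m v => ?_⟩
    have hpos : ∀ i, tl (x (Nat.pair (linePos (revPref a m) (2 * i + a m))
        (linePos (revPref b m) (b m)))) = T m (2 * i + a m) (b m) := fun i =>
      (h.eq_linePos m (2 * i + a m) (b m)).symm
    have hz : ∀ i, (tl (x (Nat.pair (linePos (revPref a m) (2 * i + a m))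
        (linePos (revPref b m) (b m))))).W.r = eqData (T m) (a m) (b m) i 0 := fun i => by
      rw [hpos, eqData, mul_zero, zero_add]
    constructor
    · rintro ⟨k, ⟨⟨a', b'⟩, ⟨L, M⟩, i⟩, hL, hM, hc, hmk, hv⟩
      dsimp only at hL hM hc hmk hv
      have hc : ParityChain (fun o i j => (tl (x (Nat.pair i j))).ty = o) (a' :: L) (b' :: M) :=
        fun s hs => (hc s hs).mono fun o i j h' => ((tileProp_pref hx).1 h').2
      have h1 := h.eq_of_parityChain (by simp [hL, hM]) hc
      simp only [List.length_cons, hL, revPref, List.cons.injEq] at h1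
      obtain ⟨⟨rfl, rfl⟩, rfl, rfl⟩ := h1
      simp only [tileProp_pref hx, hz] at hmk hv
      have hmk := (h.level m).umark i |>.1 hmk.2
      have hi := Nat.div_add_mod' i (2 * 2 ^ m)
      have hz := (h.level m).z_eq (i / (2 * 2 ^ m)) (x := m)
        (by have : m < 2 ^ m := Nat.lt_two_pow_self
            omega)
      rw [hmk] at hi
      rw [← hi, add_comm _ (α m), hz] at hv
      rcases hv with ⟨rfl, -, hv⟩ | ⟨rfl, -, hv⟩ <;> simp [hv]
    · intro hv
      obtain ⟨k, hk⟩ := (h.parityChain (m + 1)).exists_bound (A := fun k => A (pref x k))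
        (fun o i j h' => ⟨Nat.pair i j + 1, fun k' hk' => (tileProp_pref hx).2 ⟨by omega, h'⟩⟩)
      let k' := k + Nat.pair (linePos (revPref a m) (2 * α m + a m)) (linePos (revPref b m) (b m)) +
        Nat.pair (linePos (revPref a m) (2 * (α m + m) + a m)) (linePos (revPref b m) (b m)) + 1
      refine ⟨k', ((a m, b m), (revPref a m, revPref b m), α m), length_revPref _ _,
        length_revPref _ _, hk _ (by omega), (tileProp_pref hx).2 ⟨by dsimp only; omega, ?_⟩, ?_⟩
      · dsimp only
        rw [hz, (h.level m).umark, Nat.mod_eq_of_lt (h.level m).hα]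
      · dsimp only
        simp only [tileProp_pref hx, hz]
        cases hb : (eqData (T m) (a m) (b m) (α m + m) 0).u.z with
        | false => exact .inl ⟨by simpa [hb] using hv.symm, by omega, rfl⟩
        | true => exact .inr ⟨by simpa [hb] using hv.symm, by omega, rfl⟩

/-! ### Existence of tilings -/

/-- The level of a line. -/
def lv (x : ℕ) : ℕ := padicValNat 2 x

theorem lv_eq (m a : ℕ) : lv (2 ^ m * (2 * a + 1)) = m := by
  rw [lv, padicValNat.mul (by positivity) (by omega), padicValNat.prime_pow,
    padicValNat.eq_zero_of_not_dvd (by omega), add_zero]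

theorem exists_lv {x : ℕ} (hx : x ≠ 0) : ∃ a, x = 2 ^ lv x * (2 * a + 1) := by
  obtain ⟨k, m, hm, rfl⟩ := Nat.exists_eq_two_pow_mul_odd hx
  obtain ⟨a, rfl⟩ := hm
  exact ⟨a, by rw [lv_eq]⟩

/-- A horizontal wire on a row of level `m`. -/
def hwire (D : ℕ → ℕ → ℕ → CellData) (m b x : ℕ) : Wire where
  l := D m ((x + 2 ^ m) / 2 ^ (m + 1) + 4 * 2 ^ (m + 1) - 1) b
  r := D m ((x + 2 ^ m) / 2 ^ (m + 1)) b
  c := (2 * x + 2 ^ (m + 1)) / 2 ^ m % 4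
  t := decide (x % 2 = 1)
  base := decide (m = 0)

/-- Exchanges rows and columns. -/
def swapData (D : ℕ → ℕ → ℕ → CellData) (m a b : ℕ) : CellData := (D m b a).tr

/-- The tile at a given position, for given data on the boards. -/
def genTile (D : ℕ → ℕ → ℕ → CellData) (x y : ℕ) : Tile where
  ty := compare (lv x) (lv y)
  W := hwire D (lv y) (y / 2 ^ (lv y + 1)) (x - 1)
  E := hwire D (lv y) (y / 2 ^ (lv y + 1)) x
  S := (hwire (swapData D) (lv x) (x / 2 ^ (lv x + 1)) (y - 1)).tr
  N := (hwire (swapData D) (lv x) (x / 2 ^ (lv x + 1)) y).tr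

theorem genTile_tr (D : ℕ → ℕ → ℕ → CellData) (x y : ℕ) :
    (genTile D x y).tr = genTile (swapData D) y x := by
  simp only [genTile, Tile.tr, Tile.mk.injEq]
  refine ⟨Nat.compare_swap _ _, ?_, ?_, ?_, ?_⟩ <;>
    simp [Wire.tr, CellData.tr, hwire, swapData]

/-- The data of the lines fit together. -/
structure LineOk (U : ℕ → ℕ → LineData) : Prop where
  dir : ∀ m a, (U m a).dir = decide (a % 2 = 1)
  mark : ∀ m a, (U m a).mark = decide (a % 2 ^ (m + 1) = 0)
  kap : ∀ m a, (U m a).kap = ((a / 2 ^ (m + 1) : ℕ) : ZMod 4)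
  e : ∀ m a, (U m (2 * a)).e = (U (m + 1) a).z
  per : ∀ m a, U m (a + 4 * 2 ^ (m + 1)) = U m a

/-- The data of the cells are those of their lines. -/
structure DataOk (U : ℕ → ℕ → LineData) (D : ℕ → ℕ → ℕ → CellData) : Prop where
  u : ∀ m a b, (D m a b).u = U m a
  v : ∀ m a b, (D m a b).v = U m b
  per : ∀ m a b, D m (a + 4 * 2 ^ (m + 1)) b = D m a b
  per' : ∀ m a b, D m a (b + 4 * 2 ^ (m + 1)) = D m a b

theorem DataOk.swap {U : ℕ → ℕ → LineData} {D : ℕ → ℕ → ℕ → CellData} (h : DataOk U D) :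
    DataOk U (swapData D) :=
  ⟨fun m a b => h.v m b a, fun m a b => h.u m b a, fun m a b => by simp [swapData, h.per'],
    fun m a b => by simp [swapData, h.per]⟩

theorem sub_one_div {x m k : ℕ} (h : x = 2 ^ m * (2 * k + 1)) :
    (x - 1 + 2 ^ m) / 2 ^ (m + 1) = k ∧ (x + 2 ^ m) / 2 ^ (m + 1) = k + 1 ∧
      x / 2 ^ (m + 1) = k := by
  have h2 : 0 < 2 ^ m := by positivity
  have hx : x = 2 ^ m * 2 * k + 2 ^ m := by rw [h]; ring
  rw [pow_succ]
  set M := 2 ^ m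
  refine ⟨?_, ?_, ?_⟩
  · rw [Nat.div_eq_of_lt_le]
    · rw [hx, mul_comm]; omega
    · rw [hx, add_mul, mul_comm k]; omega
  · rw [Nat.div_eq_of_lt_le]
    · rw [hx, add_mul, mul_comm k]; omega
    · rw [hx, add_mul, add_mul, mul_comm k]; omega
  · rw [Nat.div_eq_of_lt_le]
    · rw [hx, mul_comm]; omega
    · rw [hx, add_mul, mul_comm k]; omega

theorem sub_one_div_of_dvd {x m k : ℕ} (h : x = 2 ^ (m + 1) * k) (hx : x ≠ 0) :
    (x - 1 + 2 ^ m) / 2 ^ (m + 1) = k := by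
  have h2 : 0 < 2 ^ m := by positivity
  rw [pow_succ] at *
  set M := 2 ^ m
  rw [Nat.div_eq_of_lt_le]
  · rw [mul_comm]; omega
  · rw [add_mul, mul_comm k]; omega

/-- A wire changes its data only at the crossings of equal levels. -/
theorem div_eq_of_lv_ne {x m : ℕ} (hx : x ≠ 0) (h : lv x ≠ m) :
    (x + 2 ^ m) / 2 ^ (m + 1) = (x - 1 + 2 ^ m) / 2 ^ (m + 1) := by
  obtain ⟨x, rfl⟩ := Nat.exists_eq_succ_of_ne_zero hx
  rw [Nat.succ_eq_add_one, add_tsub_cancel_right, show x + 1 + 2 ^ m = x + 2 ^ m + 1 by ring,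
    Nat.succ_div, if_neg, add_zero]
  rintro ⟨k, hk⟩
  obtain _ | k := k
  · have : 0 < 2 ^ m := by positivity
    omega
  · apply h
    have : x + 1 = 2 ^ m * (2 * k + 1) := by
      have : x + 1 + 2 ^ m = 2 ^ m * (2 * k + 1) + 2 ^ m := by
        rw [show x + 1 + 2 ^ m = x + 2 ^ m + 1 by ring, hk]; ring
      omega
    rw [Nat.succ_eq_add_one, this, lv_eq]

theorem next_of_lineOk {U : ℕ → ℕ → LineData} (h : LineOk U) (m a : ℕ) :
    (U m (a + 4 * 2 ^ (m + 1) - 1)).Next (U m a) := by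
  have h2 : 0 < 2 ^ m := by positivity
  have e : a + 4 * 2 ^ (m + 1) = (a + 4 * 2 ^ (m + 1) - 1) + 1 := by rw [pow_succ]; omega
  rw [← h.per m a, e, add_tsub_cancel_right]
  set b := a + 4 * 2 ^ (m + 1) - 1
  refine ⟨?_, ?_, ?_⟩
  · rw [h.dir, h.dir, ← decide_not, decide_eq_decide]
    omega
  · rw [h.mark, h.dir]
    intro h3
    have h3 : (b + 1) % 2 ^ (m + 1) = 0 := by simpa using h3
    have h3 := (Dvd.intro _ (pow_succ' 2 m).symm).trans (Nat.dvd_of_mod_eq_zero h3)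
    simp only [decide_eq_false_iff_not]
    omega
  · rw [h.kap, h.kap, h.mark, Nat.succ_div]
    by_cases h3 : 2 ^ (m + 1) ∣ b + 1
    · simp [h3, Nat.mod_eq_zero_of_dvd h3]
    · simp [h3, ← Nat.dvd_iff_mod_eq_zero]

theorem up_of_lineOk {U : ℕ → ℕ → LineData} (h : LineOk U) (m a : ℕ) :
    (U m (2 * a)).Up (U (m + 1) a) := by
  refine ⟨?_, h.e m a⟩
  rw [h.mark, h.mark, h.kap, decide_eq_true_iff, decide_eq_true_iff, ZMod.natCast_eq_zero_iff]
  rw [← Nat.dvd_iff_mod_eq_zero, ← Nat.dvd_iff_mod_eq_zero]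
  have h2 : 0 < 2 ^ m := by positivity
  constructor
  · rintro ⟨k, rfl⟩
    have e : 2 * (2 ^ (m + 1 + 1) * k) = 2 ^ (m + 1) * (4 * k) := by ring
    rw [e, Nat.mul_div_cancel_left _ (by positivity)]
    exact ⟨Dvd.intro _ rfl, Dvd.intro _ rfl⟩
  · rintro ⟨⟨k, hk⟩, h4⟩
    rw [hk, Nat.mul_div_cancel_left _ (by positivity)] at h4
    obtain ⟨k, rfl⟩ := h4
    refine ⟨k, ?_⟩
    have : 2 * a = 2 * (2 ^ (m + 1 + 1) * k) := by rw [hk]; ring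
    omega

theorem classRule_genTile {D : ℕ → ℕ → ℕ → CellData} {U : ℕ → ℕ → LineData} (hU : LineOk U)
    (hD : DataOk U D) {x y : ℕ} (hx : x ≠ 0) (hy : y ≠ 0) (h0 : lv y ≠ 0) :
    classRule (compare (lv x) (lv y)) ((2 * (x - 1) + 2 ^ (lv y + 1)) / 2 ^ lv y % 4)
      ((2 * x + 2 ^ (lv y + 1)) / 2 ^ lv y % 4) (genTile D x y).S.r.v.dir := by
  obtain ⟨a, ha⟩ := exists_lv hx
  obtain ⟨b, hb⟩ := exists_lv hy
  generalize hm : lv y = m at *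
  generalize hn : lv x = n at *
  obtain ⟨m, rfl⟩ := Nat.exists_eq_succ_of_ne_zero h0
  have h2 : 0 < 2 ^ m := by positivity
  have hdir : n < m + 1 → (genTile D x y).S.r.v.dir = decide (n = m) := by
    intro hlt
    obtain ⟨j, rfl⟩ := Nat.exists_eq_add_of_le (Nat.le_of_lt_succ hlt)
    have e : y = 2 ^ (n + 1) * (2 ^ j * (2 * b + 1)) := by rw [hb, Nat.succ_eq_add_one]; ring
    simp only [genTile, hwire, swapData, Wire.tr, CellData.tr, hn]
    rw [sub_one_div_of_dvd e hy, hD.v, hU.dir]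
    simp only [Nat.left_eq_add, decide_eq_decide]
    rcases j with _ | j
    · simp
    · simp [pow_succ, Nat.mul_mod]
  rw [Nat.succ_eq_add_one]
  have hpow : 2 ^ (m + 1 + 1) = 4 * 2 ^ m := by ring
  have hpow' : 2 ^ (m + 1) = 2 * 2 ^ m := by ring
  have dv : ∀ k j, j < 2 * 2 ^ m → (2 * 2 ^ m * k + j) / (2 * 2 ^ m) = k := fun k j hj => by
    rw [Nat.mul_add_div (by omega), Nat.div_eq_of_lt hj, add_zero]
  rcases lt_trichotomy n (m + 1) with hlt | rfl | hgt
  · rw [Nat.compare_eq_lt.2 hlt, classRule, hdir hlt]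
    split_ifs with hnm
    · have hnm : n = m := by simpa using hnm
      subst hnm
      have e1 : 2 * (x - 1) + 2 ^ (n + 1 + 1) = 2 * 2 ^ n * (2 * (a + 1)) + (2 * 2 ^ n - 2) := by
        have : x = 2 * (2 ^ n * a) + 2 ^ n := by rw [ha]; ring
        rw [hpow, this, show 2 * 2 ^ n * (2 * (a + 1)) = 4 * (2 ^ n * a) + 4 * 2 ^ n by ring]
        omega
      have e2 : 2 * x + 2 ^ (n + 1 + 1) = 2 * 2 ^ n * (2 * (a + 1) + 1) + 0 := by
        rw [hpow, ha]; ring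
      rw [e1, e2, hpow', dv _ _ (by omega), dv _ _ (by omega)]
      omega
    · have hnm : n ≠ m := by simpa using hnm
      congr 1
      have hx2 : 2 * x + 2 ^ (m + 1 + 1) = (2 * (x - 1) + 2 ^ (m + 1 + 1)) + 1 + 1 := by omega
      rw [hx2, Nat.succ_div, Nat.succ_div, if_neg, if_neg]
      · rfl
      · rw [← hx2]
        intro hd
        rw [Nat.dvd_add_left (Dvd.intro _ (pow_succ 2 (m + 1)).symm), pow_succ',
          Nat.mul_dvd_mul_iff_left (by omega), ha] at hd
        have : n < m := by omega
        obtain ⟨j, rfl⟩ := Nat.exists_eq_add_of_lt this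
        rw [show n + j + 1 = n + (j + 1) by ring, pow_add, pow_succ',
          Nat.mul_dvd_mul_iff_left (by positivity)] at hd
        have := (Dvd.intro _ rfl).trans hd
        omega
      · rintro ⟨k, hk⟩
        rw [hpow', hpow, mul_assoc] at hk
        omega
  · rw [Nat.compare_eq_eq.2 rfl]
    have e1 : 2 * (x - 1) + 2 ^ (m + 1 + 1) = 2 * 2 ^ m * (4 * a + 3) + (2 * 2 ^ m - 2) := by
      have : x = 4 * (2 ^ m * a) + 2 * 2 ^ m := by rw [ha]; ring
      rw [hpow, this, show 2 * 2 ^ m * (4 * a + 3) = 8 * (2 ^ m * a) + 6 * 2 ^ m by ring]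
      omega
    have e2 : 2 * x + 2 ^ (m + 1 + 1) = 2 * 2 ^ m * (4 * (a + 1)) + 0 := by
      rw [hpow, ha]; ring
    rw [e1, e2, hpow', dv _ _ (by omega), dv _ _ (by omega)]
    simp only [classRule]
    omega
  · rw [Nat.compare_eq_gt.2 hgt]
    obtain ⟨j, rfl⟩ := Nat.exists_eq_add_of_lt hgt
    have hX : x = 4 * (2 ^ m * (2 ^ j * (2 * a + 1))) := by rw [ha]; ring
    generalize 2 ^ j * (2 * a + 1) = X at hX
    have hX0 : 0 < X := by
      rcases X with _ | X
      · simp at hX; omega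
      · omega
    have hX1 : 0 < 2 ^ m * X := by positivity
    have e1 : 2 * (x - 1) + 2 ^ (m + 1 + 1) = 2 * 2 ^ m * (4 * X + 1) + (2 * 2 ^ m - 2) := by
      rw [hpow, hX, show 2 * 2 ^ m * (4 * X + 1) = 8 * (2 ^ m * X) + 2 * 2 ^ m by ring]
      omega
    have e2 : 2 * x + 2 ^ (m + 1 + 1) = 2 * 2 ^ m * (4 * X + 2) + 0 := by
      rw [hpow, hX]; ring
    rw [e1, e2, hpow', dv _ _ (by omega), dv _ _ (by omega)]
    simp only [classRule]
    omega

theorem mod_two_eq_one_iff {x : ℕ} (hx : x ≠ 0) : x % 2 = 1 ↔ lv x = 0 := by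
  constructor
  · intro h
    exact padicValNat.eq_zero_of_not_dvd (by omega)
  · intro h
    obtain ⟨a, ha⟩ := exists_lv hx
    rw [h] at ha
    omega

theorem rowOk_genTile {D : ℕ → ℕ → ℕ → CellData} {U : ℕ → ℕ → LineData} (hU : LineOk U)
    (hlow : ∀ a, (U 0 a).mark = !(U 0 a).dir)
    (hD : DataOk U D) {x y : ℕ} (hx : x ≠ 0) (hy : y ≠ 0) : (genTile D x y).RowOk where
  base := rfl
  tag := by
    simp only [genTile, hwire, ← decide_not, decide_eq_decide]
    omega
  cross := by
    simp only [genTile, hwire, Wire.tr, decide_eq_decide]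
    exact (mod_two_eq_one_iff hx).symm
  same h := by
    have h : lv x ≠ lv y := by simpa [genTile] using h
    simp [genTile, hwire, div_eq_of_lv_ne hx h]
  cls h := classRule_genTile hU hD hx hy (by simpa [genTile, hwire] using h)
  ty h h' := by
    simp only [genTile, hwire, Wire.tr, decide_eq_true_eq, decide_eq_false_iff_not] at *
    rw [h, Nat.compare_eq_gt]
    omega
  next h := by
    simp only [genTile, hwire, hD.u, hD.v, and_true]
    exact next_of_lineOk hU _ _
  low h h' := by
    have h' : lv y = 0 := by simpa [genTile, hwire] using h'
    simp only [genTile, hwire, h', hD.u]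
    exact hlow _
  up h h' := by
    obtain ⟨a, ha⟩ := exists_lv hx
    have h : lv y < lv x := Nat.compare_eq_gt.1 h
    obtain ⟨j, hj⟩ := Nat.exists_eq_add_of_lt h
    have e : x = 2 ^ (lv y + 1) * (2 ^ j * (2 * a + 1)) := by
      conv_lhs => rw [ha, hj]
      ring
    simp only [genTile, hwire, swapData, Wire.tr, CellData.tr, hD.u] at h' ⊢
    rw [sub_one_div_of_dvd e hx] at h' ⊢
    have hpos : 0 < 2 ^ lv y := by positivity
    rw [hU.dir] at h'
    have h' : ¬ (2 ^ j * (2 * a + 1) + 4 * 2 ^ (lv y + 1) - 1) % 2 = 1 := by simpa using h'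
    rcases j with _ | j
    · rw [show 2 ^ 0 * (2 * a + 1) + 4 * 2 ^ (lv y + 1) - 1 = 2 * a + 4 * 2 ^ (lv y + 1) by omega,
        hU.per]
      rw [(sub_one_div ha).2.2, hj]
      exact up_of_lineOk hU _ _
    · exfalso
      rw [pow_succ', pow_succ', mul_assoc] at h'
      have : 0 < 2 ^ j * (2 * a + 1) := by positivity
      omega

theorem struct_genTile {D : ℕ → ℕ → ℕ → CellData} {U : ℕ → ℕ → LineData} (hU : LineOk U)
    (hlow : ∀ a, (U 0 a).mark = !(U 0 a).dir)
    (hD : DataOk U D) {x y : ℕ} (hx : x ≠ 0) (hy : y ≠ 0) : (genTile D x y).Struct where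
  row := rowOk_genTile hU hlow hD hx hy
  col := by rw [genTile_tr]; exact rowOk_genTile hU hlow hD.swap hy hx
  ty h h' := by
    simp only [genTile, hwire, Wire.tr, decide_eq_true_eq] at *
    rw [h, h', Nat.compare_eq_eq]
  cell h := by
    have h : lv x = lv y := by simpa [genTile] using h
    obtain ⟨a, ha⟩ := exists_lv hx
    obtain ⟨b, hb⟩ := exists_lv hy
    rw [← h] at hb
    have hp : 0 < 2 ^ lv x := by positivity
    have e : ∀ a, a + 1 + 4 * 2 ^ (lv x + 1) - 1 = a + 4 * 2 ^ (lv x + 1) := fun a => by omega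
    simp only [genTile, hwire, swapData, Wire.tr, CellData.tr, ← h, sub_one_div ha,
      sub_one_div hb, e, hD.per, hD.per', and_self]

/-- The flag of the row of a machine configuration. -/
noncomputable def Instr.flag (q : ℕ → Bool) (R : ℕ → ℕ) : Instr → Bool
  | jeq a b _ => dec (R a = R b)
  | jz b _ => !q (R b)
  | _ => false

/-- The data of a line of level `m` and index `a`. -/
noncomputable def lineData (q : ℕ → Bool) (p : List Instr) (m a : ℕ) : LineData where
  dir := decide (a % 2 = 1)
  mark := decide (a % 2 ^ (m + 1) = 0)
  kap := ((a / 2 ^ (m + 1) : ℕ) : ZMod 4)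
  z := q (a % 2 ^ (m + 1))
  e := q ((a / 2) % (2 * 2 ^ (m + 1)))
  pc := min (Instr.run q (Instr.prog p) (a % 2 ^ (m + 1))).1 p.length
  flag := (Instr.prog p (Instr.run q (Instr.prog p) (a % 2 ^ (m + 1))).1).flag q
    (Instr.run q (Instr.prog p) (a % 2 ^ (m + 1))).2

/-- The data of a cell of level `m`. -/
noncomputable def cellData (q : ℕ → Bool) (p : List Instr) (m a b : ℕ) : CellData where
  u := lineData q p m a
  v := lineData q p m b
  d1 := compare (a % 2 ^ (m + 1)) (b % 2 ^ (m + 1))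
  d2 := compare (a % 2 ^ (m + 1) / 2) (b % 2 ^ (m + 1))
  rho r := compare (a % 2 ^ (m + 1)) ((Instr.run q (Instr.prog p) (b % 2 ^ (m + 1))).2 r)

theorem lineOk_lineData (q : ℕ → Bool) (p : List Instr) : LineOk (lineData q p) where
  dir _ _ := rfl
  mark _ _ := rfl
  kap _ _ := rfl
  e m a := by
    simp only [lineData]
    rw [Nat.mul_div_cancel_left _ (by omega), ← pow_succ']
  per m a := by
    have h2 : 0 < 2 ^ (m + 1) := by positivity
    have e1 : (a + 4 * 2 ^ (m + 1)) % 2 = a % 2 := by omega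
    have e2 : (a + 4 * 2 ^ (m + 1)) % 2 ^ (m + 1) = a % 2 ^ (m + 1) := by simp
    have e3 : (a + 4 * 2 ^ (m + 1)) / 2 ^ (m + 1) = a / 2 ^ (m + 1) + 4 := by
      rw [Nat.add_mul_div_right _ _ h2]
    have e4 : (a + 4 * 2 ^ (m + 1)) / 2 % (2 * 2 ^ (m + 1)) = a / 2 % (2 * 2 ^ (m + 1)) := by
      rw [show a + 4 * 2 ^ (m + 1) = a + 2 * (2 * 2 ^ (m + 1)) by ring,
        Nat.add_mul_div_left _ _ (by omega), Nat.add_mod_right]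
    simp only [lineData, e1, e2, e3, e4, Nat.cast_add]
    congr 1
    rw [show ((4 : ℕ) : ZMod 4) = 0 from rfl, add_zero]

theorem dataOk_cellData (q : ℕ → Bool) (p : List Instr) :
    DataOk (lineData q p) (cellData q p) where
  u _ _ _ := rfl
  v _ _ _ := rfl
  per m a b := by
    simp only [cellData, (lineOk_lineData q p).per, Nat.add_mul_mod_self_right]
  per' m a b := by
    simp only [cellData, (lineOk_lineData q p).per, Nat.add_mul_mod_self_right]

section
variable {q : ℕ → Bool} {p : List Instr}

theorem prog_min {i : ℕ} (h : Instr.prog p i ≠ .halt) : min i p.length = i := by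
  rw [min_eq_left_iff]
  by_contra! h'
  apply h
  rw [Instr.prog, List.getElem?_eq_none (by omega)]
  rfl

theorem regRule_step {c d : CellData} {P : ℕ → Instr} {s : ℕ} {M : ℕ × (ℕ → ℕ)}
    (hc : ∀ r, c.rho r = compare s (M.2 r))
    (hd : ∀ r, d.rho r = compare s ((Instr.step q P M).2 r)) (hu : d.u.mark = decide (s = 0)) :
    (P M.1).regRule c d := by
  rw [Instr.step] at hd
  cases h : P M.1 with
  | set i j =>
    intro r
    simp only [h, Function.update_apply] at hd
    rw [hd, hc, hc]
    split_ifs <;> rfl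
  | clr i =>
    intro r
    simp only [h, Function.update_apply] at hd
    rw [hd, hc, hu]
    simp only [decide_eq_true_eq]
    split_ifs with h1 h2
    · rw [h2]; exact Nat.compare_eq_eq.2 rfl
    · exact Nat.compare_eq_gt.2 (by omega)
    · rfl
  | inc i =>
    simp only [h] at hd
    refine ⟨?_, fun r hr => ?_⟩
    · rw [hd, hc, Function.update_self]
      exact vstep_compare _ _
    · rw [hd, hc, Function.update_of_ne hr]
  | _ =>
    simp only [h] at hd
    exact funext fun r => by rw [hd, hc]

theorem fst_step {v : LineData} {P : ℕ → Instr} {M : ℕ × (ℕ → ℕ)} (h₁ : v.pc = M.1)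
    (h₂ : v.flag = (P M.1).flag q M.2) (h₃ : P M.1 ≠ .halt) :
    (Instr.step q P M).1 = (P M.1).nextPc v := by
  rw [Instr.step]
  cases h : P M.1 with
  | halt => exact absurd h h₃
  | _ => simp [Instr.nextPc, h₁, h₂, h, Instr.flag]

theorem mod_of_not_mark {m a : ℕ} (h : (lineData q p m a).mark = false) :
    a % 2 ^ (m + 1) = (a + 4 * 2 ^ (m + 1) - 1) % 2 ^ (m + 1) + 1 := by
  have h : a % 2 ^ (m + 1) ≠ 0 := by simpa [lineData] using h
  have h2 : 0 < 2 ^ (m + 1) := by positivity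
  have h3 := Nat.mod_lt a h2
  generalize 2 ^ (m + 1) = N at *
  have h4 : a + 4 * N - 1 = (a % N - 1) + N * (a / N + 4) := by
    have := Nat.mod_add_div a N
    rw [mul_add]
    omega
  rw [h4, Nat.add_mul_mod_self_left, Nat.mod_eq_of_lt (show a % N - 1 < N by omega)]
  omega

theorem hRule_cellData (m a b : ℕ) :
    (cellData q p m (a + 4 * 2 ^ (m + 1) - 1) b).HRule (cellData q p m a b) := by
  refine ⟨fun h => ?_, fun h r => ?_, fun h => ?_⟩ <;> have e := mod_of_not_mark h <;>
    simp only [cellData]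
  · rw [e]
    exact hstep_compare _ _
  · rw [e]
    exact hstep_compare _ _
  · have hm : ((a + 4 * 2 ^ (m + 1) - 1) % 2 ^ (m + 1)) % 2 = (a + 4 * 2 ^ (m + 1) - 1) % 2 :=
      Nat.mod_mod_of_dvd _ (Dvd.intro _ (pow_succ' 2 m).symm)
    simp only [lineData, decide_eq_false_iff_not, ← hm]
    rw [e]
    set c := (a + 4 * 2 ^ (m + 1) - 1) % 2 ^ (m + 1)
    split_ifs with h'
    · rw [show (c + 1) / 2 = c / 2 + 1 by clear_value c; omega]
      exact hstep_compare _ _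
    · rw [show (c + 1) / 2 = c / 2 by clear_value c; omega]

theorem vRule_cellData (hq : ∀ n, Instr.prog p (Instr.run q (Instr.prog p) n).1 ≠ .halt)
    (m a b : ℕ) : (cellData q p m a (b + 4 * 2 ^ (m + 1) - 1)).VRule (Instr.prog p)
      (cellData q p m a b) := by
  refine ⟨fun h => ?_, fun h => ?_, fun h => ?_, fun h => ?_⟩ <;> have e := mod_of_not_mark h
  · simp only [cellData]
    rw [e]
    exact vstep_compare _ _
  · simp only [cellData]
    rw [e]
    exact vstep_compare _ _
  · have e' : (cellData q p m a (b + 4 * 2 ^ (m + 1) - 1)).v.pc = _ := prog_min (hq _)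
    rw [e']
    refine regRule_step (q := q) (fun r => rfl) (fun r => ?_) rfl
    rw [← Instr.run_succ, ← e]
    rfl
  · have e' : (cellData q p m a (b + 4 * 2 ^ (m + 1) - 1)).v.pc = _ := prog_min (hq _)
    have e'' : (cellData q p m a b).v.pc = _ := prog_min (hq _)
    rw [e'', e', e, Instr.run_succ]
    exact fst_step e' rfl (hq _)

theorem ok_cellData (hq : ∀ n, Instr.prog p (Instr.run q (Instr.prog p) n).1 ≠ .halt)
    (m a b : ℕ) : (cellData q p m a b).Ok (Instr.prog p) := by
  have h2 : 0 < 2 ^ (m + 1) := by positivity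
  refine ⟨fun h h' => ?_, fun h => ?_, fun h => ?_, fun h h' => ?_, ?_⟩
  · simp only [cellData, lineData, decide_eq_true_eq] at *
    simp [h, h', Instr.run]
  · simp only [cellData, lineData, decide_eq_true_eq] at *
    simp [h, Instr.run]
  · have h := Nat.compare_eq_eq.1 h
    simp [cellData, lineData, h]
  · have h := Nat.compare_eq_eq.1 h
    simp only [cellData, lineData, ← h] at *
    rw [ZMod.natCast_eq_zero_iff] at h'
    obtain ⟨k, hk⟩ := h'
    have := Nat.mod_add_div a (2 ^ (m + 1))
    have hlt := Nat.mod_lt a h2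
    have e : a = a % 2 ^ (m + 1) + 2 * (2 * 2 ^ (m + 1) * k) := by
      conv_lhs => rw [← this, hk]
      ring
    conv_lhs => rw [e]
    rw [Nat.add_mul_div_left _ _ (by omega), Nat.add_mul_mod_self_left, Nat.mod_eq_of_lt (by omega)]
  · have e := prog_min (hq (b % 2 ^ (m + 1)))
    simp only [cellData, lineData, e]
    have h := hq (b % 2 ^ (m + 1))
    set c := Instr.run q (Instr.prog p) (b % 2 ^ (m + 1))
    cases h' : Instr.prog p c.1 with
    | halt => exact absurd h' h
    | jeq i j l =>
      intro hi
      have hi := Nat.compare_eq_eq.1 hi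
      simp [Instr.flag, hi]
    | jz i l =>
      intro hi
      have hi := Nat.compare_eq_eq.1 hi
      simp [Instr.flag, hi]
    | _ => trivial

/-- The tile at position `(x, y)` with `0 < x` and `0 < y`. -/
noncomputable def posTile (q : ℕ → Bool) (p : List Instr) (x y : ℕ) : Tile :=
  genTile (cellData q p) x y

theorem ok_posTile (hq : ∀ n, Instr.prog p (Instr.run q (Instr.prog p) n).1 ≠ .halt)
    {x y : ℕ} (hx : x ≠ 0) (hy : y ≠ 0) : (posTile q p x y).Ok (Instr.prog p) := by
  have hlow : ∀ a, (lineData q p 0 a).mark = !(lineData q p 0 a).dir := fun a => by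
    simp only [lineData, ← decide_not, decide_eq_decide]
    omega
  have key : (posTile q p x y).ty = .eq → ∃ m a b,
      (posTile q p x y).W.r = cellData q p m a b ∧
      (posTile q p x y).W.l = cellData q p m (a + 4 * 2 ^ (m + 1) - 1) b ∧
      (posTile q p x y).S.l = cellData q p m a (b + 4 * 2 ^ (m + 1) - 1) := by
    intro h
    have h : lv x = lv y := Nat.compare_eq_eq.1 h
    obtain ⟨a, ha⟩ := exists_lv hx
    obtain ⟨b, hb⟩ := exists_lv hy
    rw [← h] at hb
    refine ⟨lv x, a, b, ?_⟩
    simp only [posTile, genTile, hwire, swapData, Wire.tr, CellData.tr, ← h, sub_one_div ha,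
      sub_one_div hb, and_self]
  refine ⟨struct_genTile (lineOk_lineData q p) hlow (dataOk_cellData q p) hx hy,
    fun h => ?_, fun h => ?_, fun h => ?_⟩ <;> obtain ⟨m, a, b, hr, hl, hs⟩ := key h
  · rw [hr, hl]
    exact hRule_cellData m a b
  · rw [hr, hs]
    exact vRule_cellData hq m a b
  · rw [hr]
    exact ok_cellData hq m a b

theorem posTile_hor (x y : ℕ) : (posTile q p x y).E = (posTile q p (x + 1) y).W := rfl

theorem posTile_ver (x y : ℕ) : (posTile q p x y).N = (posTile q p x (y + 1)).S := rfl

theorem lv_add {x s : ℕ} (hx : x ≠ 0) (h : lv x < s) : lv (x + 2 ^ s) = lv x := by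
  obtain ⟨a, ha⟩ := exists_lv hx
  obtain ⟨j, rfl⟩ := Nat.exists_eq_add_of_lt h
  have : x + 2 ^ (lv x + j + 1) = 2 ^ lv x * (2 * (a + 2 ^ j) + 1) := by
    conv_lhs => rw [ha, lv_eq]
    ring
  rw [this, lv_eq]

theorem hwire_add {U : ℕ → ℕ → LineData} {D : ℕ → ℕ → ℕ → CellData} (hD : DataOk U D)
    {m b x s : ℕ} (h : 2 * m + 4 ≤ s) :
    hwire D m (b + 2 ^ (s - (m + 1))) (x + 2 ^ s) = hwire D m b x := by
  obtain ⟨j, rfl⟩ := Nat.exists_eq_add_of_le h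
  have h2 : 0 < 2 ^ (m + 1) := by positivity
  have perr : ∀ k a b, D m (a + 4 * 2 ^ (m + 1) * k) b = D m a b := by
    intro k a b
    induction k with
    | zero => rfl
    | succ k ih => rw [mul_add_one, ← add_assoc, hD.per, ih]
  have perr' : ∀ k a b, D m a (b + 4 * 2 ^ (m + 1) * k) = D m a b := by
    intro k a b
    induction k with
    | zero => rfl
    | succ k ih => rw [mul_add_one, ← add_assoc, hD.per', ih]
  have e1 : x + 2 ^ (2 * m + 4 + j) + 2 ^ m = x + 2 ^ m + 2 ^ (m + 1) * (4 * 2 ^ (m + 1) * 2 ^ j) := by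
    ring
  have e2 : 2 * (x + 2 ^ (2 * m + 4 + j)) + 2 ^ (m + 1) = 2 * x + 2 ^ (m + 1) +
    2 ^ m * (4 * (8 * 2 ^ m * 2 ^ j)) := by ring
  have e3 : 2 ^ (2 * m + 4 + j - (m + 1)) = 4 * 2 ^ (m + 1) * 2 ^ j := by
    rw [show 2 * m + 4 + j - (m + 1) = m + 1 + 2 + j by omega]; ring
  have e4 : (x + 2 ^ (2 * m + 4 + j)) % 2 = x % 2 := by
    rw [show 2 ^ (2 * m + 4 + j) = 2 * 2 ^ (2 * m + 3 + j) by ring, Nat.add_mul_mod_self_left]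
  have e5 : ∀ a k, a + k + 4 * 2 ^ (m + 1) - 1 = a + 4 * 2 ^ (m + 1) - 1 + k := by omega
  simp only [hwire, e1, e2, e3, e4, Nat.add_mul_div_left _ _ h2,
    Nat.add_mul_div_left _ _ (show 0 < 2 ^ m by positivity), Nat.add_mul_mod_self_left, perr', perr,
    e5]

theorem div_add_two_pow {y m s : ℕ} (h : 2 * m + 4 ≤ s) :
    (y + 2 ^ s) / 2 ^ (m + 1) = y / 2 ^ (m + 1) + 2 ^ (s - (m + 1)) := by
  obtain ⟨j, rfl⟩ := Nat.exists_eq_add_of_le (show m + 1 ≤ s by omega)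
  rw [pow_add, Nat.add_mul_div_left _ _ (by positivity), add_tsub_cancel_left]

theorem posTile_add {x y s : ℕ} (hx : x ≠ 0) (hy : y ≠ 0) (h : 2 * lv x + 4 ≤ s)
    (h' : 2 * lv y + 4 ≤ s) : posTile q p (x + 2 ^ s) (y + 2 ^ s) = posTile q p x y := by
  have hD := dataOk_cellData q p
  have e : ∀ x, x ≠ 0 → x + 2 ^ s - 1 = x - 1 + 2 ^ s := fun x hx => by
    generalize 2 ^ s = M
    omega
  simp only [posTile, genTile, lv_add hx (show lv x < s by omega),
    lv_add hy (show lv y < s by omega), div_add_two_pow h, div_add_two_pow h', hwire_add hD h',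
    hwire_add hD.swap h, e x hx, e y hy]

/-- The origin of the approximations of the tiling of the plane. -/
def shiftNat (M : ℕ) : ℕ := (4 ^ M - 1) / 3

theorem shiftNat_spec (M : ℕ) : 3 * shiftNat M + 1 = 4 ^ M := by
  have h : 4 ^ M % 3 = 1 := by
    rw [Nat.pow_mod]
    norm_num
  have h' : 0 < 4 ^ M := by positivity
  rw [shiftNat]
  omega

theorem shiftNat_succ (M : ℕ) : shiftNat (M + 1) = shiftNat M + 2 ^ (2 * M) := by
  have h := shiftNat_spec M
  have h' := shiftNat_spec (M + 1)
  rw [pow_succ] at h'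
  rw [pow_mul, show 2 ^ 2 = 4 by norm_num]
  omega

theorem le_shiftNat (M : ℕ) : M ≤ shiftNat M + 1 := by
  have h := shiftNat_spec M
  have : 3 * M ≤ 4 ^ M + 2 := by
    clear h
    induction M with
    | zero => simp
    | succ M ih =>
      have : 0 < 4 ^ M := by positivity
      rw [pow_succ]
      omega
  omega

theorem lv_le {i : ℤ} {M : ℕ} (h : i.natAbs + 3 ≤ M) :
    (i + shiftNat M).toNat ≠ 0 ∧ lv (i + shiftNat M).toNat ≤ i.natAbs + 1 := by
  have hM := le_shiftNat M
  have h0 : (i + shiftNat M).toNat ≠ 0 := by omega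
  refine ⟨h0, ?_⟩
  obtain ⟨a, ha⟩ := exists_lv h0
  by_contra! hlt
  set v := lv (i + shiftNat M).toNat
  have hd : (2 : ℤ) ^ (i.natAbs + 2) ∣ i + shiftNat M := by
    have h1 : ((i + shiftNat M).toNat : ℤ) = i + shiftNat M := by omega
    rw [← h1, ha]
    push_cast
    exact ((pow_dvd_pow 2 (by omega)).trans (Dvd.intro _ rfl))
  have hs : (3 * shiftNat M + 1 : ℤ) = 4 ^ M := by exact_mod_cast shiftNat_spec M
  have hd2 : (2 : ℤ) ^ (i.natAbs + 2) ∣ 4 ^ M := by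
    rw [show (4 : ℤ) = 2 ^ 2 by norm_num, ← pow_mul]
    exact pow_dvd_pow 2 (by omega)
  have hd3 : (2 : ℤ) ^ (i.natAbs + 2) ∣ 3 * i - 1 := by
    have : 3 * i - 1 = 3 * (i + shiftNat M) - 4 ^ M := by rw [← hs]; ring
    rw [this]
    exact dvd_sub (hd.mul_left _) hd2
  have hd4 := Int.le_of_dvd (abs_pos.2 (by omega)) ((dvd_abs _ _).2 hd3)
  have hlt2 : i.natAbs < 2 ^ i.natAbs := Nat.lt_two_pow_self
  have hlt3 : (i.natAbs : ℤ) + 1 ≤ 2 ^ i.natAbs := by exact_mod_cast hlt2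
  have : |3 * i - 1| ≤ 3 * i.natAbs + 1 := by
    rw [abs_le]
    omega
  rw [pow_add] at hd4
  omega

/-- The tile at position `(i, j)`. -/
noncomputable def intTile (q : ℕ → Bool) (p : List Instr) (i j : ℤ) : Tile :=
  posTile q p (i + shiftNat (i.natAbs + j.natAbs + 3)).toNat
    (j + shiftNat (i.natAbs + j.natAbs + 3)).toNat

theorem intTile_eq {i j : ℤ} {M : ℕ} (h : i.natAbs + j.natAbs + 3 ≤ M) :
    intTile q p i j = posTile q p (i + shiftNat M).toNat (j + shiftNat M).toNat := by
  induction M, h using Nat.le_induction with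
  | base => rfl
  | succ M hM ih =>
    have hi := lv_le (i := i) (M := M) (by omega)
    have hj := lv_le (i := j) (M := M) (by omega)
    rw [ih, ← posTile_add (s := 2 * M) hi.1 hj.1 (by omega) (by omega), shiftNat_succ]
    have := hi.1
    have := hj.1
    push_cast
    generalize h : 2 ^ (2 * M) = B
    have h' : (2 : ℤ) ^ (2 * M) = B := by exact_mod_cast h
    rw [h']
    congr 1 <;> omega

theorem ok_intTile (hq : ∀ n, Instr.prog p (Instr.run q (Instr.prog p) n).1 ≠ .halt) (i j : ℤ) :
    (intTile q p i j).Ok (Instr.prog p) :=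
  ok_posTile hq (lv_le (by omega)).1 (lv_le (by omega)).1

theorem intTile_hor (i j : ℤ) : (intTile q p i j).E = (intTile q p (i + 1) j).W := by
  set M := i.natAbs + j.natAbs + 4
  have hM := le_shiftNat M
  rw [intTile_eq (M := M) (by omega), intTile_eq (M := M) (by omega), posTile_hor]
  congr 2
  omega

theorem intTile_ver (i j : ℤ) : (intTile q p i j).N = (intTile q p i (j + 1)).S := by
  set M := i.natAbs + j.natAbs + 4
  have hM := le_shiftNat M
  rw [intTile_eq (M := M) (by omega), intTile_eq (M := M) (by omega), posTile_ver]
  congr 2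
  omega

end

/-! ### Computability of the tiling -/

/-- The truth values of an oracle prefix. -/
noncomputable def orc (l : List ℕ) (i : ℕ) : Bool := dec (l[i]?.getD 0 = 1)

section
variable {α β σ τ : Type*} [Primcodable α] [Primcodable β]

@[fun_prop] theorem C_orc {f : α → List ℕ} {g : α → ℕ} (hf : Computable f) (hg : Computable g) :
    Computable (fun a => orc (f a) (g a)) := by
  unfold orc
  fun_prop

/-- Computable functions with finitely many values, in an arbitrary type. -/
def FinComp (f : α → τ) : Prop :=
  ∃ (n : ℕ) (c : α → ℕ) (g : ℕ → τ), Computable c ∧ (∀ a, c a < n) ∧ ∀ a, f a = g (c a)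

namespace FinComp

theorem of_bounded {f : α → ℕ} (hf : Computable f) (n : ℕ) (h : ∀ a, f a < n) : FinComp f :=
  ⟨n, f, id, hf, h, fun _ => rfl⟩

theorem map {f : α → σ} (hf : FinComp f) (g : σ → τ) : FinComp (fun a => g (f a)) := by
  obtain ⟨n, c, g', hc, hn, h⟩ := hf
  exact ⟨n, c, g ∘ g', hc, hn, fun a => by simp [h]⟩

theorem map₂ {κ : Type*} {f : α → σ} {f' : α → τ} (hf : FinComp f) (hf' : FinComp f')
    (g : σ → τ → κ) : FinComp (fun a => g (f a) (f' a)) := by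
  obtain ⟨n, c, e, hc, hn, h⟩ := hf
  obtain ⟨n', c', e', hc', hn', h'⟩ := hf'
  refine ⟨n * n', fun a => c a * n' + c' a, fun k => g (e (k / n')) (e' (k % n')), by fun_prop,
    fun a => ?_, fun a => ?_⟩
  · have h1 := hn a
    have h2 := hn' a
    calc c a * n' + c' a < c a * n' + n' := by omega
      _ = (c a + 1) * n' := by ring
      _ ≤ n * n' := Nat.mul_le_mul_right _ h1
  · have h2 := hn' a
    simp only [h, h']
    rw [mul_comm, Nat.mul_add_div (by omega), Nat.div_eq_of_lt h2, add_zero,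
      Nat.mul_add_mod, Nat.mod_eq_of_lt h2]

theorem bool {f : α → Bool} (hf : Computable f) : FinComp f := by
  refine ⟨2, fun a => bif f a then 1 else 0, fun k => k == 1, by fun_prop, fun a => ?_, fun a => ?_⟩
  · cases h : f a <;> simp [h]
  · cases h : f a <;> simp [h]

theorem compare {f g : α → ℕ} (hf : Computable f) (hg : Computable g) :
    FinComp (fun a => compare (f a) (g a)) := by
  have h := (bool (f := fun a => dec (f a < g a)) (by fun_prop)).map₂
    (bool (f := fun a => dec (f a = g a)) (by fun_prop))
    (fun b b' => bif b then Ordering.lt else bif b' then Ordering.eq else Ordering.gt)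
  convert h using 2 with a
  rcases lt_trichotomy (f a) (g a) with h | h | h
  · rw [Nat.compare_eq_lt.2 h, dec_eq_true.2 h, cond_true]
  · rw [Nat.compare_eq_eq.2 h, dec_eq_false.2 h.not_lt, dec_eq_true.2 h, cond_false, cond_true]
  · rw [Nat.compare_eq_gt.2 h, dec_eq_false.2 h.not_gt, dec_eq_false.2 h.ne', cond_false,
      cond_false]

theorem eventuallyConst {f : α → ℕ → τ} (K : ℕ) (hf : ∀ r, FinComp (fun a => f a r))
    (hK : ∀ a r, K ≤ r → f a r = f a K) : FinComp f := by
  have key : ∀ k, FinComp (fun a (r : ℕ) => if r < k then f a r else f a K) := by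
    intro k
    induction k with
    | zero => simpa using (hf K).map (fun t (_ : ℕ) => t)
    | succ k ih =>
      have := ih.map₂ (hf k) (fun F t r => if r = k then t else F r)
      convert this using 3 with a r
      split_ifs with h1 h2 h3 h4 h5
      · rw [h2]
      · rfl
      · omega
      · omega
      · omega
      · rfl
  convert key K using 3 with a r
  split_ifs with h
  · rfl
  · exact hK a r (by omega)

end FinComp
end

namespace Instr

/-- The kind of an instruction. -/
def op : Instr → ℕ
  | set _ _ => 0
  | clr _ => 1
  | inc _ => 2
  | jeq _ _ _ => 3
  | jz _ _ => 4
  | halt => 5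

/-- The first register of an instruction. -/
def arg₁ : Instr → ℕ
  | set a _ | clr a | inc a | jeq a _ _ | jz a _ => a
  | halt => 0

/-- The second register of an instruction. -/
def arg₂ : Instr → ℕ
  | set _ b | jeq _ b _ => b
  | _ => 0

/-- The target of a jump. -/
def target : Instr → ℕ
  | jeq _ _ l | jz _ l => l
  | _ => 0

/-- The value of a register in a list of assignments. -/
def look (L : List (ℕ × ℕ)) (r : ℕ) : ℕ :=
  (((L.filter fun e => e.1 == r).head?).map Prod.snd).getD 0

theorem look_cons (a v : ℕ) (L : List (ℕ × ℕ)) :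
    look ((a, v) :: L) = Function.update (look L) a v := by
  funext r
  rw [Function.update_apply, look, List.filter_cons]
  split_ifs with h1 h2 h3
  · rfl
  · simp at h1; omega
  · simp at h1; omega
  · rfl

@[fun_prop] theorem C_look {α : Type*} [Primcodable α] {f : α → List (ℕ × ℕ)} {g : α → ℕ}
    (hf : Computable f) (hg : Computable g) : Computable (fun a => look (f a) (g a)) := by
  unfold look
  have : Computable (fun q : (α × List (ℕ × ℕ)) => q.2.head?.map Prod.snd) := by fun_prop
  fun_prop

theorem computable_prog (p : List Instr) (f : Instr → ℕ) : Computable fun i => f (prog p i) := by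
  have : Computable fun i : ℕ => ((p.map f)[i]?).getD (f halt) := by fun_prop
  refine this.of_eq fun i => ?_
  rw [prog, List.getElem?_map]
  cases p[i]? <;> rfl

/-- A computable version of `step`, for a program given by its components. -/
noncomputable def cstepAux (A B T O : ℕ → ℕ) (l : List ℕ) (c : ℕ × List (ℕ × ℕ)) :
    ℕ × List (ℕ × ℕ) :=
  if O c.1 = 0 then (c.1 + 1, (A c.1, look c.2 (B c.1)) :: c.2) else
  if O c.1 = 1 then (c.1 + 1, (A c.1, 0) :: c.2) else
  if O c.1 = 2 then (c.1 + 1, (A c.1, look c.2 (A c.1) + 1) :: c.2) else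
  if O c.1 = 3 then (if look c.2 (A c.1) = look c.2 (B c.1) then T c.1 else c.1 + 1, c.2) else
  if O c.1 = 4 then (if orc l (look c.2 (A c.1)) = false then T c.1 else c.1 + 1, c.2) else c

theorem computable_cstepAux {A B T O : ℕ → ℕ} (hA : Computable A) (hB : Computable B)
    (hT : Computable T) (hO : Computable O) :
    Computable fun q : List ℕ × (ℕ × List (ℕ × ℕ)) => cstepAux A B T O q.1 q.2 := by
  have h : ∀ n, Computable fun q : List ℕ × (ℕ × List (ℕ × ℕ)) => dec (O q.2.1 = n) := by fun_prop
  have h0 : Computable fun q : List ℕ × (ℕ × List (ℕ × ℕ)) =>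
      (q.2.1 + 1, (A q.2.1, look q.2.2 (B q.2.1)) :: q.2.2) := by fun_prop
  have h1 : Computable fun q : List ℕ × (ℕ × List (ℕ × ℕ)) =>
      (q.2.1 + 1, (A q.2.1, 0) :: q.2.2) := by fun_prop
  have h2 : Computable fun q : List ℕ × (ℕ × List (ℕ × ℕ)) =>
      (q.2.1 + 1, (A q.2.1, look q.2.2 (A q.2.1) + 1) :: q.2.2) := by fun_prop
  have h3 : Computable fun q : List ℕ × (ℕ × List (ℕ × ℕ)) =>
      (if look q.2.2 (A q.2.1) = look q.2.2 (B q.2.1) then T q.2.1 else q.2.1 + 1, q.2.2) := by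
    fun_prop
  have h4 : Computable fun q : List ℕ × (ℕ × List (ℕ × ℕ)) =>
      (if orc q.1 (look q.2.2 (A q.2.1)) = false then T q.2.1 else q.2.1 + 1, q.2.2) := by
    fun_prop
  exact C_ite (h 0) h0 (C_ite (h 1) h1 (C_ite (h 2) h2 (C_ite (h 3) h3 (C_ite (h 4) h4 (by fun_prop)))))

/-- A computable version of `step`. -/
noncomputable def cstep (p : List Instr) (l : List ℕ) (c : ℕ × List (ℕ × ℕ)) : ℕ × List (ℕ × ℕ) :=
  cstepAux (fun i => (prog p i).arg₁) (fun i => (prog p i).arg₂) (fun i => (prog p i).target)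
    (fun i => (prog p i).op) l c

theorem step_cstep (p : List Instr) (l : List ℕ) (c : ℕ × List (ℕ × ℕ)) :
    step (orc l) (prog p) (c.1, look c.2) = ((cstep p l c).1, look (cstep p l c).2) := by
  simp only [step, cstep, cstepAux]
  cases prog p c.1 <;> simp [op, arg₁, arg₂, target, look_cons] <;> congr

/-- A computable version of `run`. -/
noncomputable def crun (p : List Instr) (l : List ℕ) (n : ℕ) : ℕ × List (ℕ × ℕ) :=
  (cstep p l)^[n] (0, [])

theorem run_crun (p : List Instr) (l : List ℕ) (n : ℕ) :
    run (orc l) (prog p) n = ((crun p l n).1, look (crun p l n).2) := by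
  induction n with
  | zero => rfl
  | succ n ih => rw [run_succ, ih, step_cstep, crun, crun, Function.iterate_succ_apply']

section
variable {α : Type*} [Primcodable α] (p : List Instr)

theorem C_cstep : Computable fun q : List ℕ × (ℕ × List (ℕ × ℕ)) => cstep p q.1 q.2 :=
  computable_cstepAux (computable_prog p arg₁) (computable_prog p arg₂) (computable_prog p target)
    (computable_prog p op)

@[fun_prop] theorem C_crun {f : α → List ℕ} {g : α → ℕ} (hf : Computable f) (hg : Computable g) :
    Computable (fun a => crun p (f a) (g a)) := by
  have h : Computable fun q : α × (ℕ × List (ℕ × ℕ)) => cstep p (f q.1) q.2 :=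
    (C_cstep p).comp (g := fun q : α × (ℕ × List (ℕ × ℕ)) => (f q.1, q.2)) (by fun_prop)
  unfold crun
  fun_prop

@[fun_prop] theorem C_run_fst {f : α → List ℕ} {g : α → ℕ} (hf : Computable f)
    (hg : Computable g) : Computable (fun a => (run (orc (f a)) (prog p) (g a)).1) := by
  simp only [run_crun]
  fun_prop

@[fun_prop] theorem C_run_snd {f : α → List ℕ} {g h : α → ℕ} (hf : Computable f)
    (hg : Computable g) (hh : Computable h) :
    Computable (fun a => (run (orc (f a)) (prog p) (g a)).2 (h a)) := by
  simp only [run_crun]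
  fun_prop

@[fun_prop] theorem C_flag {f : α → List ℕ} {g : α → ℕ} (hf : Computable f) (hg : Computable g) :
    Computable (fun a => (prog p (run (orc (f a)) (prog p) (g a)).1).flag (orc (f a))
      (run (orc (f a)) (prog p) (g a)).2) := by
  have hc : Computable fun a => crun p (f a) (g a) := by fun_prop
  have hi : ∀ F : Instr → ℕ, Computable fun a => F (prog p (crun p (f a) (g a)).1) := fun F =>
    (computable_prog p F).comp (g := fun a => (crun p (f a) (g a)).1) (by fun_prop)
  have h1 := hi arg₁
  have h2 := hi arg₂
  have h3 : ∀ n, Computable fun a => dec ((prog p (crun p (f a) (g a)).1).op = n) := fun n =>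
    C_dec_eq (hi op) (C_const n)
  have hl : ∀ F : Instr → ℕ, Computable fun a =>
      look (crun p (f a) (g a)).2 (F (prog p (crun p (f a) (g a)).1)) := fun F =>
    C_look (C_snd hc) (hi F)
  have h := C_ite (h3 3) (C_dec_eq (hl arg₁) (hl arg₂)) (C_ite (h3 4) (C_bnot (C_orc hf (hl arg₁)))
    (C_const false))
  refine h.of_eq fun a => ?_
  simp only [run_crun]
  cases prog p (crun p (f a) (g a)).1 <;> simp [op, arg₁, arg₂, flag]

end

theorem exists_reg_bound (p : List Instr) :
    ∃ K, ∀ q n r, K ≤ r → (run q (prog p) n).2 r = 0 := by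
  obtain ⟨K, hK⟩ : ∃ K, ∀ i, (prog p i).arg₁ < K := by
    refine ⟨(p.map arg₁).sum + 1, fun i => ?_⟩
    rw [prog]
    cases h : p[i]? with
    | none => simp [arg₁]
    | some x =>
      have := List.single_le_sum (l := p.map arg₁) (by simp) (arg₁ x)
        (List.mem_map.2 ⟨x, List.mem_of_getElem? h, rfl⟩)
      simp only [Option.getD_some]
      omega
  refine ⟨K, fun q n r hr => ?_⟩
  induction n with
  | zero => rfl
  | succ n ih =>
    have h := hK (run q (prog p) n).1
    rw [run_succ, step]
    cases hi : prog p (run q (prog p) n).1 with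
    | set a b | clr a | inc a =>
      rw [hi, arg₁] at h
      exact (Function.update_of_ne (show r ≠ a by omega) _ _).trans ih
    | _ => exact ih

theorem run_le (q : ℕ → Bool) (p : ℕ → Instr) (n r : ℕ) : (run q p n).2 r ≤ n := by
  induction n generalizing r with
  | zero => simp [run]
  | succ n ih =>
    rw [run_succ, step]
    have h := ih r
    cases hi : p (run q p n).1 with
    | set a b =>
      have h' := ih b
      simp only [Function.update_apply]
      split_ifs <;> omega
    | clr a =>
      simp only [Function.update_apply]
      split_ifs <;> omega
    | inc a =>
      have h' := ih a
      simp only [Function.update_apply]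
      split_ifs <;> omega
    | _ => exact h.trans (Nat.le_succ n)

theorem run_congr {q q' : ℕ → Bool} {T : ℕ} (h : ∀ i < T, q i = q' i) (p : ℕ → Instr) {n : ℕ}
    (hn : n ≤ T) : run q p n = run q' p n := by
  induction n with
  | zero => rfl
  | succ n ih =>
    rw [run_succ, run_succ, ih (by omega), step, step]
    cases hi : p (run q' p n).1 with
    | jz b l =>
      have := h _ ((run_le q' p n b).trans_lt hn)
      simp only [this]
    | _ => rfl

end Instr

theorem computable_lv : Computable lv := by
  have key : ∀ x, ∃ n, x = 0 ∨ x % 2 ^ (n + 1) ≠ 0 := by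
    intro x
    by_cases hx : x = 0
    · exact ⟨0, .inl hx⟩
    · refine ⟨x, .inr ?_⟩
      rw [Nat.mod_eq_of_lt]
      · exact hx
      · exact Nat.lt_two_pow_self.trans (Nat.pow_lt_pow_right (by omega) (by omega))
  have h := computable_find (p := fun x n => x = 0 ∨ x % 2 ^ (n + 1) ≠ 0) (by fun_prop) key
  refine h.of_eq fun x => ?_
  trans Nat.find (key x)
  · congr
  by_cases hx : x = 0
  · exact ((Nat.find_eq_zero (key x)).2 (.inl hx)).trans (by rw [lv, hx, padicValNat_zero_right])
  obtain ⟨a, ha⟩ := exists_lv hx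
  refine (Nat.find_eq_iff (key x)).2 ⟨.inr fun h0 => ?_, fun n hn => ?_⟩
  · have h0 := Nat.dvd_of_mod_eq_zero h0
    rw [pow_succ] at h0
    nth_rw 2 [ha] at h0
    have := (Nat.mul_dvd_mul_iff_left (by positivity)).1 h0
    omega
  · simp only [hx, false_or, not_not]
    refine Nat.mod_eq_zero_of_dvd ?_
    rw [ha]
    exact (pow_dvd_pow 2 hn).trans (Dvd.intro _ rfl)

section
variable {α : Type*} [Primcodable α] (p : List Instr)

@[fun_prop] theorem C_lv {f : α → ℕ} (hf : Computable f) : Computable (fun a => lv (f a)) :=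
  computable_lv.comp hf

theorem finComp_lineData {l : α → List ℕ} {m a : α → ℕ} (hl : Computable l) (hm : Computable m)
    (ha : Computable a) : FinComp fun x => lineData (orc (l x)) p (m x) (a x) := by
  have h1 : FinComp fun x => decide (a x % 2 = 1) := .bool (by fun_prop)
  have h2 : FinComp fun x => decide (a x % 2 ^ (m x + 1) = 0) := .bool (by fun_prop)
  have h3 : FinComp fun x => ((a x / 2 ^ (m x + 1) : ℕ) : ZMod 4) := by
    have := (FinComp.of_bounded (f := fun x => a x / 2 ^ (m x + 1) % 4) (by fun_prop) 4
      (fun x => by omega)).map (fun k => (k : ZMod 4))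
    convert this using 2 with x
    exact (ZMod.natCast_mod _ 4).symm
  have h4 : FinComp fun x => orc (l x) (a x % 2 ^ (m x + 1)) := .bool (by fun_prop)
  have h5 : FinComp fun x => orc (l x) ((a x / 2) % (2 * 2 ^ (m x + 1))) := .bool (by fun_prop)
  have h6 : FinComp fun x => min (Instr.run (orc (l x)) (Instr.prog p) (a x % 2 ^ (m x + 1))).1
      p.length := .of_bounded (by fun_prop) (p.length + 1) (fun x => by omega)
  have h7 : FinComp fun x =>
      (Instr.prog p (Instr.run (orc (l x)) (Instr.prog p) (a x % 2 ^ (m x + 1))).1).flag (orc (l x))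
        (Instr.run (orc (l x)) (Instr.prog p) (a x % 2 ^ (m x + 1))).2 := .bool (by fun_prop)
  exact (((((h1.map₂ h2 Prod.mk).map₂ h3 Prod.mk).map₂ h4 Prod.mk).map₂ h5 Prod.mk).map₂ h6
    Prod.mk).map₂ h7 fun q f => LineData.mk q.1.1.1.1.1 q.1.1.1.1.2 q.1.1.1.2 q.1.1.2 q.1.2 q.2 f

theorem finComp_cellData {l : α → List ℕ} {m a b : α → ℕ} (hl : Computable l) (hm : Computable m)
    (ha : Computable a) (hb : Computable b) :
    FinComp fun x => cellData (orc (l x)) p (m x) (a x) (b x) := by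
  have h1 := finComp_lineData p hl hm ha
  have h2 := finComp_lineData p hl hm hb
  have h3 : FinComp fun x => compare (a x % 2 ^ (m x + 1)) (b x % 2 ^ (m x + 1)) :=
    .compare (by fun_prop) (by fun_prop)
  have h4 : FinComp fun x => compare (a x % 2 ^ (m x + 1) / 2) (b x % 2 ^ (m x + 1)) :=
    .compare (by fun_prop) (by fun_prop)
  have h5 : FinComp fun x r => compare (a x % 2 ^ (m x + 1))
      ((Instr.run (orc (l x)) (Instr.prog p) (b x % 2 ^ (m x + 1))).2 r) := by
    obtain ⟨K, hK⟩ := Instr.exists_reg_bound p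
    refine .eventuallyConst K (fun r => .compare (by fun_prop) (by fun_prop)) fun x r hr => ?_
    rw [hK _ _ _ hr, hK _ _ _ le_rfl]
  exact (((h1.map₂ h2 Prod.mk).map₂ h3 Prod.mk).map₂ h4 Prod.mk).map₂ h5
    fun q f => CellData.mk q.1.1.1 q.1.1.2 q.1.2 q.2 f

theorem finComp_hwire {D : List ℕ → ℕ → ℕ → ℕ → CellData} {l : α → List ℕ} {m b x : α → ℕ}
    (hD : ∀ {l : α → List ℕ} {m a b : α → ℕ}, Computable l → Computable m → Computable a →
      Computable b → FinComp fun x => D (l x) (m x) (a x) (b x))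
    (hl : Computable l) (hm : Computable m)
    (hb : Computable b) (hx : Computable x) :
    FinComp fun e => hwire (D (l e)) (m e) (b e) (x e) := by
  have h1 := hD hl hm (show Computable fun e =>
    (x e + 2 ^ m e) / 2 ^ (m e + 1) + 4 * 2 ^ (m e + 1) - 1 by fun_prop) hb
  have h2 := hD hl hm (show Computable fun e => (x e + 2 ^ m e) / 2 ^ (m e + 1) by fun_prop) hb
  have h3 : FinComp fun e => (2 * x e + 2 ^ (m e + 1)) / 2 ^ m e % 4 :=
    .of_bounded (by fun_prop) 4 fun e => by omega
  have h4 : FinComp fun e => decide (x e % 2 = 1) := .bool (by fun_prop)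
  have h5 : FinComp fun e => decide (m e = 0) := .bool (by fun_prop)
  exact (((h1.map₂ h2 Prod.mk).map₂ h3 Prod.mk).map₂ h4 Prod.mk).map₂ h5
    fun q f => Wire.mk q.1.1.1 q.1.1.2 q.1.2 q.2 f

theorem finComp_posTile {l : α → List ℕ} {x y : α → ℕ} (hl : Computable l) (hx : Computable x)
    (hy : Computable y) : FinComp fun e => posTile (orc (l e)) p (x e) (y e) := by
  have hD := fun {l : α → List ℕ} {m a b : α → ℕ} => finComp_cellData p (l := l) (m := m) (a := a)
    (b := b)
  have hD' : ∀ {l : α → List ℕ} {m a b : α → ℕ}, Computable l → Computable m → Computable a →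
      Computable b → FinComp fun x => swapData (cellData (orc (l x)) p) (m x) (a x) (b x) :=
    fun h1 h2 h3 h4 => (hD h1 h2 h4 h3).map CellData.tr
  have h0 : FinComp fun e => compare (lv (x e)) (lv (y e)) := .compare (by fun_prop) (by fun_prop)
  have h1 := finComp_hwire (D := fun l => cellData (orc l) p) hD hl
    (show Computable fun e => lv (y e) by fun_prop)
    (show Computable fun e => y e / 2 ^ (lv (y e) + 1) by fun_prop)
    (show Computable fun e => x e - 1 by fun_prop)
  have h2 := finComp_hwire (D := fun l => cellData (orc l) p) hD hl
    (show Computable fun e => lv (y e) by fun_prop)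
    (show Computable fun e => y e / 2 ^ (lv (y e) + 1) by fun_prop) hx
  have h3 := finComp_hwire (D := fun l => swapData (cellData (orc l) p)) hD' hl
    (show Computable fun e => lv (x e) by fun_prop)
    (show Computable fun e => x e / 2 ^ (lv (x e) + 1) by fun_prop)
    (show Computable fun e => y e - 1 by fun_prop)
  have h4 := finComp_hwire (D := fun l => swapData (cellData (orc l) p)) hD' hl
    (show Computable fun e => lv (x e) by fun_prop)
    (show Computable fun e => x e / 2 ^ (lv (x e) + 1) by fun_prop) hy
  exact (((h0.map₂ h1 Prod.mk).map₂ h2 Prod.mk).map₂ (h3.map Wire.tr) Prod.mk).map₂ (h4.map Wire.tr)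
    fun q f => Tile.mk q.1.1.1 q.1.1.2 q.1.2 q.2 f

end

section
variable {q q' : ℕ → Bool} (p : List Instr)

theorem lineData_congr {m : ℕ} (h : ∀ i < 2 ^ (m + 2), q i = q' i) (a : ℕ) :
    lineData q p m a = lineData q' p m a := by
  have h2 : 0 < 2 ^ (m + 1) := by positivity
  have h3 : 2 ^ (m + 2) = 2 * 2 ^ (m + 1) := by ring
  have hlt := Nat.mod_lt a h2
  have hr := Instr.run_congr h (Instr.prog p) (show a % 2 ^ (m + 1) ≤ _ by omega)
  simp only [lineData, hr, h _ (show a % 2 ^ (m + 1) < _ by omega),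
    h _ (show a / 2 % (2 * 2 ^ (m + 1)) < _ by rw [h3]; exact Nat.mod_lt _ (by omega))]
  congr 1
  have hb := fun r => h _ ((Instr.run_le q' (Instr.prog p) (a % 2 ^ (m + 1)) r).trans_lt
    (show a % 2 ^ (m + 1) < _ by omega))
  cases Instr.prog p (Instr.run q' (Instr.prog p) (a % 2 ^ (m + 1))).1 <;> simp [Instr.flag, hb]

theorem cellData_congr {m : ℕ} (h : ∀ i < 2 ^ (m + 2), q i = q' i) :
    cellData q p m = cellData q' p m := by
  funext a b
  have h2 : 0 < 2 ^ (m + 1) := by positivity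
  have h3 : 2 ^ (m + 2) = 2 * 2 ^ (m + 1) := by ring
  have hlt := Nat.mod_lt b h2
  have hr := Instr.run_congr h (Instr.prog p) (show b % 2 ^ (m + 1) ≤ _ by omega)
  simp only [cellData, hr, lineData_congr p h]

theorem posTile_congr {x y : ℕ} (h : ∀ i < 2 ^ (x + y + 2), q i = q' i) :
    posTile q p x y = posTile q' p x y := by
  have hle : ∀ x, lv x ≤ x := fun x => by
    by_cases h0 : x = 0
    · simp [lv, h0]
    · obtain ⟨a, ha⟩ := exists_lv h0
      exact Nat.lt_two_pow_self.le.trans ((Nat.le_mul_of_pos_right _ (by omega)).trans_eq ha.symm)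
  have hx := cellData_congr p (m := lv x) fun i hi =>
    h i (hi.trans_le (Nat.pow_le_pow_right (by omega) (by have := hle x; omega)))
  have hy := cellData_congr p (m := lv y) fun i hi =>
    h i (hi.trans_le (Nat.pow_le_pow_right (by omega) (by have := hle y; omega)))
  simp only [posTile, genTile, hwire, swapData, hx, hy]

end

/-! ### Words in a finitely generated group -/

section Words
variable {G : Type*} [Group G] {k : ℕ} {σ : Fin k → G}

theorem wordVal_eq_prod (w : List (Fin k × Bool)) :
    wordVal σ w = (w.map fun x => cond x.2 (σ x.1) (σ x.1)⁻¹).prod :=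
  FreeGroup.lift_mk

theorem wordVal_nil : wordVal σ [] = 1 := by rw [wordVal_eq_prod]; rfl

theorem wordVal_append (u v : List (Fin k × Bool)) :
    wordVal σ (u ++ v) = wordVal σ u * wordVal σ v := by
  simp [wordVal_eq_prod]

/-- The formal inverse of a word. -/
def wordInv (w : List (Fin k × Bool)) : List (Fin k × Bool) :=
  (w.map fun x => (x.1, !x.2)).reverse

theorem wordVal_wordInv (w : List (Fin k × Bool)) : wordVal σ (wordInv w) = (wordVal σ w)⁻¹ := by
  rw [wordVal, wordVal, ← map_inv, FreeGroup.inv_mk]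
  rfl

@[fun_prop] theorem C_wordInv {α : Type*} [Primcodable α] {f : α → List (Fin k × Bool)}
    (hf : Computable f) : Computable (fun a => wordInv (f a)) := by
  unfold wordInv
  fun_prop

theorem wordVal_surjective (hσ : IsSymmGen σ) : Function.Surjective (wordVal σ) := by
  have h : Function.Surjective (cover σ) := by
    rw [← MonoidHom.range_eq_top, cover, FreeGroup.range_lift_eq_closure, hσ.1]
  exact h.comp fun g => ⟨g.toWord, FreeGroup.mk_toWord⟩

theorem DecidableWordProblem.computable_eq (h : DecidableWordProblem σ) :
    Computable fun q : List (Fin k × Bool) × List (Fin k × Bool) =>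
      dec (wordVal σ q.1 = wordVal σ q.2) := by
  obtain ⟨φ, hφ, h⟩ := h
  have hc : Computable fun q : List (Fin k × Bool) × List (Fin k × Bool) =>
      φ (q.1 ++ wordInv q.2) := by fun_prop
  refine hc.of_eq fun q => ?_
  rw [Bool.eq_iff_iff, h, wordVal_append, wordVal_wordInv, mul_inv_eq_one, dec_eq_true]

end Words

/-! ### Computable groups -/

/-- A group on a numbered set, with computable operations. -/
class CGroup (H : Type*) [Group H] [Denumerable H] : Prop where
  computable_mul : Computable fun q : H × H => q.1 * q.2
  computable_inv : Computable fun a : H => a⁻¹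

section CGroup
variable {H α : Type*} [Group H] [Denumerable H] [CGroup H] [Primcodable α]

@[fun_prop] theorem C_gmul {f g : α → H} (hf : Computable f) (hg : Computable g) :
    Computable (fun a => f a * g a) := CGroup.computable_mul.comp (hf.pair hg)

@[fun_prop] theorem C_ginv {f : α → H} (hf : Computable f) : Computable (fun a => (f a)⁻¹) :=
  CGroup.computable_inv.comp hf

end CGroup

open Classical in
theorem computable_count {p : ℕ → Prop} (hp : Computable fun n => dec (p n)) :
    Computable fun n => Nat.count p n := by
  obtain ⟨b, hb⟩ : ∃ b : ℕ → Bool, ∀ n, b n = dec (p n) := ⟨_, fun _ => rfl⟩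
  simp only [← hb] at hp
  have : Computable fun n : ℕ => Nat.rec (motive := fun _ => ℕ) 0
      (fun n c => bif b n then c + 1 else c) n := by fun_prop
  refine this.of_eq fun n => ?_
  induction n with
  | zero => simp
  | succ n ih =>
    simp only [ih]
    rw [Nat.count_succ]
    by_cases h : p n
    · rw [hb, dec_eq_true.2 h, cond_true, if_pos h]
    · rw [hb, dec_eq_false.2 h, cond_false, if_neg h, add_zero]

theorem exists_cGroup {H : Type*} [Group H] [Infinite H] {k : ℕ} {σ : Fin k → H}
    (hσ : IsSymmGen σ) (h : DecidableWordProblem σ) :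
    ∃ (_ : Denumerable H), CGroup H ∧ Computable (wordVal σ) := by
  classical
  have hE := h.computable_eq
  let D : ℕ → List (Fin k × Bool) := fun n => (Encodable.decode n).getD []
  have hD : Computable D := by fun_prop
  obtain ⟨p, hpn⟩ : ∃ p : ℕ → Prop, ∀ n, p n ↔ ∀ m < n, wordVal σ (D m) ≠ wordVal σ (D n) :=
    ⟨_, fun _ => Iff.rfl⟩
  have hEq : Computable fun q : ℕ × ℕ => dec (wordVal σ (D q.2) = wordVal σ (D q.1)) :=
    hE.comp (g := fun q : ℕ × ℕ => (D q.2, D q.1)) (by fun_prop)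
  have hp : Computable fun n => dec (p n) := by
    simp only [hpn]
    show Computable fun n => dec (∀ m < n, ¬ wordVal σ (D m) = wordVal σ (D n))
    fun_prop
  have hs : ∀ a, ∃ n, wordVal σ (D n) = a := fun a => by
    obtain ⟨w, rfl⟩ := wordVal_surjective hσ a
    exact ⟨Encodable.encode w, by simp [D]⟩
  let idx : H → ℕ := fun a => Nat.find (hs a)
  have hidx : ∀ a, wordVal σ (D (idx a)) = a := fun a => Nat.find_spec (hs a)
  have hpidx : ∀ a, p (idx a) := fun a => (hpn _).2 fun m hm => by
    rw [hidx]
    exact Nat.find_min (hs a) hm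
  have hidxp : ∀ n, p n → idx (wordVal σ (D n)) = n := fun n hn =>
    (Nat.find_eq_iff _).2 ⟨rfl, (hpn n).1 hn⟩
  have hinf : (Set.ofPred p).Infinite :=
    Set.infinite_of_injective_forall_mem (f := idx)
      (fun a b hab => by rw [← hidx a, hab, hidx]) hpidx
  let e : H ≃ ℕ :=
    { toFun := fun a => Nat.count p (idx a)
      invFun := fun n => wordVal σ (D (Nat.nth p n))
      left_inv := fun a => by
        simp only [Nat.nth_count (hpidx a), hidx]
      right_inv := fun n => by
        simp only [hidxp _ (Nat.nth_mem_of_infinite hinf n), Nat.count_nth_of_infinite hinf] }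
  let inst : Denumerable H := Denumerable.mk' e
  have hfind : Computable fun n => Nat.nth p n := by
    have hex : ∀ n, ∃ m, p m ∧ Nat.count p m = n := fun n =>
      ⟨Nat.nth p n, Nat.nth_mem_of_infinite hinf n, Nat.count_nth_of_infinite hinf n⟩
    have hc := computable_count hp
    have hp' : Computable fun q : ℕ × ℕ => dec (p q.2) := hp.comp (g := fun q : ℕ × ℕ => q.2)
      (by fun_prop)
    refine (computable_find (p := fun n m => p m ∧ Nat.count p m = n)
      (C_dec_and hp' (C_dec_eq (hc.comp Computable.snd) Computable.fst)) hex).of_eq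
      fun n => ?_
    trans Nat.find (hex n)
    · congr
    · obtain ⟨h1, h2⟩ := Nat.find_spec (hex n)
      conv_rhs => rw [← h2]
      exact (Nat.nth_count h1).symm
  have hval : Computable (wordVal σ) := by
    refine Computable.encode_iff.1 ?_
    have h1 := computable_find (p := fun w n => wordVal σ (D n) = wordVal σ w)
      (hE.comp (g := fun q : List (Fin k × Bool) × ℕ => (D q.2, q.1)) (by fun_prop))
      (fun w => hs _)
    refine ((computable_count hp).comp h1).of_eq fun w => ?_
    show _ = Nat.count p (idx _)
    congr
  have hword : Computable fun a : H => D (Nat.nth p (Encodable.encode a)) := by fun_prop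
  have hword' : ∀ a : H, wordVal σ (D (Nat.nth p (Encodable.encode a))) = a := fun a =>
    e.left_inv a
  refine ⟨inst, ⟨?_, ?_⟩, hval⟩
  · have : Computable fun q : H × H => wordVal σ (D (Nat.nth p (Encodable.encode q.1)) ++
      D (Nat.nth p (Encodable.encode q.2))) := by fun_prop
    exact this.of_eq fun q => by rw [wordVal_append, hword', hword']
  · have : Computable fun a : H => wordVal σ (wordInv (D (Nat.nth p (Encodable.encode a)))) := by
      fun_prop
    exact this.of_eq fun q => by rw [wordVal_wordInv, hword']

/-! ### Word length in a computable group -/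

section
variable {H : Type*} [Group H] [Denumerable H]

/-- `N` is the word length with respect to the finite symmetric generating set `S`, and `bl`
lists its balls. -/
structure IsLength (S : List H) (bl : ℕ → List H) (N : H → ℕ) : Prop where
  computable_ball : Computable bl
  computable : Computable N
  mem_ball : ∀ {n h}, h ∈ bl n ↔ N h ≤ n
  inv_mem : ∀ {s}, s ∈ S → s⁻¹ ∈ S
  one : N 1 = 0
  eq_one : ∀ {h}, N h = 0 → h = 1
  step : ∀ {h n}, N h = n + 1 → ∃ s ∈ S, N (h * s) = n
  mul_le : ∀ a b, N (a * b) ≤ N a + N b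
  inv : ∀ a, N a⁻¹ = N a
  le_one : ∀ {s}, s ∈ S → N s ≤ 1

theorem exists_isLength [CGroup H] {S : List H} (hinv : ∀ s ∈ S, s⁻¹ ∈ S)
    (hgen : ∀ h : H, ∃ w : List H, (∀ s ∈ w, s ∈ S) ∧ w.prod = h) :
    ∃ bl N, IsLength S bl N := by
  let bl : ℕ → List H := fun n =>
    (fun l => l ++ l.flatMap fun h => S.map fun s => h * s)^[n] [1]
  have h1 : Computable fun q : (List H × H) × H => q.1.2 * q.2 := by fun_prop
  have h2 : Computable fun q : List H × H => S.map fun s => q.2 * s := C_map (C_const S) h1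
  have h3 : Computable fun l : List H => l ++ l.flatMap fun h => S.map fun s => h * s :=
    C_append C_id (C_flatMap C_id h2)
  have h4 : Computable fun q : ℕ × List H => q.2 ++ q.2.flatMap fun h => S.map fun s => h * s :=
    h3.comp Computable.snd
  have hbl : Computable bl := C_iterate C_id (C_const _) h4
  have hsucc : ∀ n, bl (n + 1) = bl n ++ (bl n).flatMap fun h => S.map fun s => h * s :=
    fun n => Function.iterate_succ_apply' _ _ _
  have hmem : ∀ n h, h ∈ bl n ↔ ∃ w : List H, (∀ s ∈ w, s ∈ S) ∧ w.length ≤ n ∧ w.prod = h := by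
    intro n
    induction n with
    | zero =>
      intro h
      simp only [bl, Function.iterate_zero_apply, List.mem_singleton, Nat.le_zero, List.length_eq_zero_iff]
      constructor
      · rintro rfl
        exact ⟨[], by simp, rfl, rfl⟩
      · rintro ⟨w, -, rfl, rfl⟩
        rfl
    | succ n ih =>
      intro h
      rw [hsucc, List.mem_append, ih, List.mem_flatMap]
      simp only [List.mem_map]
      constructor
      · rintro (⟨w, h1, h2, h3⟩ | ⟨a, ha, s, hs, rfl⟩)
        · exact ⟨w, h1, by omega, h3⟩
        · obtain ⟨w, h1, h2, rfl⟩ := (ih a).1 ha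
          refine ⟨w ++ [s], ?_, by simpa using h2, by simp⟩
          simp only [List.mem_append, List.mem_singleton]
          rintro t (ht | rfl)
          exacts [h1 t ht, hs]
      · rintro ⟨w, h1, h2, rfl⟩
        induction w using List.reverseRecOn with
        | nil => exact .inl ⟨[], by simp, by simp, rfl⟩
        | append_singleton w s =>
          refine .inr ⟨w.prod, (ih _).2 ⟨w, fun t ht => h1 t (by simp [ht]), by simpa using h2, rfl⟩,
            s, h1 s (by simp), by simp⟩
  have hex : ∀ h, ∃ n, h ∈ bl n := fun h => by
    obtain ⟨w, h1, h2⟩ := hgen h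
    exact ⟨w.length, (hmem _ _).2 ⟨w, h1, le_rfl, h2⟩⟩
  classical
  let N : H → ℕ := fun h => Nat.find (hex h)
  have hN : ∀ n h, h ∈ bl n ↔ N h ≤ n := by
    intro n h
    refine ⟨fun hh => Nat.find_min' _ hh, fun hh => ?_⟩
    obtain ⟨w, h1, h2, h3⟩ := (hmem _ _).1 (Nat.find_spec (hex h))
    exact (hmem _ _).2 ⟨w, h1, h2.trans hh, h3⟩
  have hN' : ∀ {n h}, N h ≤ n ↔ ∃ w : List H, (∀ s ∈ w, s ∈ S) ∧ w.length ≤ n ∧ w.prod = h :=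
    fun {n h} => (hN n h).symm.trans (hmem n h)
  have hinvle : ∀ a, N a⁻¹ ≤ N a := by
    intro a
    obtain ⟨w, h1, h2, h3⟩ := hN'.1 (le_refl (N a))
    refine hN'.2 ⟨(w.map fun s => s⁻¹).reverse, ?_, by simpa using h2, ?_⟩
    · simp only [List.mem_reverse, List.mem_map]
      rintro t ⟨s, hs, rfl⟩
      exact hinv s (h1 s hs)
    · rw [← h3, List.prod_inv_reverse]
  have hmul : ∀ a b, N (a * b) ≤ N a + N b := by
    intro a b
    obtain ⟨w, h1, h2, h3⟩ := hN'.1 (le_refl (N a))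
    obtain ⟨w', h1', h2', h3'⟩ := hN'.1 (le_refl (N b))
    refine hN'.2 ⟨w ++ w', ?_, by simp; omega, by simp [h3, h3']⟩
    simp only [List.mem_append]
    rintro t (ht | ht)
    exacts [h1 t ht, h1' t ht]
  have hS : ∀ s ∈ S, N s ≤ 1 := fun s hs => hN'.2 ⟨[s], by simpa using hs, by simp, by simp⟩
  refine ⟨bl, N, hbl, ?_, fun {n h} => hN n h, fun {s} => hinv s, ?_, fun {h} h0 => ?_,
    fun {h n} h0 => ?_, hmul, fun a => (hinvle a).antisymm (by simpa using hinvle a⁻¹), fun {s} => hS s⟩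
  · refine (computable_find (p := fun h n => h ∈ bl n) (by fun_prop) hex).of_eq fun h => ?_
    congr
  · exact Nat.le_zero.1 (hN'.2 ⟨[], by simp, by simp, rfl⟩)
  · obtain ⟨w, -, h2, rfl⟩ := hN'.1 h0.le
    rw [List.length_eq_zero_iff.1 (Nat.le_zero.1 h2), List.prod_nil]
  · obtain ⟨w, h1, h2, rfl⟩ := hN'.1 h0.le
    induction w using List.reverseRecOn with
    | nil =>
      have : N 1 ≤ 0 := hN'.2 ⟨[], by simp, by simp, rfl⟩
      simp at h0
      omega
    | append_singleton w s =>
      have hs := h1 s (by simp)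
      refine ⟨s⁻¹, hinv s hs, ?_⟩
      have hw : N w.prod ≤ n :=
        hN'.2 ⟨w, fun t ht => h1 t (by simp [ht]), by simpa using h2, rfl⟩
      have := hmul w.prod s
      have := hS s hs
      simp only [List.prod_append, List.prod_singleton, mul_inv_cancel_right] at h0 ⊢
      omega

namespace IsLength
variable {S : List H} {bl : ℕ → List H} {N : H → ℕ} (hN : IsLength S bl N)
include hN

theorem finite_le (n : ℕ) : {h | N h ≤ n}.Finite :=
  (bl n).finite_toSet.subset fun _ hh => hN.mem_ball.2 hh

theorem exists_gt {U : Set H} (hU : U.Infinite) (n : ℕ) : ∃ h ∈ U, n < N h := by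
  by_contra! hc
  exact hU ((hN.finite_le n).subset hc)

theorem le_mul (a b : H) : N a ≤ N (a * b) + N b := by
  have := hN.mul_le (a * b) b⁻¹
  rwa [mul_inv_cancel_right, hN.inv] at this

/-- Induction along geodesics to the identity. -/
theorem induction {P : H → Prop} (h1 : P 1)
    (hs : ∀ h, ∀ s ∈ S, N h = N (h * s) + 1 → P (h * s) → P h) (h : H) : P h := by
  generalize hn : N h = n
  induction n generalizing h with
  | zero => rwa [hN.eq_one hn]
  | succ n ih =>
    obtain ⟨s, hs', hn'⟩ := hN.step hn
    exact hs h s hs' (by omega) (ih _ hn')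

end IsLength
end

/-! ### Computable proper walks -/

/-- The group carries a computable walk with finitely many steps that leaves every point at a
computable time. -/
def HasProperWalk (H : Type*) [Group H] [Denumerable H] : Prop :=
  ∃ (r : ℕ → H) (β : H → ℕ) (T : List H), Computable r ∧ Computable β ∧
    (∀ n, (r n)⁻¹ * r (n + 1) ∈ T) ∧ ∀ n, n ≤ β (r n)

section
variable {H : Type*} [Group H] [Denumerable H] {S : List H} {bl : ℕ → List H} {N : H → ℕ}

/-- No edge with an endpoint outside the ball of radius `m` crosses the boundary of `U`. -/
def AlmostInv (S : List H) (N : H → ℕ) (m : ℕ) (U : Set H) : Prop :=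
  ∀ x, m < N x → ∀ s ∈ S, (x ∈ U ↔ x * s ∈ U)

omit [Denumerable H] in
theorem AlmostInv.compl {m : ℕ} {U : Set H} (h : AlmostInv S N m U) : AlmostInv S N m Uᶜ :=
  fun x hx s hs => not_congr (h x hx s hs)

namespace IsLength
variable (hN : IsLength S bl N)
include hN

theorem translate_ball {m : ℕ} {U : Set H} (hU : AlmostInv S N m U) {a : H} (ha : 2 * m < N a)
    {b : H} (hb : N b ≤ m) : a * b ∈ U ↔ a ∈ U := by
  induction b using hN.induction with
  | h1 => rw [mul_one]
  | hs b s hs h ih =>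
    rw [← ih (by omega), ← mul_assoc]
    exact hU _ (by have := hN.le_mul a b; omega) s hs

theorem translate_subset {m : ℕ} {U V : Set H} (hU : AlmostInv S N m U) (hV : AlmostInv S N m V)
    {g : H} (hg : 2 * m < N g) (hgU : g ∈ U) (hgV : g⁻¹ ∉ V) {x : H} (hx : x ∈ V) : g * x ∈ U := by
  induction x using hN.induction with
  | h1 => rwa [mul_one]
  | hs x s hs h ih =>
    by_cases hxm : N x ≤ m
    · exact (hN.translate_ball hU hg hxm).2 hgU
    · refine (hU _ ?_ s hs).2 (by rw [mul_assoc]; exact ih ((hV x (by omega) s hs).1 hx))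
      by_contra! hc
      have := (hN.translate_ball hV (a := g⁻¹) (by rwa [hN.inv]) hc).1 (by simpa using hx)
      exact hgV this

theorem hasProperWalk_of_contraction [CGroup H] {m : ℕ} {U : Set H} (hU : AlmostInv S N m U)
    {f : H} (h1 : ∀ x ∈ U, f * x ∈ U) (h2 : f ∈ U) (h3 : ∀ b, N b ≤ m → f⁻¹ * b ∉ U) :
    HasProperWalk H := by
  have key : ∀ x n, (f ^ n)⁻¹ * x ∈ U → n ≤ N x := by
    intro x
    induction x using hN.induction with
    | h1 =>
      intro n hn
      rcases n with _ | n
      · exact Nat.zero_le _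
      · exfalso
        refine h3 1 (by rw [hN.one]; omega) ?_
        induction n with
        | zero => simpa using hn
        | succ n ih =>
          refine ih ?_
          have := h1 _ hn
          rw [mul_one] at this ⊢
          rwa [pow_succ f (n + 1), mul_inv_rev, mul_inv_cancel_left] at this
    | hs x s hs h ih =>
      intro n hn
      rcases n with _ | n
      · exact Nat.zero_le _
      · have hfu := h1 _ hn
        have he : f * ((f ^ (n + 1))⁻¹ * x) = (f ^ n)⁻¹ * x := by
          rw [pow_succ, mul_inv_rev]
          group
        rw [he] at hfu
        have := ih n <| by
          rw [← mul_assoc]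
          refine (hU _ ?_ s hs).1 hfu
          by_contra! hc
          refine h3 _ hc ?_
          rwa [← he, inv_mul_cancel_left]
        omega
  have hN' := hN.computable
  refine ⟨fun n => f ^ n, fun x => N x + 1, [f], ?_, by fun_prop, fun n => ?_, fun n => ?_⟩
  · have h : Computable fun q : ℕ × H => q.2 * f := by fun_prop
    refine (C_iterate (h := fun (_ : ℕ) x => x * f) C_id (C_const 1) h).of_eq fun n => ?_
    induction n with
    | zero => simp
    | succ n ih => rw [Function.iterate_succ_apply', ih, pow_succ]
  · simp [pow_succ]
  · rcases n with _ | n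
    · exact Nat.zero_le _
    · exact Nat.succ_le_succ (key _ n (by simpa [pow_succ] using h2))

theorem hasProperWalk_of_ends [CGroup H] {m : ℕ} {U : Set H} (hU : AlmostInv S N m U)
    (h1 : U.Infinite) (h2 : Uᶜ.Infinite) : HasProperWalk H := by
  obtain ⟨g, hgU, hg⟩ := hN.exists_gt h1 (2 * m)
  obtain ⟨h, hhU, hh⟩ := hN.exists_gt h2 (2 * m)
  have hg' : 2 * m < N g⁻¹ := by rwa [hN.inv]
  have hh' : 2 * m < N h⁻¹ := by rwa [hN.inv]
  by_cases hgi : g⁻¹ ∈ U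
  · by_cases hhi : h⁻¹ ∈ U
    · exact hN.hasProperWalk_of_contraction hU.compl
        (fun x hx => hN.translate_subset hU.compl hU.compl hh hhU (by simpa using hhi) hx) hhU
        fun b hb => by simpa using (hN.translate_ball hU hh' hb).2 hhi
    · have hgc : ∀ x ∈ Uᶜ, g * x ∈ U := fun x hx =>
        hN.translate_subset hU hU.compl hg hgU (by simpa using hgi) hx
      have hhc : ∀ x ∈ U, h * x ∈ Uᶜ := fun x hx =>
        hN.translate_subset hU.compl hU hh hhU hhi hx
      refine hN.hasProperWalk_of_contraction hU (f := g * h)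
        (fun x hx => by rw [mul_assoc]; exact hgc _ (hhc x hx)) (hgc _ hhU) fun b hb hc => ?_
      have := hhc _ hc
      rw [mul_inv_rev, mul_assoc, mul_inv_cancel_left] at this
      exact this ((hN.translate_ball hU hg' hb).2 hgi)
  · exact hN.hasProperWalk_of_contraction hU
      (fun x hx => hN.translate_subset hU hU hg hgU hgi hx) hgU
      fun b hb hc => hgi ((hN.translate_ball hU hg' hb).1 hc)

end IsLength

/-- Connectedness outside the ball of radius `n`. -/
def Conn (S : List H) (N : H → ℕ) (n : ℕ) : H → H → Prop :=
  Relation.ReflTransGen fun a b => n < N a ∧ n < N b ∧ a⁻¹ * b ∈ S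

omit [Denumerable H] in
theorem Conn.mono {n m : ℕ} (h : n ≤ m) {x y : H} (hc : Conn S N m x y) : Conn S N n x y :=
  Relation.ReflTransGen.mono (fun _ _ ⟨h1, h2, h3⟩ => ⟨by omega, by omega, h3⟩) _ _ hc

namespace IsLength
variable (hN : IsLength S bl N)
include hN

theorem conn_symm {n : ℕ} {x y : H} (h : Conn S N n x y) : Conn S N n y x := by
  induction h with
  | refl => exact .refl
  | tail _ h ih => exact .head ⟨h.2.1, h.1, by simpa using hN.inv_mem h.2.2⟩ ih

theorem exists_conn_sphere {n : ℕ} {x : H} (hx : n < N x) : ∃ y, N y = n + 1 ∧ Conn S N n x y := by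
  induction x using hN.induction with
  | h1 => rw [hN.one] at hx; omega
  | hs x s hs h ih =>
    by_cases hn : N x = n + 1
    · exact ⟨x, hn, .refl⟩
    · obtain ⟨y, hy, hc⟩ := ih (by omega)
      exact ⟨y, hy, .head ⟨hx, by omega, by simpa using hs⟩ hc⟩

theorem almostInv_conn (n : ℕ) (x : H) : AlmostInv S N (n + 1) {y | Conn S N n x y} := by
  intro y hy s hs
  have h1 : n < N (y * s) := by
    have := hN.le_mul y s
    have := hN.le_one hs
    omega
  constructor
  · exact fun h => .tail h ⟨by omega, h1, by simpa using hs⟩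
  · exact fun h => .tail h ⟨h1, by omega, by simpa using hN.inv_mem hs⟩

theorem exists_radius [Infinite H]
    (h1 : ∀ m U, AlmostInv S N m U → U.Infinite → Uᶜ.Finite) (n : ℕ) :
    ∃ M, n ≤ M ∧ ∀ x y, M < N x → M < N y → Conn S N n x y := by
  obtain ⟨y, hy⟩ : ∃ y, {x | Conn S N n y x}.Infinite := by
    by_contra! hc
    have hfin : (⋃ y ∈ {y | N y ≤ n + 1}, {x | Conn S N n y x}).Finite :=
      (hN.finite_le (n + 1)).biUnion fun y _ => hc y
    refine Set.infinite_univ ((hfin.union (hN.finite_le n)).subset fun x _ => ?_)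
    by_cases hx : N x ≤ n
    · exact .inr hx
    · obtain ⟨y, hy, hxy⟩ := hN.exists_conn_sphere (Nat.lt_of_not_le hx)
      exact .inl (Set.mem_biUnion (show N y ≤ n + 1 from hy.le) (hN.conn_symm hxy))
  obtain ⟨M, hM⟩ := ((h1 _ _ (hN.almostInv_conn n y) hy).image N).bddAbove
  have hM' : ∀ x, M < N x → Conn S N n y x := fun x hx => by
    by_contra hc
    have := hM ⟨x, hc, rfl⟩
    omega
  exact ⟨max n M, le_max_left _ _, fun x x' hx hx' =>
    (hN.conn_symm (hM' x ((le_max_right _ _).trans_lt hx))).trans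
      (hM' x' ((le_max_right _ _).trans_lt hx'))⟩

end IsLength
end

section Lists
variable {α : Type*}

/-- The list is a path from `x` to `y` with steps in `A` through points satisfying `Q`. -/
def IsPath (A : α → α → Prop) (Q : α → Prop) (x y : α) (l : List α) : Prop :=
  l.head? = some x ∧ l.getLast? = some y ∧ (∀ a ∈ l, Q a) ∧ l.IsChain A

theorem exists_isPath {A : α → α → Prop} {Q : α → Prop} {x y : α} (hx : Q x)
    (h : Relation.ReflTransGen (fun a b => Q a ∧ Q b ∧ A a b) x y) : ∃ l, IsPath A Q x y l := by
  induction h with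
  | refl => exact ⟨[x], rfl, rfl, by simpa using hx, .singleton _⟩
  | @tail b c _ h ih =>
    obtain ⟨l, h1, h2, h3, h4⟩ := ih
    refine ⟨l ++ [c], by simp [List.head?_append, h1], by simp, ?_, ?_⟩
    · simp only [List.mem_append, List.mem_singleton]
      rintro a (ha | rfl)
      exacts [h3 a ha, h.2.1]
    · refine List.isChain_append.2 ⟨h4, .singleton _, ?_⟩
      simp only [h2, Option.mem_def, Option.some.injEq, List.head?_cons]
      rintro _ rfl _ rfl
      exact h.2.2

theorem IsPath.reflTransGen {A : α → α → Prop} {Q : α → Prop} {x y : α} {l : List α}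
    (h : IsPath A Q x y l) : Relation.ReflTransGen (fun a b => Q a ∧ Q b ∧ A a b) x y := by
  induction l generalizing x with
  | nil => simp [IsPath] at h
  | cons a l ih =>
    obtain ⟨h1, h2, h3, h4⟩ := h
    obtain rfl : a = x := by simpa using h1
    cases l with
    | nil =>
      obtain rfl : a = y := by simpa using h2
      exact .refl
    | cons b l =>
      rw [List.isChain_cons_cons] at h4
      exact .head ⟨h3 _ (by simp), h3 _ (by simp), h4.1⟩
        (ih ⟨rfl, by simpa using h2, fun c hc => h3 c (List.mem_cons_of_mem _ hc), h4.2⟩)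

theorem isChain_iff_getD {A : α → α → Prop} (d : α) {l : List α} :
    l.IsChain A ↔ ∀ i < l.length - 1, A (l[i]?.getD d) (l[i + 1]?.getD d) := by
  rw [List.isChain_iff_getElem]
  refine ⟨fun h i hi => ?_, fun h i hi => ?_⟩
  · rw [List.getElem?_eq_getElem (by omega), List.getElem?_eq_getElem (by omega)]
    exact h i (by omega)
  · have := h i (by omega)
    rwa [List.getElem?_eq_getElem (by omega), List.getElem?_eq_getElem (by omega)] at this

theorem C_comp₂ {β γ δ : Type*} [Primcodable α] [Primcodable β] [Primcodable γ] [Primcodable δ]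
    {f : β → γ → δ} {g : α → β} {h : α → γ} (hf : Computable fun q : β × γ => f q.1 q.2)
    (hg : Computable g) (hh : Computable h) : Computable fun a => f (g a) (h a) :=
  hf.comp (hg.pair hh)

theorem computable_isPath {γ : Type*} [Primcodable γ] [Primcodable α] (d : α) {A : α → α → Prop}
    {N : α → ℕ} (hN : Computable N) (hA : Computable fun q : α × α => dec (A q.1 q.2))
    {n : γ → ℕ} {x y : γ → α} {l : γ → List α} (hn : Computable n) (hx : Computable x)
    (hy : Computable y) (hl : Computable l) :
    Computable fun q => dec (IsPath A (fun a => n q < N a) (x q) (y q) (l q)) := by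
  have hA' : Computable fun q : γ × ℕ =>
      dec (A ((l q.1)[q.2]?.getD d) ((l q.1)[q.2 + 1]?.getD d)) :=
    C_comp₂ (f := fun a b => dec (A a b)) hA
      (C_optionGetD (C_getElem? (hl.comp Computable.fst) Computable.snd) (C_const d))
      (C_optionGetD (C_getElem? (hl.comp Computable.fst) (Computable.succ.comp Computable.snd))
        (C_const d))
  have h1 : Computable fun q => dec ((l q).head? = some (x q)) := by fun_prop
  have h2 : Computable fun q => dec ((l q).reverse.head? = some (y q)) := by fun_prop
  have h3 : Computable fun q => dec (∀ a ∈ l q, n q < N a) := by fun_prop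
  have h4 : Computable fun q => dec (∀ i < (l q).length - 1,
      A ((l q)[i]?.getD d) ((l q)[i + 1]?.getD d)) := C_dec_forall_lt (by fun_prop) hA'
  refine (C_dec_and h1 (C_dec_and h2 (C_dec_and h3 h4))).of_eq fun q => ?_
  rw [Bool.eq_iff_iff, dec_eq_true, dec_eq_true, IsPath, isChain_iff_getD d, List.head?_reverse]

theorem computable_exists_isPath {γ : Type*} [Primcodable γ] [Primcodable α] (d : α)
    {A : α → α → Prop} {N : α → ℕ} (hN : Computable N)
    (hA : Computable fun q : α × α => dec (A q.1 q.2)) {n m : γ → ℕ} {u : γ → List α}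
    {L : γ → List (List α)} (hn : Computable n) (hm : Computable m) (hu : Computable u)
    (hL : Computable L) :
    Computable fun q => dec (∀ x ∈ u q, ∀ y ∈ u q, m q < N x → m q < N y →
      ∃ l ∈ L q, IsPath A (fun a => n q < N a) x y l) := by
  have hf : Computable fun q : (γ × α) × α => q.1.1 := Computable.fst.comp Computable.fst
  have hx : Computable fun q : (γ × α) × α => q.1.2 := Computable.snd.comp Computable.fst
  have h1 : Computable fun q : (γ × α) × α =>
      dec (∃ l ∈ L q.1.1, IsPath A (fun a => n q.1.1 < N a) q.1.2 q.2 l) :=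
    C_dec_exists_mem (hL.comp hf) (computable_isPath d hN hA
      ((hn.comp hf).comp Computable.fst) (hx.comp Computable.fst)
      (Computable.snd.comp Computable.fst) Computable.snd)
  have h2 : Computable fun q : (γ × α) × α => dec (m q.1.1 < N q.1.2) :=
    C_dec_lt (hm.comp hf) (hN.comp hx)
  have h3 : Computable fun q : (γ × α) × α => dec (m q.1.1 < N q.2) :=
    C_dec_lt (hm.comp hf) (hN.comp Computable.snd)
  exact C_dec_forall_mem hu (C_dec_forall_mem (hu.comp Computable.fst)
    (C_dec_imp h2 (C_dec_imp h3 h1)))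

/-- The point of a concatenation of paths at a given time. -/
def concat (d : α) (P : ℕ → List α) (i : ℕ) : α := ((List.range (i + 1)).flatMap P)[i]?.getD d

variable {d : α} {P : ℕ → List α}

theorem getElem?_flatMap_range {n m i : ℕ} (h : n ≤ m) (hi : i < ((List.range n).flatMap P).length) :
    ((List.range m).flatMap P)[i]? = ((List.range n).flatMap P)[i]? := by
  obtain ⟨k, rfl⟩ := Nat.exists_eq_add_of_le h
  rw [List.range_add, List.flatMap_append, List.getElem?_append_left hi]

theorem le_length_flatMap_range (hP : ∀ n, P n ≠ []) (n : ℕ) :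
    n ≤ ((List.range n).flatMap P).length := by
  induction n with
  | zero => simp
  | succ n ih =>
    have := List.length_pos_iff.2 (hP n)
    rw [List.range_succ, List.flatMap_append, List.length_append, List.flatMap_singleton]
    omega

theorem concat_eq (hP : ∀ n, P n ≠ []) {i n : ℕ} (hi : i < ((List.range n).flatMap P).length) :
    concat d P i = ((List.range n).flatMap P)[i] := by
  have h := le_length_flatMap_range hP (i + 1)
  rw [concat, ← getElem?_flatMap_range (le_max_left (i + 1) n) (by omega),
    getElem?_flatMap_range (le_max_right (i + 1) n) hi, List.getElem?_eq_getElem hi,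
    Option.getD_some]

theorem concat_chain {A : α → α → Prop} {p : ℕ → α} (hA : ∀ a, A a a)
    (hP : ∀ n, ∃ Q, IsPath A Q (p n) (p (n + 1)) (P n)) (i : ℕ) :
    A (concat d P i) (concat d P (i + 1)) := by
  have hne : ∀ n, P n ≠ [] := fun n h => by
    obtain ⟨Q, h1, -⟩ := hP n
    simp [h] at h1
  have hc : ∀ n, ((List.range (n + 1)).flatMap P).IsChain A ∧
      ((List.range (n + 1)).flatMap P).getLast? = some (p (n + 1)) := by
    intro n
    induction n with
    | zero =>
      obtain ⟨Q, h1, h2, h3, h4⟩ := hP 0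
      simpa using ⟨h4, h2⟩
    | succ n ih =>
      obtain ⟨Q, h1, h2, h3, h4⟩ := hP (n + 1)
      rw [List.range_succ, List.flatMap_append, List.flatMap_singleton]
      refine ⟨List.isChain_append.2 ⟨ih.1, h4, ?_⟩, ?_⟩
      · simp only [ih.2, h1, Option.mem_def, Option.some.injEq]
        rintro _ rfl _ rfl
        exact hA _
      · rw [List.getLast?_append, h2, Option.some_or]
  have hl := le_length_flatMap_range hne (i + 1 + 1)
  rw [concat_eq hne (n := i + 1 + 1) (by omega), concat_eq hne (n := i + 1 + 1) (by omega)]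
  exact List.isChain_iff_getElem.1 (hc (i + 1)).1 i (by omega)

theorem concat_late (hP : ∀ n, P n ≠ []) {i n : ℕ}
    (hi : ((List.range n).flatMap P).length ≤ i) : ∃ m, n ≤ m ∧ concat d P i ∈ P m := by
  have hl := le_length_flatMap_range hP (i + 1)
  obtain ⟨k, hk⟩ : ∃ k, i + 1 = n + k := Nat.exists_eq_add_of_le (by
    have := le_length_flatMap_range hP n
    omega)
  have h : concat d P i ∈ (List.range' n k).flatMap P := by
    have hs : (List.range (i + 1)).flatMap P =
        (List.range n).flatMap P ++ (List.range' n k).flatMap P := by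
      rw [← List.flatMap_append, hk, List.range_eq_range', List.range_eq_range',
        ← List.range'_append_1, Nat.zero_add]
    have hlt : i - ((List.range n).flatMap P).length < ((List.range' n k).flatMap P).length := by
      rw [hs, List.length_append] at hl
      omega
    rw [concat, hs, List.getElem?_append_right hi, List.getElem?_eq_getElem hlt, Option.getD_some]
    exact List.getElem_mem _
  obtain ⟨m, hm, h⟩ := List.mem_flatMap.1 h
  exact ⟨m, (List.mem_range'_1.1 hm).1, h⟩

end Lists

section
variable {H : Type*} [Group H] [Denumerable H] [CGroup H] {S : List H} {bl : ℕ → List H}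
  {N : H → ℕ}

theorem IsLength.hasProperWalk_of_oneEnded [Infinite H] (hN : IsLength S bl N)
    (h1 : ∀ m U, AlmostInv S N m U → U.Infinite → Uᶜ.Finite) : HasProperWalk H := by
  let A : H → H → Prop := fun a b => a⁻¹ * b ∈ 1 :: S
  have hA : Computable fun q : H × H => dec (A q.1 q.2) :=
    C_dec_mem (C_const _) (by fun_prop)
  have hcN := hN.computable
  have hbl := hN.computable_ball
  have hconn : ∀ {n x y}, n < N x → Conn S N n x y → ∃ l, IsPath A (fun a => n < N a) x y l :=
    fun hx h => exists_isPath hx (Relation.ReflTransGen.mono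
      (fun _ _ ⟨h1, h2, h3⟩ => ⟨h1, h2, List.mem_cons_of_mem _ h3⟩) _ _ h)
  have hconn' : ∀ {n x y l}, IsPath A (fun a => n < N a) x y l → Conn S N n x y := by
    intro n x y l h
    have := IsPath.reflTransGen h
    clear h
    induction this with
    | refl => exact .refl
    | tail _ h ih =>
      rcases List.mem_cons.1 h.2.2 with h' | h'
      · rwa [← inv_mul_eq_one.1 h']
      · exact ih.tail ⟨h.1, h.2.1, h'⟩
  obtain ⟨E, hE, hE'⟩ : ∃ E : ℕ → ℕ × List (List H), Computable E ∧ ∀ n, n ≤ (E n).1 ∧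
      ∀ x ∈ bl ((E n).1 + 1), ∀ y ∈ bl ((E n).1 + 1), (E n).1 < N x → (E n).1 < N y →
        ∃ l ∈ (E n).2, IsPath A (fun a => n < N a) x y l := by
    refine exists_computable_selector (p := fun n (e : ℕ × List (List H)) => n ≤ e.1 ∧
      ∀ x ∈ bl (e.1 + 1), ∀ y ∈ bl (e.1 + 1), e.1 < N x → e.1 < N y →
        ∃ l ∈ e.2, IsPath A (fun a => n < N a) x y l) ?_ fun n => ?_
    · have hm : Computable fun q : ℕ × (ℕ × List (List H)) => q.2.1 :=
        Computable.fst.comp Computable.snd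
      exact C_dec_and (C_dec_le Computable.fst hm) (computable_exists_isPath 1 hcN hA
        Computable.fst hm (hbl.comp (Computable.succ.comp hm))
        (Computable.snd.comp Computable.snd))
    · obtain ⟨M, hM, hc⟩ := hN.exists_radius h1 n
      have : ∀ x y, ∃ l, M < N x → M < N y → IsPath A (fun a => n < N a) x y l := fun x y => by
        by_cases h : M < N x ∧ M < N y
        · obtain ⟨l, hl⟩ := hconn (hM.trans_lt h.1) (hc x y h.1 h.2)
          exact ⟨l, fun _ _ => hl⟩
        · exact ⟨[], fun h1 h2 => (h ⟨h1, h2⟩).elim⟩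
      choose f hf using this
      refine ⟨(M, (bl (M + 1)).flatMap fun x => (bl (M + 1)).map (f x)), hM,
        fun x hx y hy h1 h2 => ⟨f x y, ?_, hf x y h1 h2⟩⟩
      exact List.mem_flatMap.2 ⟨x, hx, List.mem_map.2 ⟨y, hy, rfl⟩⟩
  have hEc : ∀ n x y, (E n).1 < N x → (E n).1 < N y → Conn S N n x y := by
    intro n x y hx hy
    obtain ⟨h1, h2⟩ := hE' n
    obtain ⟨x', hx', hxx⟩ := hN.exists_conn_sphere hx
    obtain ⟨y', hy', hyy⟩ := hN.exists_conn_sphere hy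
    obtain ⟨l, -, hl⟩ := h2 x' (hN.mem_ball.2 hx'.le) y' (hN.mem_ball.2 hy'.le) (by omega) (by omega)
    exact ((hxx.mono h1).trans (hconn' hl)).trans (hN.conn_symm (hyy.mono h1))
  obtain ⟨p, hp, hp'⟩ : ∃ p : ℕ → H, Computable p ∧ ∀ n, ∀ i < n + 1, (E i).1 < N (p n) := by
    let _ : Inhabited H := ⟨1⟩
    refine exists_computable_selector (p := fun n h => ∀ i < n + 1, (E i).1 < N h) ?_ fun n => ?_
    · refine C_dec_forall_lt (by fun_prop) (C_dec_lt ?_ ?_)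
      · exact (Computable.fst.comp hE).comp (Computable.snd)
      · exact hcN.comp (Computable.snd.comp Computable.fst)
    · obtain ⟨h, -, hh⟩ := hN.exists_gt Set.infinite_univ (∑ i ∈ Finset.range (n + 1), (E i).1)
      refine ⟨h, fun i hi => lt_of_le_of_lt ?_ hh⟩
      exact Finset.single_le_sum (f := fun i => (E i).1) (by simp) (Finset.mem_range.2 hi)
  obtain ⟨P, hP, hP'⟩ : ∃ P : ℕ → List H, Computable P ∧
      ∀ n, IsPath A (fun a => n < N a) (p n) (p (n + 1)) (P n) := by
    refine exists_computable_selector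
      (p := fun n l => IsPath A (fun a => n < N a) (p n) (p (n + 1)) l) ?_ fun n => ?_
    · exact computable_isPath 1 hcN hA Computable.fst (hp.comp Computable.fst)
        (hp.comp (Computable.succ.comp Computable.fst)) Computable.snd
    · have h1 := hp' n n (by omega)
      exact hconn ((hE' n).1.trans_lt h1) (hEc n _ _ h1 (hp' (n + 1) n (by omega)))
  have hne : ∀ n, P n ≠ [] := fun n h => by
    have h1 := (hP' n).1
    simp [h] at h1
  have hF : Computable fun n : ℕ => (List.range n).flatMap P :=
    C_flatMap (by fun_prop) (hP.comp Computable.snd)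
  refine ⟨concat 1 P, fun h => ((List.range (N h)).flatMap P).length, 1 :: S, ?_, ?_, ?_, ?_⟩
  · have : Computable fun i : ℕ => (List.range (i + 1)).flatMap P := hF.comp (by fun_prop)
    exact C_optionGetD (C_getElem? this C_id) (C_const 1)
  · exact C_length (hF.comp hcN)
  · exact concat_chain (A := A) (fun a => by simp [A]) fun n => ⟨_, hP' n⟩
  · intro i
    by_contra! hc
    obtain ⟨m, hm, h⟩ := concat_late (d := (1 : H)) hne hc.le
    have := (hP' m).2.2.1 _ h
    omega

end

/-! ### A computable height function -/

theorem exists_last {α : Type*} [Denumerable α] {r : ℕ → α} {β : α → ℕ} (hr : Computable r) (hβ : Computable β)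
    (h : ∀ n, n ≤ β (r n)) : ∃ u : ℕ → ℕ, Computable u ∧
      ∀ n, n ≤ u n ∧ r (u n) = r n ∧ ∀ k, u n < k → r k ≠ r n := by
  have hd : Computable fun q : (ℕ × ℕ) × ℕ => dec (r q.2 = r q.1.1) :=
    C_dec_eq (hr.comp Computable.snd) (hr.comp (Computable.fst.comp Computable.fst))
  have hd' : Computable fun q : (ℕ × ℕ) × ℕ => dec (q.1.2 < q.2) :=
    C_dec_lt (Computable.snd.comp Computable.fst) Computable.snd
  obtain ⟨u, hu, hu'⟩ := exists_computable_selector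
    (p := fun n m => r m = r n ∧ ∀ k < β (r n) + 1, m < k → ¬ r k = r n)
    (C_dec_and (C_dec_eq (hr.comp Computable.snd) (hr.comp Computable.fst))
      (C_dec_forall_lt (Computable.succ.comp (hβ.comp (hr.comp Computable.fst)))
        (C_dec_imp hd' (C_dec_not hd)))) fun n => by
      classical
      let m := Nat.findGreatest (fun m => r m = r n) (β (r n))
      exact ⟨m, Nat.findGreatest_spec (P := fun m => r m = r n) (h n) rfl,
        fun k hk hmk => Nat.findGreatest_is_greatest hmk (Nat.lt_succ_iff.1 hk)⟩
  have hlast : ∀ n k, u n < k → r k ≠ r n := fun n k hk hkn =>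
    (hu' n).2 k (Nat.lt_succ_iff.2 (hkn ▸ h k)) hk hkn
  exact ⟨u, hu, fun n => ⟨not_lt.1 fun hn => hlast n n hn rfl, (hu' n).1, hlast n⟩⟩

section
variable {H : Type*} [Group H] [Denumerable H] [CGroup H]

omit [CGroup H] in
/-- Erasing loops from a proper walk makes it injective. -/
theorem HasProperWalk.exists_injective (h : HasProperWalk H) :
    ∃ (r : ℕ → H) (β : H → ℕ) (T : List H), Computable r ∧ Computable β ∧
      (∀ n, (r n)⁻¹ * r (n + 1) ∈ T) ∧ (∀ n, n ≤ β (r n)) ∧ Function.Injective r := by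
  obtain ⟨r, β, T, hr, hβ, hT, hb⟩ := h
  obtain ⟨u, hu, hu'⟩ := exists_last hr hβ hb
  let v : ℕ → ℕ := fun n => Nat.rec (motive := fun _ => ℕ) (u 0) (fun _ i => u (i + 1)) n
  have hv : Computable v := C_natRec C_id (C_const _)
    (hu.comp (Computable.succ.comp (Computable.snd.comp Computable.snd)))
  have hsucc : ∀ n, v (n + 1) = u (v n + 1) := fun _ => rfl
  have hlast : ∀ n k, v n < k → r k ≠ r (v n) := by
    rintro (_ | n) k hk
    · exact (hu' 0).2.1 ▸ (hu' 0).2.2 k hk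
    · rw [hsucc] at hk ⊢
      rw [(hu' (v n + 1)).2.1]
      exact (hu' _).2.2 k hk
  have hmono : StrictMono v := strictMono_nat_of_lt_succ fun n => (hu' (v n + 1)).1
  refine ⟨fun n => r (v n), β, T, hr.comp hv, hβ, fun n => ?_,
    fun n => (hmono.le_apply).trans (hb _), fun a b hab => ?_⟩
  · have := hT (v n)
    rwa [← (hu' (v n + 1)).2.1] at this
  · by_contra hne
    rcases lt_or_gt_of_ne hne with h | h
    · exact hlast a _ (hmono h) hab.symm
    · exact hlast b _ (hmono h) hab

/-- The difference `v - d` is a function to the integers all of whose values have a neighbour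
above them. -/
theorem HasProperWalk.exists_height (h : HasProperWalk H) {S : List H} {bl : ℕ → List H}
    {N : H → ℕ} (hN : IsLength S bl N) :
    ∃ (d v : H → ℕ) (T : List H), Computable d ∧ Computable v ∧
      ∀ h, ∃ s ∈ T, v (h * s) + d h = v h + d (h * s) + 1 := by
  classical
  obtain ⟨r, β, T, hr, hβ, hT, hb, hinj⟩ := h.exists_injective
  have hcN := hN.computable
  have hex : ∀ h, ∃ n, ∃ i, N (h⁻¹ * r i) ≤ n := fun h => ⟨_, 0, le_rfl⟩
  have hdec : ∀ h n, (∃ i, N (h⁻¹ * r i) ≤ n) ↔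
      ∃ g ∈ bl n, ∃ i < β (h * g) + 1, r i = h * g := by
    refine fun h n => ⟨fun ⟨i, hi⟩ => ⟨h⁻¹ * r i, hN.mem_ball.2 hi, i, ?_, by group⟩, ?_⟩
    · rw [mul_inv_cancel_left]
      exact Nat.lt_succ_iff.2 (hb i)
    · rintro ⟨g, hg, i, -, hi⟩
      exact ⟨i, by rw [hi, inv_mul_cancel_left]; exact hN.mem_ball.1 hg⟩
  have hc : Computable fun q : H × ℕ => dec (∃ i, N (q.1⁻¹ * r i) ≤ q.2) := by
    have h1 : Computable fun q : (H × ℕ) × H => q.1.1 * q.2 :=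
      C_gmul (Computable.fst.comp Computable.fst) Computable.snd
    have h2 : Computable fun q : H × ℕ =>
        dec (∃ g ∈ bl q.2, ∃ i < β (q.1 * g) + 1, r i = q.1 * g) :=
      C_dec_exists_mem (hN.computable_ball.comp Computable.snd) (C_dec_exists_lt
        (Computable.succ.comp (hβ.comp h1))
        (C_dec_eq (hr.comp Computable.snd) (h1.comp Computable.fst)))
    refine h2.of_eq fun q => ?_
    rw [Bool.eq_iff_iff, dec_eq_true, dec_eq_true, hdec]
  let d : H → ℕ := fun h => Nat.find (hex h)
  have hd : ∀ h, ∃ i, N (h⁻¹ * r i) ≤ d h := fun h => Nat.find_spec (hex h)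
  have hdle : ∀ {h n i}, N (h⁻¹ * r i) ≤ n → d h ≤ n := fun hi => Nat.find_min' _ ⟨_, hi⟩
  have hcd : Computable d := computable_find hc hex
  let v : H → ℕ := fun h => Nat.find (hd h)
  have hv : ∀ h, N (h⁻¹ * r (v h)) ≤ d h := fun h => Nat.find_spec (hd h)
  have hvle : ∀ {h i}, N (h⁻¹ * r i) ≤ d h → v h ≤ i := fun hi => Nat.find_min' _ hi
  have hcv : Computable v := by
    refine (computable_find (p := fun h i => N (h⁻¹ * r i) ≤ d h) ?_ hd).of_eq fun h => by
      simp only [v]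
      congr
    exact C_dec_le (hcN.comp (C_gmul (C_ginv Computable.fst) (hr.comp Computable.snd)))
      (hcd.comp Computable.fst)
  refine ⟨d, v, T ++ S, hcd, hcv, fun h => ?_⟩
  have h0 : ∀ i, d (r i) = 0 ∧ v (r i) = i := fun i => by
    have h1 : d (r i) = 0 := Nat.le_zero.1 (hdle (i := i) (by rw [inv_mul_cancel, hN.one]))
    refine ⟨h1, hinj ?_⟩
    have h2 := hv (r i)
    rw [h1] at h2
    exact (inv_mul_eq_one.1 (hN.eq_one (Nat.le_zero.1 h2))).symm
  rcases hdh : d h with _ | n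
  · have h2 := hv h
    rw [hdh] at h2
    obtain ⟨i, rfl⟩ : ∃ i, h = r i := ⟨_, inv_mul_eq_one.1 (hN.eq_one (Nat.le_zero.1 h2))⟩
    refine ⟨(r i)⁻¹ * r (i + 1), List.mem_append_left _ (hT i), ?_⟩
    rw [mul_inv_cancel_left, (h0 _).1, (h0 _).2, (h0 _).2]
  · have hle : N (h⁻¹ * r (v h)) = n + 1 := le_antisymm (hdh ▸ hv h) (hdh ▸ hdle le_rfl)
    rw [← hN.inv] at hle
    obtain ⟨s, hs, hsN⟩ := hN.step hle
    have hstep : ∀ i, N (h⁻¹ * r i) ≤ N ((h * s)⁻¹ * r i) + 1 := fun i => by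
      have h1 := hN.mul_le s ((h * s)⁻¹ * r i)
      have h2 := hN.le_one hs
      have h3 : s * ((h * s)⁻¹ * r i) = h⁻¹ * r i := by group
      rw [h3] at h1
      omega
    have hi : N ((h * s)⁻¹ * r (v h)) = n := by
      rw [← hsN, ← hN.inv]
      congr 1
      group
    have hd' : d (h * s) = n := by
      refine le_antisymm (hdle hi.le) ?_
      obtain ⟨j, hj⟩ := hd (h * s)
      have := hdle ((hstep j).trans (Nat.succ_le_succ hj))
      omega
    have hv' : v (h * s) = v h := by
      refine le_antisymm (hvle (by rw [hi, hd'])) (hvle ?_)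
      have := (hstep _).trans (Nat.succ_le_succ (hv (h * s)))
      omega
    exact ⟨s, List.mem_append_right _ hs, by omega⟩

end

theorem exists_height {H : Type*} [Group H] [Infinite H] {k : ℕ} {σ : Fin k → H}
    (hσ : IsSymmGen σ) (h : DecidableWordProblem σ) :
    ∃ (d v s : H → ℕ) (n : ℕ) (T : ℕ → H), (Computable fun w => d (wordVal σ w)) ∧
      (Computable fun w => v (wordVal σ w)) ∧ (Computable fun w => s (wordVal σ w)) ∧
      (∀ h, s h < n) ∧ ∀ h, v (h * T (s h)) + d h = v h + d (h * T (s h)) + 1 := by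
  obtain ⟨_, _, hw⟩ := exists_cGroup hσ h
  have hgen : ∀ h : H, ∃ w : List H, (∀ s ∈ w, s ∈ List.ofFn σ) ∧ w.prod = h := fun h => by
    obtain ⟨w, rfl⟩ := wordVal_surjective hσ h
    refine ⟨_, fun s hs => ?_, (wordVal_eq_prod w).symm⟩
    obtain ⟨⟨i, b⟩, -, rfl⟩ := List.mem_map.1 hs
    cases b
    · simpa [List.mem_ofFn] using hσ.2 i
    · simp [List.mem_ofFn]
  obtain ⟨bl, N, hN⟩ := exists_isLength (S := List.ofFn σ) (fun s hs => by
    obtain ⟨i, rfl⟩ := List.mem_ofFn.1 hs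
    simpa [List.mem_ofFn] using hσ.2 i) hgen
  have hwalk : HasProperWalk H := by
    by_cases h1 : ∀ m U, AlmostInv (List.ofFn σ) N m U → U.Infinite → Uᶜ.Finite
    · exact hN.hasProperWalk_of_oneEnded h1
    · push Not at h1
      obtain ⟨m, U, hU, h1, h2⟩ := h1
      exact hN.hasProperWalk_of_ends hU h1 h2
  obtain ⟨d, v, T, hd, hv, hT⟩ := hwalk.exists_height hN
  have hs : Computable fun q : H × ℕ => q.1 * T[q.2]?.getD 1 :=
    C_gmul Computable.fst (C_optionGetD (C_getElem? (C_const T) Computable.snd) (C_const 1))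
  have hd1 := hd.comp (Computable.fst (α := H) (β := ℕ))
  have hv1 := hv.comp (Computable.fst (α := H) (β := ℕ))
  obtain ⟨s, hs, hs'⟩ := exists_computable_selector
    (p := fun h i => i < T.length ∧ v (h * T[i]?.getD 1) + d h = v h + d (h * T[i]?.getD 1) + 1)
    (C_dec_and (C_dec_lt Computable.snd (C_const _)) (C_dec_eq (C_add (hv.comp hs) hd1)
      (Computable.succ.comp (C_add hv1 (hd.comp hs))))) fun h => by
      obtain ⟨t, ht, h'⟩ := hT h
      obtain ⟨i, hi, rfl⟩ := List.getElem_of_mem ht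
      exact ⟨i, hi, by rwa [List.getElem?_eq_getElem hi]⟩
  exact ⟨d, v, s, T.length, fun i => T[i]?.getD 1, hd.comp hw, hv.comp hw, hs.comp hw,
    fun h => (hs' h).1, fun h => (hs' h).2⟩

/-! ### Subshifts of finite type have effectively closed Medvedev degree -/

theorem exists_word_map {G G' : Type*} [Group G] [Group G'] {m k : ℕ} (f : G →* G')
    (ν : Fin m → G) {σ : Fin k → G'} (hσ : IsSymmGen σ) :
    ∃ φ : List (Fin m × Bool) → List (Fin k × Bool), Computable φ ∧
      ∀ w, wordVal σ (φ w) = f (wordVal ν w) := by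
  choose a ha using fun i => wordVal_surjective hσ (f (ν i))
  let g : Fin m × Bool → List (Fin k × Bool) := fun x => cond x.2 (a x.1) (wordInv (a x.1))
  refine ⟨fun w => w.flatMap g,
    C_flatMap (h := fun _ x => g x) C_id ((computable_of_finite g).comp Computable.snd),
    fun w => ?_⟩
  induction w with
  | nil => simp [wordVal_nil]
  | cons x w ih =>
    obtain ⟨i, b⟩ := x
    dsimp only at ih ⊢
    rw [List.flatMap_cons, wordVal_append, ih, wordVal_eq_prod (σ := ν) (_ :: _), List.map_cons,
      List.prod_cons, ← wordVal_eq_prod, map_mul]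
    congr 1
    cases b
    · simp [g, wordVal_wordInv, ha]
    · simp [g, ha]

theorem DecidableWordProblem.prod {H K : Type*} [Group H] [Group K] {k r m : ℕ} {σ : Fin k → H}
    {τ : Fin r → K} (hσ : IsSymmGen σ) (hτ : IsSymmGen τ) (h : DecidableWordProblem σ)
    (h' : DecidableWordProblem τ) (ν : Fin m → H × K) : DecidableWordProblem ν := by
  obtain ⟨f, hf, hfw⟩ := exists_word_map (MonoidHom.fst H K) ν hσ
  obtain ⟨g, hg, hgw⟩ := exists_word_map (MonoidHom.snd H K) ν hτ
  obtain ⟨φ, hφ, h⟩ := h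
  obtain ⟨ψ, hψ, h'⟩ := h'
  refine ⟨fun w => φ (f w) && ψ (g w), C_band (hφ.comp hf) (hψ.comp hg), fun w => ?_⟩
  rw [Bool.and_eq_true, h, h', hfw, hgw, Prod.ext_iff]
  rfl

section Subshift
variable {G : Type*} [Group G] {m n : ℕ} {ν : Fin m → G}

theorem confFun_of_decode (x : G → Fin n) {i : ℕ} {w : List (Fin m × Bool)}
    (h : Encodable.decode i = some w) : confFun (x ∘ cover ν) i = x (wordVal ν w) + 1 := by
  have : (Encodable.decode (α := FreeGroup (Fin m)) i) = some (FreeGroup.mk w) := by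
    change (Encodable.decode (α := List (Fin m × Bool)) i).bind _ = _
    rw [h]
    rfl
  rw [confFun, this]
  rfl

theorem confFun_encode (x : G → Fin n) (w : List (Fin m × Bool)) :
    confFun (x ∘ cover ν) (Encodable.encode w) = x (wordVal ν w) + 1 :=
  confFun_of_decode x (Encodable.encodek w)

theorem confFun_of_decode_eq_none (x : G → Fin n) {i : ℕ}
    (h : (Encodable.decode i : Option (List (Fin m × Bool))) = none) :
    confFun (x ∘ cover ν) i = 0 := by
  have : (Encodable.decode (α := FreeGroup (Fin m)) i) = none := by
    change (Encodable.decode (α := List (Fin m × Bool)) i).bind _ = _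
    rw [h]
    rfl
  rw [confFun, this]
  rfl

/-- The prefix records the value `v` for the letter `a` at the word `w`. -/
def Bit (l : List ℕ) (w : List (Fin m × Bool)) (a v : ℕ) : Prop :=
  l[Nat.pair (Encodable.encode w) a]? = some v

theorem computable_bit {γ : Type*} [Primcodable γ] {l : γ → List ℕ}
    {w : γ → List (Fin m × Bool)} {a : γ → ℕ} (hl : Computable l) (hw : Computable w)
    (ha : Computable a) (v : ℕ) : Computable fun q => dec (Bit (l q) (w q) (a q) v) :=
  C_dec_eq (C_getElem? hl (C_natPair (C_encode hw) ha)) (C_const _)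

theorem bit_pref {c : ℕ → ℕ} {k : ℕ} {w : List (Fin m × Bool)} {a v : ℕ} :
    Bit (pref c k) w a v ↔ Nat.pair (Encodable.encode w) a < k ∧
      c (Nat.pair (Encodable.encode w) a) = v := getElem?_pref_eq

/-- A finite prefix shows that a point does not describe a configuration avoiding `F`. -/
def BadPrefix (ν : Fin m → G) (n : ℕ) (F : List (List (List (Fin m × Bool) × ℕ)))
    (l : List ℕ) : Prop :=
  (∃ w : List (Fin m × Bool), ∀ a < n, Bit l w a 0) ∨
  (∃ q : (List (Fin m × Bool) × List (Fin m × Bool)) × ℕ × ℕ,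
    wordVal ν q.1.1 = wordVal ν q.1.2 ∧ q.2.1 ≠ q.2.2 ∧ Bit l q.1.1 q.2.1 1 ∧
      Bit l q.1.2 q.2.2 1 ∧ q.2.1 < n ∧ q.2.2 < n) ∨
  ∃ u : List (Fin m × Bool), ∃ p ∈ F, ∀ q ∈ p, Bit l (u ++ q.1) q.2 1

theorem semidec_badPrefix (h : DecidableWordProblem ν) (n : ℕ)
    (F : List (List (List (Fin m × Bool) × ℕ))) : Semidec (BadPrefix ν n F) := by
  refine .or ?_ (.or ?_ ?_)
  · refine .exists (.of_computable (C_dec_forall_lt (C_const n) ?_))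
    exact computable_bit (Computable.fst.comp Computable.fst)
      (Computable.snd.comp Computable.fst) Computable.snd 0
  · refine .exists (.of_computable ?_)
    let α := List ℕ × (List (Fin m × Bool) × List (Fin m × Bool)) × ℕ × ℕ
    have h1 : Computable fun q : α => q.2.1 := Computable.fst.comp Computable.snd
    have h2 : Computable fun q : α => q.2.2 := Computable.snd.comp Computable.snd
    have ha : Computable fun q : α => q.2.2.1 := Computable.fst.comp h2
    have hb : Computable fun q : α => q.2.2.2 := Computable.snd.comp h2
    have hw : Computable fun q : α => q.2.1.1 := Computable.fst.comp h1
    have hw' : Computable fun q : α => q.2.1.2 := Computable.snd.comp h1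
    exact C_dec_and (h.computable_eq.comp h1) (C_dec_and (C_dec_not (C_dec_eq ha hb))
      (C_dec_and (computable_bit Computable.fst hw ha 1) (C_dec_and
        (computable_bit Computable.fst hw' hb 1) (C_dec_and (C_dec_lt ha (C_const n))
          (C_dec_lt hb (C_const n))))))
  · refine .exists (.of_computable (C_dec_exists_mem (C_const F)
      (C_dec_forall_mem Computable.snd ?_)))
    let α := ((List ℕ × List (Fin m × Bool)) × List (List (Fin m × Bool) × ℕ)) ×
      List (Fin m × Bool) × ℕ
    have h1 : Computable fun q : α => q.1.1 := Computable.fst.comp Computable.fst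
    exact computable_bit (Computable.fst.comp h1)
      (C_append (Computable.snd.comp h1) (Computable.fst.comp Computable.snd))
      (Computable.snd.comp Computable.snd) 1

/-- The point describes the configuration. -/
def Describes (ν : Fin m → G) (c : ℕ → ℕ) (x : G → Fin n) : Prop :=
  ∀ w, ∀ a < n, c (Nat.pair (Encodable.encode w) a) = 1 ↔ (x (wordVal ν w) : ℕ) = a

theorem exists_forall_mem_lt (l : List ℕ) : ∃ k, ∀ i ∈ l, i < k :=
  ⟨l.sum + 1, fun _ h => Nat.lt_succ_of_le (List.le_sum_of_mem h)⟩

theorem forall_not_badPrefix_iff (hν : IsSymmGen ν) {F : List (List (List (Fin m × Bool) × ℕ))}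
    (hF : ∀ p ∈ F, ∀ q ∈ p, q.2 < n) {c : ℕ → ℕ} (hc : c ∈ cantorSpace) :
    (∀ k, ¬ BadPrefix ν n F (pref c k)) ↔ ∃ x : G → Fin n, Describes ν c x ∧
      ∀ u, ∀ p ∈ F, ¬ ∀ q ∈ p, (x (wordVal ν (u ++ q.1)) : ℕ) = q.2 := by
  constructor
  · intro h
    have h1 : ∀ w : List (Fin m × Bool), ∃ a : Fin n,
        c (Nat.pair (Encodable.encode w) a) = 1 := by
      by_contra! hw
      obtain ⟨w, hw⟩ := hw
      obtain ⟨k, hk⟩ := exists_forall_mem_lt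
        ((List.range n).map fun a => Nat.pair (Encodable.encode w) a)
      refine h k (.inl ⟨w, fun a ha => bit_pref.2 ⟨hk _ (List.mem_map.2 ⟨a, by simpa, rfl⟩), ?_⟩⟩)
      have h2 := hc (Nat.pair (Encodable.encode w) a)
      have h3 := hw ⟨a, ha⟩
      dsimp only at h3
      omega
    have h2 : ∀ w w' : List (Fin m × Bool), ∀ a b : ℕ, wordVal ν w = wordVal ν w' → a < n →
        b < n → c (Nat.pair (Encodable.encode w) a) = 1 →
        c (Nat.pair (Encodable.encode w') b) = 1 → a = b := by
      intro w w' a b hw ha hb h1 h2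
      by_contra hab
      exact h (max (Nat.pair (Encodable.encode w) a + 1) (Nat.pair (Encodable.encode w') b + 1))
        (.inr (.inl ⟨((w, w'), a, b), hw, hab, bit_pref.2 ⟨by dsimp only; omega, h1⟩,
          bit_pref.2 ⟨by dsimp only; omega, h2⟩, ha, hb⟩))
    choose f hf using h1
    choose g hg using wordVal_surjective hν
    have h3 : Describes ν c fun h => f (g h) := fun w a ha =>
      ⟨fun h => h2 _ _ _ _ (hg _) (f _).2 ha (hf _) h, fun h => by
        rw [← h2 _ _ _ _ (hg (wordVal ν w)).symm (f w).2 (f _).2 (hf _) (hf _)] at h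
        exact h ▸ hf w⟩
    refine ⟨_, h3, fun u p hp hq => ?_⟩
    obtain ⟨k, hk⟩ := exists_forall_mem_lt
      (p.map fun q => Nat.pair (Encodable.encode (u ++ q.1)) q.2)
    exact h k (.inr (.inr ⟨u, p, hp, fun q hqp => bit_pref.2
      ⟨hk _ (List.mem_map.2 ⟨q, hqp, rfl⟩), (h3 _ _ (hF p hp q hqp)).2 (hq q hqp)⟩⟩))
  · rintro ⟨x, hx, hxF⟩ k (⟨w, hw⟩ | ⟨⟨⟨w, w'⟩, a, b⟩, h, hab, h1, h2, ha, hb⟩ | ⟨u, p, hp, h⟩)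
    · have h1 := (bit_pref.1 (hw _ (x (wordVal ν w)).2)).2
      rw [(hx w _ (x (wordVal ν w)).2).2 rfl] at h1
      exact one_ne_zero h1
    · dsimp only at *
      exact hab (((hx _ _ ha).1 (bit_pref.1 h1).2).symm.trans
        ((congrArg (fun g => (x g : ℕ)) h).trans ((hx _ _ hb).1 (bit_pref.1 h2).2)))
    · exact hxF u p hp fun q hq => (hx _ _ (hF p hp q hq)).1 (bit_pref.1 (h q hq)).2

theorem IsSFT.exists_words (hν : IsSymmGen ν) {X : Set (G → Fin n)} (hX : IsSFT X) :
    ∃ F : List (List (List (Fin m × Bool) × ℕ)), (∀ p ∈ F, ∀ q ∈ p, q.2 < n) ∧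
      ∀ x, x ∈ X ↔ ∀ u, ∀ p ∈ F, ¬ ∀ q ∈ p, (x (wordVal ν (u ++ q.1)) : ℕ) = q.2 := by
  obtain ⟨F, rfl⟩ := hX
  choose g hg using wordVal_surjective hν
  refine ⟨F.map fun p => p.dom.attach.toList.map fun h : {h // h ∈ p.dom} => (g h, (p.val h : ℕ)), ?_, fun x => ?_⟩
  · simp only [List.mem_map]
    rintro _ ⟨p, -, rfl⟩ q hq
    obtain ⟨h, -, rfl⟩ := List.mem_map.1 hq
    exact (p.val h).2
  · simp only [Set.mem_ofPred_eq, List.forall_mem_map, Finset.mem_toList, Finset.mem_attach,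
      true_implies, wordVal_append, hg, MatchesAt, shift, Fin.val_inj]
    refine ⟨fun h u p hp hm => h p hp (wordVal ν u)⁻¹ fun d : {h // h ∈ p.dom} => ?_, fun h p hp u hm =>
      h (g u⁻¹) p hp fun d : {h // h ∈ p.dom} => ?_⟩
    · rw [inv_inv]
      exact hm d
    · rw [hg]
      exact hm d

theorem exists_isPi01Cantor_of_isSFT (hν : IsSymmGen ν) (hw : DecidableWordProblem ν)
    {X : Set (G → Fin n)} (hX : IsSFT X) (hne : X.Nonempty) :
    ∃ Q, IsPi01Cantor Q ∧ Q.Nonempty ∧ BaireEquiv (mSet (pullback (cover ν) X)) Q := by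
  obtain ⟨F, hF, hXF⟩ := hX.exists_words hν
  let c : (G → Fin n) → ℕ → ℕ := fun x i =>
    if confFun (x ∘ cover ν) i.unpair.1 = i.unpair.2 + 1 then 1 else 0
  have hc : ∀ x, c x ∈ cantorSpace ∧ Describes ν (c x) x := by
    refine fun x => ⟨fun i => ?_, fun w a ha => ?_⟩
    · dsimp only [c]
      split_ifs <;> simp
    · dsimp only [c]
      rw [Nat.unpair_pair]
      simp [confFun_encode]
  have hcX : ∀ x ∈ X, c x ∈ cantorSpace \ {c | ∃ k, BadPrefix ν n F (pref c k)} := by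
    intro x hx
    refine ⟨(hc x).1, ?_⟩
    rw [Set.mem_ofPred_eq, not_exists, forall_not_badPrefix_iff hν hF (hc x).1]
    exact ⟨x, (hc x).2, (hXF x).1 hx⟩
  refine ⟨_, isPi01Cantor_of_semidec (semidec_badPrefix hw n F), ?_, ?_, ?_⟩
  · obtain ⟨x, hx⟩ := hne
    exact ⟨_, hcX x hx⟩
  · refine BaireLE.of_semidec (R := fun l i v =>
      ((Encodable.decode i : Option (List (Fin m × Bool))) = none ∧ v = 0) ∨
      ∃ q : List (Fin m × Bool) × ℕ, Encodable.decode i = some q.1 ∧ q.2 < n ∧ Bit l q.1 q.2 1 ∧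
        v = q.2 + 1) (.or (.of_computable ?_) (.exists (.of_computable ?_))) ?_
    · exact C_dec_and (C_dec_eq (C_decode (Computable.fst.comp Computable.snd)) (C_const _))
        (C_dec_eq (Computable.snd.comp Computable.snd) (C_const _))
    · let α := (List ℕ × ℕ × ℕ) × List (Fin m × Bool) × ℕ
      have h1 : Computable fun q : α => q.1.2 := Computable.snd.comp Computable.fst
      have hw : Computable fun q : α => q.2.1 := Computable.fst.comp Computable.snd
      have ha : Computable fun q : α => q.2.2 := Computable.snd.comp Computable.snd
      exact C_dec_and (C_dec_eq (C_decode (Computable.fst.comp h1)) (C_some hw))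
        (C_dec_and (C_dec_lt ha (C_const n)) (C_dec_and
          (computable_bit (Computable.fst.comp Computable.fst) hw ha 1)
          (C_dec_eq (Computable.snd.comp h1) (Computable.succ.comp ha))))
    · rintro c ⟨hc, hB⟩
      rw [Set.mem_ofPred_eq, not_exists, forall_not_badPrefix_iff hν hF hc] at hB
      obtain ⟨x, hx, hxF⟩ := hB
      refine ⟨_, ⟨_, ⟨x, (hXF x).2 hxF, rfl⟩, rfl⟩, fun i v => ?_⟩
      constructor
      · rintro ⟨k, ⟨h, rfl⟩ | ⟨⟨w, a⟩, h, ha, hb, rfl⟩⟩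
        · exact confFun_of_decode_eq_none x h
        · dsimp only at *
          rw [← (hx w a ha).1 (bit_pref.1 hb).2, confFun_of_decode x h]
      · rintro rfl
        rcases h : (Encodable.decode i : Option (List (Fin m × Bool))) with _ | w
        · exact ⟨0, .inl ⟨rfl, confFun_of_decode_eq_none x h⟩⟩
        · exact ⟨_, .inr ⟨(w, x (wordVal ν w)), rfl, (x _).2, bit_pref.2
            ⟨Nat.lt_succ_self _, (hx _ _ (x _).2).2 rfl⟩, confFun_of_decode x h⟩⟩
  · refine BaireLE.of_semidec (R := fun l i v => ∃ s, l[i.unpair.1]? = some s ∧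
      v = if s = i.unpair.2 + 1 then 1 else 0) (.exists (.of_computable ?_)) ?_
    · let α := (List ℕ × ℕ × ℕ) × ℕ
      have hl : Computable fun q : α => q.1.1 := Computable.fst.comp Computable.fst
      have h1 : Computable fun q : α => q.1.2 := Computable.snd.comp Computable.fst
      have hi : Computable fun q : α => q.1.2.1.unpair := C_unpair (Computable.fst.comp h1)
      exact C_dec_and (C_dec_eq (C_getElem? hl (Computable.fst.comp hi))
        (C_some Computable.snd)) (C_dec_eq (Computable.snd.comp h1) (C_ite
          (C_dec_eq Computable.snd (Computable.succ.comp (Computable.snd.comp hi)))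
          (C_const 1) (C_const 0)))
    · rintro _ ⟨_, ⟨x, hx, rfl⟩, rfl⟩
      refine ⟨c x, hcX x hx, fun i v => ⟨?_, ?_⟩⟩
      · rintro ⟨k, s, hs, rfl⟩
        rw [← (getElem?_pref_eq.1 hs).2]
      · rintro rfl
        exact ⟨i.unpair.1 + 1, _, getElem?_pref (Nat.lt_succ_self _), rfl⟩

end Subshift

/-! ### The subshift of tilings -/

theorem isSFT_of_local {G : Type*} [Group G] {n : ℕ} (D : Finset G) (L : (G → Fin n) → Prop)
    (h : ∀ x y, (∀ d ∈ D, x d = y d) → L x → L y) : IsSFT {x | ∀ g, L (shift g x)} := by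
  classical
  let F : Finset ({g // g ∈ D} → Fin n) :=
    Finset.univ.filter fun val => ¬ ∃ x, L x ∧ ∀ d : {g // g ∈ D}, x d = val d
  refine ⟨F.toList.map (Pattern.mk D), Set.ext fun x => ?_⟩
  simp only [Set.mem_ofPred_eq, List.forall_mem_map, Finset.mem_toList, F, Finset.mem_filter,
    Finset.mem_univ, true_and]
  refine ⟨fun hx val hval g hm => hval ⟨_, hx g, hm⟩, fun hx g => ?_⟩
  by_contra hg
  refine hx (fun d => shift g x d) (fun ⟨y, hy, hd⟩ => hg (h y _ (fun d hd' => hd ⟨d, hd'⟩) hy)) g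
    fun _ => rfl

theorem eq_of_forall_mul_gen {G β : Type*} [Group G] {k : ℕ} {σ : Fin k → G} (hσ : IsSymmGen σ)
    {f : G → β} (h : ∀ g i, f (g * σ i) = f g) (g : G) : f g = f 1 := by
  have hg : g ∈ Subgroup.closure (Set.range σ) := hσ.1 ▸ Subgroup.mem_top g
  suffices ∀ a, f (a * g) = f a by simpa using this 1
  induction hg using Subgroup.closure_induction with
  | mem _ hx =>
    obtain ⟨i, rfl⟩ := hx
    exact fun a => h a i
  | one => simp
  | mul x y _ _ hx hy => exact fun a => by rw [← mul_assoc, hy, hx]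
  | inv x _ hx => exact fun a => by rw [← hx, inv_mul_cancel_right]

section TileSubshift
variable {H K : Type*} [Group H] [Group K] {k r : ℕ}

/-- A tile is placed at every group element, together with the horizontal and vertical
neighbours against which it is matched. -/
structure IsTileConf (p : ℕ → Instr) (σ : Fin k → H) (τ : Fin r → K) (T₁ : ℕ → H) (T₂ : ℕ → K)
    (t : H × K → Tile) (a b : H × K → ℕ) : Prop where
  ok : ∀ g, (t g).Ok p
  left : ∀ g i, a (g * (1, τ i)) = a g
  right : ∀ g i, b (g * (σ i, 1)) = b g
  hor : ∀ g, (t g).E = (t (g * (T₁ (a g), 1))).W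
  ver : ∀ g, (t g).N = (t (g * (1, T₂ (b g)))).S

/-- The configurations describing tilings; a letter consists of a tile and the indices of the
horizontal and vertical neighbours. -/
def tileSubshift (p : ℕ → Instr) (σ : Fin k → H) (τ : Fin r → K) (T₁ : ℕ → H) (T₂ : ℕ → K)
    (tl : ℕ → Tile) (n n₁ n₂ : ℕ) : Set (H × K → Fin (n * (n₁ * n₂))) :=
  {x | IsTileConf p σ τ T₁ T₂ (fun g => tl (x g % n)) (fun g => x g / n % n₁)
    fun g => x g / n / n₁}

theorem isSFT_tileSubshift (p : ℕ → Instr) (σ : Fin k → H) (τ : Fin r → K) (T₁ : ℕ → H)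
    (T₂ : ℕ → K) (tl : ℕ → Tile) (n n₁ n₂ : ℕ) :
    IsSFT (tileSubshift p σ τ T₁ T₂ tl n n₁ n₂) := by
  classical
  let D : Finset (H × K) := {1} ∪ Finset.univ.image (fun i => (1, τ i)) ∪
    Finset.univ.image (fun i => (σ i, 1)) ∪
    Finset.univ.image (fun q : Fin (n * (n₁ * n₂)) => (T₁ (q / n % n₁), 1)) ∪
    Finset.univ.image (fun q : Fin (n * (n₁ * n₂)) => (1, T₂ (q / n / n₁)))
  let L : (H × K → Fin (n * (n₁ * n₂))) → Prop := fun x => (tl (x 1 % n)).Ok p ∧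
    (∀ i, x (1, τ i) / n % n₁ = (x 1 / n % n₁ : ℕ)) ∧
    (∀ i, x (σ i, 1) / n / n₁ = (x 1 / n / n₁ : ℕ)) ∧
    (tl (x 1 % n)).E = (tl (x (T₁ (x 1 / n % n₁), 1) % n)).W ∧
    (tl (x 1 % n)).N = (tl (x (1, T₂ (x 1 / n / n₁)) % n)).S
  have hL : ∀ x y, (∀ d ∈ D, x d = y d) → L x → L y := by
    rintro x y h ⟨h1, h2, h3, h4, h5⟩
    have hd : ∀ d ∈ D, (x d : ℕ) = y d := fun d hd => congrArg _ (h d hd)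
    have e1 := hd 1 (by simp [D])
    have e2 := fun i => hd (1, τ i) (by simp [D])
    have e3 := fun i => hd (σ i, 1) (by simp [D])
    have e4 := hd (T₁ (x 1 / n % n₁), 1) (by simp [D])
    have e5 := hd (1, T₂ (x 1 / n / n₁)) (by simp [D])
    rw [e4, e1] at h4
    rw [e5, e1] at h5
    rw [e1] at h1
    refine ⟨h1, fun i => ?_, fun i => ?_, h4, h5⟩
    · rw [← e1, ← e2, h2]
    · rw [← e1, ← e3, h3]
  convert isSFT_of_local D L hL using 1
  ext x
  have hs : ∀ g h, shift g⁻¹ x h = x (g * h) := fun g h => by rw [shift, inv_inv]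
  have hg : (∀ g, L (shift g x)) ↔ ∀ g, L (shift g⁻¹ x) :=
    ⟨fun h g => h _, fun h g => by simpa using h g⁻¹⟩
  rw [Set.mem_ofPred_eq, hg]
  simp only [L, hs, mul_one]
  exact ⟨fun h g => ⟨h.ok g, h.left g, h.right g, h.hor g, h.ver g⟩,
    fun h => ⟨fun g => (h g).1, fun g => (h g).2.1, fun g => (h g).2.2.1,
      fun g => (h g).2.2.2.1, fun g => (h g).2.2.2.2⟩⟩

theorem IsTileConf.left_const {p : ℕ → Instr} {σ : Fin k → H} {τ : Fin r → K} {T₁ : ℕ → H}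
    {T₂ : ℕ → K} {t : H × K → Tile} {a b : H × K → ℕ} (h : IsTileConf p σ τ T₁ T₂ t a b)
    (hτ : IsSymmGen τ) (x : H) (y : K) : a (x, y) = a (x, 1) :=
  eq_of_forall_mul_gen hτ (f := fun y => a (x, y))
    (fun y i => by simpa using h.left (x, y) i) y

theorem IsTileConf.right_const {p : ℕ → Instr} {σ : Fin k → H} {τ : Fin r → K} {T₁ : ℕ → H}
    {T₂ : ℕ → K} {t : H × K → Tile} {a b : H × K → ℕ} (h : IsTileConf p σ τ T₁ T₂ t a b)
    (hσ : IsSymmGen σ) (x : H) (y : K) : b (x, y) = b (1, y) :=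
  eq_of_forall_mul_gen hσ (f := fun x => b (x, y))
    (fun x i => by simpa using h.right (x, y) i) x

end TileSubshift

/-! ### Tilings of the quadrant from configurations -/

section Follow
variable {m : ℕ}

/-- The path from the identity that appends the word selected by the current letter, read off a
prefix of the configuration. -/
def followPref (L : List (List (Fin m × Bool))) (f : ℕ → ℕ) (l : List ℕ) (i : ℕ) :
    Option (List (Fin m × Bool)) :=
  Nat.rec (some []) (fun _ o => o.bind fun w =>
    (l[Encodable.encode w]?).map fun s => w ++ L[f (s - 1)]?.getD []) i

/-- The path from the identity that appends the word selected by the current letter. -/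
def follow (L : List (List (Fin m × Bool))) (f : ℕ → ℕ) (y : ℕ → ℕ) (i : ℕ) :
    List (Fin m × Bool) :=
  Nat.rec [] (fun _ w => w ++ L[f (y (Encodable.encode w) - 1)]?.getD []) i

variable (L : List (List (Fin m × Bool)))

theorem follow_succ (f y : ℕ → ℕ) (i : ℕ) : follow L f y (i + 1) =
    follow L f y i ++ L[f (y (Encodable.encode (follow L f y i)) - 1)]?.getD [] := rfl

theorem followPref_succ (f : ℕ → ℕ) (l : List ℕ) (i : ℕ) : followPref L f l (i + 1) =
    (followPref L f l i).bind fun w =>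
      (l[Encodable.encode w]?).map fun s => w ++ L[f (s - 1)]?.getD [] := rfl

theorem computable_followPref {f : ℕ → ℕ} (hf : Computable f) :
    Computable fun q : List ℕ × ℕ => followPref L f q.1 q.2 := by
  refine C_natRec (h := fun (q : List ℕ × ℕ) _ (o : Option (List (Fin m × Bool))) =>
    o.bind fun w => (q.1[Encodable.encode w]?).map fun s => w ++ L[f (s - 1)]?.getD [])
    Computable.snd (C_const (some [])) (C_optionBind (Computable.snd.comp Computable.snd) ?_)
  let α := (List ℕ × ℕ) × ℕ × Option (List (Fin m × Bool))
  have hl : Computable fun q : α × List (Fin m × Bool) => q.1.1.1 :=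
    Computable.fst.comp (Computable.fst.comp Computable.fst)
  refine C_optionMap (C_getElem? hl (C_encode Computable.snd)) ?_
  exact C_append (Computable.snd.comp Computable.fst) (C_optionGetD (C_getElem? (C_const L)
    (hf.comp (C_sub Computable.snd (C_const 1)))) (C_const []))

theorem eq_follow_of_followPref {f y : ℕ → ℕ} {k i : ℕ} {w : List (Fin m × Bool)}
    (h : followPref L f (pref y k) i = some w) : follow L f y i = w := by
  induction i generalizing w with
  | zero => exact Option.some.inj h
  | succ i ih =>
    rw [followPref_succ, Option.bind_eq_some_iff] at h
    obtain ⟨u, hu, h⟩ := h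
    rw [Option.map_eq_some_iff] at h
    obtain ⟨s, hs, rfl⟩ := h
    rw [follow_succ, ih hu, (getElem?_pref_eq.1 hs).2]

theorem exists_followPref_eq (f y : ℕ → ℕ) (i : ℕ) :
    ∃ k, ∀ k' ≥ k, followPref L f (pref y k') i = some (follow L f y i) := by
  induction i with
  | zero => exact ⟨0, fun _ _ => rfl⟩
  | succ i ih =>
    obtain ⟨k, hk⟩ := ih
    refine ⟨max k (Encodable.encode (follow L f y i) + 1), fun k' h => ?_⟩
    rw [followPref_succ, hk k' (by omega), Option.bind_some, getElem?_pref (by omega)]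
    rfl

variable {G : Type*} [Group G] {n n' : ℕ} {ν : Fin m → G}

theorem wordVal_follow_succ {T : ℕ → G} {f : ℕ → ℕ}
    (hL : ∀ i < n', wordVal ν (L[i]?.getD []) = T i) (x : G → Fin n) (hf : ∀ a < n, f a < n')
    (i : ℕ) : wordVal ν (follow L f (confFun (x ∘ cover ν)) (i + 1)) =
      wordVal ν (follow L f (confFun (x ∘ cover ν)) i) *
        T (f (x (wordVal ν (follow L f (confFun (x ∘ cover ν)) i)))) := by
  rw [follow_succ, wordVal_append, confFun_encode, Nat.add_sub_cancel,
    hL _ (hf _ (x _).2)]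

end Follow

theorem baireLE_tileSubshift {H K : Type*} [Group H] [Group K] {k r m : ℕ} {σ : Fin k → H}
    {τ : Fin r → K} {ν : Fin m → H × K} (hσ : IsSymmGen σ) (hτ : IsSymmGen τ)
    (hν : IsSymmGen ν) (p : ℕ → Instr) (T₁ : ℕ → H) (T₂ : ℕ → K) (tl : ℕ → Tile) (n n₁ n₂ : ℕ) :
    BaireLE (tilingSet p n tl) (mSet (pullback (cover ν) (tileSubshift p σ τ T₁ T₂ tl n n₁ n₂))) := by
  choose W₁ hW₁ using fun i => wordVal_surjective hν (T₁ i, 1)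
  choose W₂ hW₂ using fun i => wordVal_surjective hν (1, T₂ i)
  let L₁ := (List.range n₁).map W₁
  let L₂ := (List.range n₂).map W₂
  have hL₁ : ∀ i < n₁, wordVal ν (L₁[i]?.getD []) = (T₁ i, 1) := fun i hi => by
    simp [L₁, hi, hW₁]
  have hL₂ : ∀ i < n₂, wordVal ν (L₂[i]?.getD []) = (1, T₂ i) := fun i hi => by
    simp [L₂, hi, hW₂]
  let f₁ : ℕ → ℕ := fun a => a / n % n₁
  let f₂ : ℕ → ℕ := fun a => a / n / n₁
  have hf₁ : ∀ a < n * (n₁ * n₂), f₁ a < n₁ := fun a ha => Nat.mod_lt _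
    (Nat.pos_of_ne_zero fun h => by simp [h] at ha)
  have hf₂ : ∀ a < n * (n₁ * n₂), f₂ a < n₂ := fun a ha =>
    Nat.div_lt_of_lt_mul (Nat.div_lt_of_lt_mul ha)
  have hc₁ : Computable f₁ := C_mod (C_div C_id (C_const n)) (C_const n₁)
  have hc₂ : Computable f₂ := C_div (C_div C_id (C_const n)) (C_const n₁)
  let W := List (Fin m × Bool)
  refine BaireLE.of_semidec (R := fun l i v => ∃ q : (W × W) × ℕ,
    followPref L₁ f₁ l i.unpair.1 = some q.1.1 ∧ followPref L₂ f₂ l i.unpair.2 = some q.1.2 ∧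
    l[Encodable.encode (q.1.1 ++ q.1.2)]? = some q.2 ∧ v = (q.2 - 1) % n)
    (.exists (.of_computable ?_)) ?_
  · let α := (List ℕ × ℕ × ℕ) × (W × W) × ℕ
    have hl : Computable fun q : α => q.1.1 := Computable.fst.comp Computable.fst
    have h1 : Computable fun q : α => q.1.2 := Computable.snd.comp Computable.fst
    have hi : Computable fun q : α => q.1.2.1.unpair := C_unpair (Computable.fst.comp h1)
    have h2 : Computable fun q : α => q.2.1 := Computable.fst.comp Computable.snd
    have hs : Computable fun q : α => q.2.2 := Computable.snd.comp Computable.snd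
    have e₁ := (computable_followPref L₁ hc₁).comp (C_pair hl (Computable.fst.comp hi))
    have e₂ := (computable_followPref L₂ hc₂).comp (C_pair hl (Computable.snd.comp hi))
    have hu₁ := Computable.fst.comp h2
    have hu₂ := Computable.snd.comp h2
    have e₃ := C_getElem? hl (C_encode (C_append hu₁ hu₂))
    have e₄ := C_mod (C_sub hs (C_const 1)) (C_const n)
    exact C_dec_and (C_dec_eq e₁ (C_some hu₁)) (C_dec_and (C_dec_eq e₂ (C_some hu₂))
      (C_dec_and (C_dec_eq e₃ (C_some hs)) (C_dec_eq (Computable.snd.comp h1) e₄)))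
  · rintro _ ⟨_, ⟨x, hx, rfl⟩, rfl⟩
    have hx' : IsTileConf p σ τ T₁ T₂ (fun g => tl (x g % n)) (fun g => f₁ (x g))
      (fun g => f₂ (x g)) := hx
    set y := confFun (x ∘ cover ν) with hy
    let w₁ := follow L₁ f₁ y
    let w₂ := follow L₂ f₂ y
    let h : ℕ → H := fun i => (wordVal ν (w₁ i)).1
    let g : ℕ → K := fun i => (wordVal ν (w₂ i)).2
    have hw₁ : ∀ i, wordVal ν (w₁ (i + 1)) = _ := wordVal_follow_succ L₁ hL₁ x hf₁
    have hw₂ : ∀ i, wordVal ν (w₂ (i + 1)) = _ := wordVal_follow_succ L₂ hL₂ x hf₂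
    have hh : ∀ i, wordVal ν (w₁ i) = (h i, 1) := fun i => by
      refine Prod.ext rfl ?_
      induction i with
      | zero => exact congrArg Prod.snd (wordVal_nil (σ := ν))
      | succ i ih =>
        rw [hw₁, Prod.snd_mul, mul_one]
        exact ih
    have hg : ∀ i, wordVal ν (w₂ i) = (1, g i) := fun i => by
      refine Prod.ext ?_ rfl
      induction i with
      | zero => exact congrArg Prod.fst (wordVal_nil (σ := ν))
      | succ i ih =>
        rw [hw₂, Prod.fst_mul, mul_one]
        exact ih
    have hval : ∀ i j, wordVal ν (w₁ i ++ w₂ j) = (h i, g j) := fun i j => by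
      rw [wordVal_append, hh, hg, Prod.mk_mul_mk, mul_one, one_mul]
    have hs₁ : ∀ i j, (h i, g j) * (T₁ (f₁ (x (h i, g j))), 1) = (h (i + 1), g j) := by
      intro i j
      have h1 := hw₁ i
      rw [show follow L₁ f₁ (confFun (x ∘ cover ν)) i = w₁ i from rfl, hh, hh,
        Prod.mk_mul_mk] at h1
      rw [hx'.left_const hτ (h i) (g j), Prod.mk_mul_mk, mul_one, (Prod.mk.inj h1).1]
    have hs₂ : ∀ i j, (h i, g j) * (1, T₂ (f₂ (x (h i, g j)))) = (h i, g (j + 1)) := by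
      intro i j
      have h1 := hw₂ j
      rw [show follow L₂ f₂ (confFun (x ∘ cover ν)) j = w₂ j from rfl, hg, hg,
        Prod.mk_mul_mk] at h1
      rw [hx'.right_const hσ (h i) (g j), Prod.mk_mul_mk, mul_one, (Prod.mk.inj h1).2]
    refine ⟨fun i => x (h i.unpair.1, g i.unpair.2) % n, ⟨fun i => Nat.mod_lt _
      (Nat.pos_of_ne_zero fun hn => ?_), fun i j => ?_, fun i j => ?_, fun i j => ?_⟩,
      fun i v => ⟨?_, ?_⟩⟩
    · have := (x 1).2
      simp [hn] at this
    · exact hx'.ok _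
    · have := hx'.hor (h i, g j)
      rw [hs₁] at this
      simpa only [Nat.unpair_pair] using this
    · have := hx'.ver (h i, g j)
      rw [hs₂] at this
      simpa only [Nat.unpair_pair] using this
    · rintro ⟨k, ⟨⟨u₁, u₂⟩, s⟩, h1, h2, h3, rfl⟩
      dsimp only at h1 h2 h3 ⊢
      rw [← (getElem?_pref_eq.1 h3).2, ← eq_follow_of_followPref L₁ h1,
        ← eq_follow_of_followPref L₂ h2, hy, confFun_encode, Nat.add_sub_cancel]
      exact congrArg (fun a => (x a : ℕ) % n) (hval _ _).symm
    · rintro rfl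
      obtain ⟨k₁, hk₁⟩ := exists_followPref_eq L₁ f₁ y i.unpair.1
      obtain ⟨k₂, hk₂⟩ := exists_followPref_eq L₂ f₂ y i.unpair.2
      refine ⟨max (max k₁ k₂) (Encodable.encode (w₁ i.unpair.1 ++ w₂ i.unpair.2) + 1),
        ((w₁ i.unpair.1, w₂ i.unpair.2), y (Encodable.encode (w₁ i.unpair.1 ++ w₂ i.unpair.2))),
        hk₁ _ (by omega), hk₂ _ (by omega),
        getElem?_pref ((Nat.lt_succ_self _).trans_le (le_max_right _ _)), ?_⟩
      dsimp only
      rw [hy, confFun_encode, Nat.add_sub_cancel, hval]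

/-! ### Configurations from oracles -/

theorem dec_pref_orc {z : ℕ → ℕ} {k i : ℕ} (h : i < k) : orc (pref z k) i = dec (z i = 1) := by
  rw [orc, getElem?_pref h, Option.getD_some]

/-- A configuration each of whose letters is computed from a bounded prefix of the oracle is
computable from the oracle. -/
theorem baireLE_of_use {G : Type*} [Group G] {m n : ℕ} {ν : Fin m → G} {X : Set (G → Fin n)}
    {Q : Set (ℕ → ℕ)} {B : List (Fin m × Bool) → ℕ} {F : List ℕ × List (Fin m × Bool) → ℕ}
    (hB : Computable B) (hF : Computable F)
    (h : ∀ z ∈ Q, ∃ x ∈ X, ∀ w, (x (wordVal ν w) : ℕ) = F (pref z (B w), w)) :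
    BaireLE (mSet (pullback (cover ν) X)) Q := by
  let W := List (Fin m × Bool)
  refine BaireLE.of_semidec (R := fun l i v => ((Encodable.decode i : Option W) = none ∧ v = 0) ∨
    ∃ w : W, Encodable.decode i = some w ∧ B w ≤ l.length ∧ v = F (l.take (B w), w) + 1)
    (.or (.of_computable ?_) (.exists (.of_computable ?_))) fun z hz => ?_
  · exact C_dec_and (C_dec_eq (C_decode (Computable.fst.comp Computable.snd)) (C_const _))
      (C_dec_eq (Computable.snd.comp Computable.snd) (C_const _))
  · let α := (List ℕ × ℕ × ℕ) × W
    have hl : Computable fun q : α => q.1.1 := Computable.fst.comp Computable.fst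
    have h1 : Computable fun q : α => q.1.2 := Computable.snd.comp Computable.fst
    have hw : Computable fun q : α => q.2 := Computable.snd
    have hBw := hB.comp hw
    exact C_dec_and (C_dec_eq (C_decode (Computable.fst.comp h1)) (C_some hw))
      (C_dec_and (C_dec_le hBw (C_length hl)) (C_dec_eq (Computable.snd.comp h1)
        (Computable.succ.comp (hF.comp (C_pair (C_take hl hBw) hw)))))
  · obtain ⟨x, hx, hxw⟩ := h z hz
    refine ⟨_, ⟨_, ⟨x, hx, rfl⟩, rfl⟩, fun i v => ⟨?_, ?_⟩⟩
    · rintro ⟨k, ⟨h, rfl⟩ | ⟨w, h, hB, rfl⟩⟩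
      · exact confFun_of_decode_eq_none x h
      · rw [length_pref] at hB
        rw [take_pref z hB, ← hxw]
        exact confFun_of_decode x h
    · rintro rfl
      rcases h : (Encodable.decode i : Option W) with _ | w
      · exact ⟨0, .inl ⟨rfl, confFun_of_decode_eq_none x h⟩⟩
      · refine ⟨B w, .inr ⟨w, rfl, (length_pref _ _).ge, ?_⟩⟩
        rw [take_pref z le_rfl, ← hxw]
        exact confFun_of_decode x h

theorem add_mul_lt_mul {a b m n : ℕ} (ha : a < m) (hb : b < n) : a + m * b < m * n := by
  have := Nat.mul_le_mul_left m (Nat.succ_le_of_lt hb)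
  rw [Nat.mul_succ] at this
  omega

/-- A configuration of tiles on the product of two groups with height functions, computed from
an oracle. -/
theorem exists_tileSubshift {H K : Type*} [Group H] [Group K] [Infinite H] [Infinite K]
    {k r m : ℕ} {σ : Fin k → H} (hσ : IsSymmGen σ) {τ : Fin r → K} (hτ : IsSymmGen τ)
    (hwpH : DecidableWordProblem σ) (hwpK : DecidableWordProblem τ) (ν : Fin m → H × K)
    {Q : Set (ℕ → ℕ)} {p : List Instr} (hQ : Q ⊆ cantorSpace)
    (hp : ∀ z : ℕ → Bool, (∀ n, Instr.prog p (Instr.run z (Instr.prog p) n).1 ≠ .halt) ↔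
      (fun n => (z n).toNat) ∈ Q) :
    ∃ (T₁ : ℕ → H) (T₂ : ℕ → K) (tl : ℕ → Tile) (n n₁ n₂ : ℕ),
      BaireLE (mSet (pullback (cover ν) (tileSubshift (Instr.prog p) σ τ T₁ T₂ tl n n₁ n₂))) Q := by
  obtain ⟨d₁, v₁, s₁, n₁, T₁, hd₁, hv₁, hs₁, hsn₁, hT₁⟩ := exists_height hσ hwpH
  obtain ⟨d₂, v₂, s₂, n₂, T₂, hd₂, hv₂, hs₂, hsn₂, hT₂⟩ := exists_height hτ hwpK
  obtain ⟨φ, hφ, hφw⟩ := exists_word_map (MonoidHom.fst H K) ν hσ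
  obtain ⟨ψ, hψ, hψw⟩ := exists_word_map (MonoidHom.snd H K) ν hτ
  have lift₁ : ∀ {f : H → ℕ}, (Computable fun w => f (wordVal σ w)) →
      Computable fun w => f (wordVal ν w).1 := fun hf =>
    (hf.comp hφ).of_eq fun w => by rw [hφw]; rfl
  have lift₂ : ∀ {f : K → ℕ}, (Computable fun w => f (wordVal τ w)) →
      Computable fun w => f (wordVal ν w).2 := fun hf =>
    (hf.comp hψ).of_eq fun w => by rw [hψw]; rfl
  obtain ⟨n, c, tl, hc, hcn, hct⟩ := finComp_posTile (α := List ℕ × ℕ × ℕ) p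
    Computable.fst (Computable.fst.comp Computable.snd) (Computable.snd.comp Computable.snd)
  let M : H × K → ℕ := fun g => v₁ g.1 + d₁ g.1 + v₂ g.2 + d₂ g.2 + 3
  let px : H × K → ℕ := fun g => v₁ g.1 + shiftNat (M g) - d₁ g.1
  let py : H × K → ℕ := fun g => v₂ g.2 + shiftNat (M g) - d₂ g.2
  let B : H × K → ℕ := fun g => 2 ^ (px g + py g + 2)
  let a : (ℕ → ℕ) → H × K → ℕ := fun z g =>
    c (pref z (B g), px g, py g) + n * (s₁ g.1 + n₁ * s₂ g.2)
  have han : ∀ z g, a z g < n * (n₁ * n₂) := fun z g =>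
    add_mul_lt_mul (hcn _) (add_mul_lt_mul (hsn₁ _) (hsn₂ _))
  let x : (ℕ → ℕ) → H × K → Fin (n * (n₁ * n₂)) := fun z g => ⟨a z g, han z g⟩
  have hx : ∀ z ∈ Q, x z ∈ tileSubshift (Instr.prog p) σ τ T₁ T₂ tl n n₁ n₂ := by
    intro z hz
    let q : ℕ → Bool := fun i => dec (z i = 1)
    have hq : ∀ i, Instr.prog p (Instr.run q (Instr.prog p) i).1 ≠ .halt := by
      rw [hp]
      convert hz using 1
      funext i
      rcases Nat.le_one_iff_eq_zero_or_eq_one.1 (hQ hz i) with h | h <;> simp [q, h]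
    have hn : ∀ g, 0 < n := fun g => (Nat.zero_le _).trans_lt (hcn (pref z (B g), px g, py g))
    have e₁ : ∀ g, a z g / n % n₁ = s₁ g.1 := fun g => by
      rw [Nat.add_mul_div_left _ _ (hn g), Nat.div_eq_of_lt (hcn _), zero_add,
        Nat.add_mul_mod_self_left, Nat.mod_eq_of_lt (hsn₁ _)]
    have e₂ : ∀ g, a z g / n / n₁ = s₂ g.2 := fun g => by
      rw [Nat.add_mul_div_left _ _ (hn g), Nat.div_eq_of_lt (hcn _), zero_add,
        Nat.add_mul_div_left _ _ ((Nat.zero_le _).trans_lt (hsn₁ g.1)),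
        Nat.div_eq_of_lt (hsn₁ _), zero_add]
    have e₃ : ∀ g, tl (a z g % n) = intTile q p ((v₁ g.1 : ℤ) - d₁ g.1) (v₂ g.2 - d₂ g.2) := by
      intro g
      have hM := le_shiftNat (M g)
      rw [Nat.add_mul_mod_self_left, Nat.mod_eq_of_lt (hcn _), ← hct,
        intTile_eq (M := M g) (by dsimp only [M]; omega)]
      have h1 : ((v₁ g.1 : ℤ) - d₁ g.1 + shiftNat (M g)).toNat = px g := by
        dsimp only [px, M] at hM ⊢
        omega
      have h2 : ((v₂ g.2 : ℤ) - d₂ g.2 + shiftNat (M g)).toNat = py g := by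
        dsimp only [py, M] at hM ⊢
        omega
      rw [h1, h2]
      exact posTile_congr p fun i hi => dec_pref_orc hi
    refine ⟨fun g => ?_, fun g i => ?_, fun g i => ?_, fun g => ?_, fun g => ?_⟩
    · exact e₃ g ▸ ok_intTile hq _ _
    · change a z _ / n % n₁ = a z _ / n % n₁
      rw [e₁, e₁, Prod.fst_mul, mul_one]
    · change a z _ / n / n₁ = a z _ / n / n₁
      rw [e₂, e₂, Prod.snd_mul, mul_one]
    · change (tl (a z g % n)).E = (tl (a z (g * (T₁ (a z g / n % n₁), 1)) % n)).W
      rw [e₃, e₃, e₁, intTile_hor, Prod.fst_mul, Prod.snd_mul, mul_one]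
      congr 2
      have := hT₁ g.1
      dsimp only
      omega
    · change (tl (a z g % n)).N = (tl (a z (g * (1, T₂ (a z g / n / n₁))) % n)).S
      rw [e₃, e₃, e₂, intTile_ver, Prod.fst_mul, Prod.snd_mul, mul_one]
      congr 2
      have := hT₂ g.2
      dsimp only
      omega
  refine ⟨T₁, T₂, tl, n, n₁, n₂, ?_⟩
  let W := List (Fin m × Bool)
  have cM : Computable fun w : W => M (wordVal ν w) :=
    C_add (C_add (C_add (C_add (lift₁ hv₁) (lift₁ hd₁)) (lift₂ hv₂)) (lift₂ hd₂)) (C_const 3)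
  have cS : Computable fun w : W => shiftNat (M (wordVal ν w)) :=
    C_div (C_sub (C_pow (C_const 4) cM) (C_const 1)) (C_const 3)
  have cx : Computable fun w : W => px (wordVal ν w) := C_sub (C_add (lift₁ hv₁) cS) (lift₁ hd₁)
  have cy : Computable fun w : W => py (wordVal ν w) := C_sub (C_add (lift₂ hv₂) cS) (lift₂ hd₂)
  have cB : Computable fun w : W => B (wordVal ν w) :=
    C_pow (C_const 2) (C_add (C_add cx cy) (C_const 2))
  have cs : Computable fun w : W =>
      n * (s₁ (wordVal ν w).1 + n₁ * s₂ (wordVal ν w).2) :=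
    C_mul (C_const n) (C_add (lift₁ hs₁) (C_mul (C_const n₁) (lift₂ hs₂)))
  have ct : Computable fun q : List ℕ × W =>
      c (q.1, px (wordVal ν q.2), py (wordVal ν q.2)) :=
    hc.comp (C_pair Computable.fst (C_pair (cx.comp Computable.snd) (cy.comp Computable.snd)))
  exact baireLE_of_use cB (C_add ct (cs.comp Computable.snd)) fun z hz =>
    ⟨x z, hx z hz, fun _ => rfl⟩

theorem BaireLE.nonempty {P Q : Set (ℕ → ℕ)} (h : BaireLE P Q) (hQ : Q.Nonempty) :
    P.Nonempty := by
  obtain ⟨φ, -, -, h⟩ := h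
  obtain ⟨x, hx⟩ := hQ
  obtain ⟨y, hy, -⟩ := h x hx
  exact ⟨y, hy⟩

/-- If `H` and `K` are infinite finitely generated groups with decidable word problem,
then `M_SFT(H × K)` is the set of all `Π⁰₁` Medvedev degrees. -/
theorem statement13 {H K : Type*} [Group H] [Group K] [Infinite H] [Infinite K]
    {k r m : ℕ} (σ : Fin k → H) (hσ : IsSymmGen σ) (τ : Fin r → K) (hτ : IsSymmGen τ)
    (hwpH : DecidableWordProblem σ) (hwpK : DecidableWordProblem τ)
    (ν : Fin m → H × K) (hν : IsSymmGen ν) :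
    ∀ P : Set (ℕ → ℕ), IsSFTDeg ν P ↔ IsPi01Deg P := by
  refine fun P => ⟨fun ⟨n, X, hX, hne, h, h'⟩ => ?_, fun ⟨Q, hQ, hne, h, h'⟩ => ?_⟩
  · obtain ⟨Q, hQ, hQne, h₁, h₂⟩ := exists_isPi01Cantor_of_isSFT hν (.prod hσ hτ hwpH hwpK ν) hX hne
    exact ⟨Q, hQ, hQne, h'.trans h₁, h₂.trans h⟩
  · obtain ⟨p, hp⟩ := hQ.exists_machine
    have hQc : Q ⊆ cantorSpace := by
      obtain ⟨f, -, rfl⟩ := hQ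
      exact Set.sdiff_subset
    obtain ⟨T₁, T₂, tl, n, n₁, n₂, hle⟩ := exists_tileSubshift hσ hτ hwpH hwpK ν hQc hp
    have hle' := (baireLE_tilingSet hp n tl).trans
      (baireLE_tileSubshift hσ hτ hν (Instr.prog p) T₁ T₂ tl n n₁ n₂)
    obtain ⟨_, _, ⟨x, hx, -⟩, -⟩ := hle.nonempty hne
    exact ⟨_, _, isSFT_tileSubshift _ _ _ _ _ _ _ _ _, ⟨x, hx⟩, hle.trans h', h.trans hle'⟩

end MedvedevFormal
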